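/- arXiv:1103.4093 — 2 statements merged into one kernel-verified Lean document; each statement's English description precedes it below -/
import Mathlib

section
/- Let A and B be arbitrary finitely generated infinite groups and let G = A ∗ B be their free product. Then for every n ≥ 1, n randomly chosen elements of G are generically a free basis of the subgroup they generate; that is, G satisfies the strong generic free group property with respect to every finite generating set of G. -/
open Filter Set

/-- The ball of radius `m` in a group with respect to a set `S`: the elements expressible as
a product of at most `m` elements of `S ∪ S⁻¹`. -/
def wordBall {G : Type*} [Group G] (S : Set G) (m : ℕ) : Set G :=
  {g | ∃ l : List G, l.length ≤ m ∧ (∀ x ∈ l, x ∈ S ∨ x⁻¹ ∈ S) ∧ l.prod = g}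

/-- A tuple `(g₁, …, gₙ)` is a free basis tuple if the induced homomorphism from the free
group of rank `n` sending the `i`-th free generator to `gᵢ` is injective. -/
def IsFreeBasisTuple {G : Type*} [Group G] {n : ℕ} (x : Fin n → G) : Prop :=
  Function.Injective (FreeGroup.lift x)

/-- A group has the strong generic free group property with respect to a generating set `S`
if for every `n ≥ 1` the proportion of free basis `n`-tuples in the ball of radius `m`
tends to `1` as `m → ∞`. -/
def StrongGenericFreeGroupProperty {G : Type*} [Group G] (S : Set G) : Prop :=
  ∀ n : ℕ, 1 ≤ n →
    Filter.Tendsto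
      (fun m : ℕ =>
        ({x : Fin n → G | (∀ i, x i ∈ wordBall S m) ∧ IsFreeBasisTuple x}.ncard : ℝ) /
          ((wordBall S m).ncard : ℝ) ^ n)
      Filter.atTop (nhds 1)

/-- A group has the strong generic free group property with respect to every finite
generating set. -/
def HasStrongGenericFreeGroupProperty (G : Type*) [Group G] : Prop :=
  ∀ S : Set G, S.Finite → Subgroup.closure S = ⊤ → StrongGenericFreeGroupProperty S

namespace Monoid.CoprodI

section NormalForm

variable {ι : Type*} {M : ι → Type*} [∀ i, Group (M i)]

/-- The element of the free product represented by a list of syllables. -/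
def listProd (l : List (Σ i, M i)) : CoprodI M := (l.map fun s => of s.2).prod

@[simp] lemma listProd_nil : listProd ([] : List (Σ i, M i)) = 1 := rfl

@[simp] lemma listProd_cons (s : Σ i, M i) (l : List (Σ i, M i)) :
    listProd (s :: l) = of s.2 * listProd l := by simp [listProd]

@[simp] lemma listProd_append (l r : List (Σ i, M i)) :
    listProd (l ++ r) = listProd l * listProd r := by simp [listProd]

/-- A list of syllables is reduced if it has no trivial syllable and adjacent syllables lie in
different factors. -/
structure IsReduced (l : List (Σ i, M i)) : Prop where
  ne_one : ∀ s ∈ l, s.2 ≠ 1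
  chain : l.IsChain fun s t => s.1 ≠ t.1

lemma isReduced_nil : IsReduced ([] : List (Σ i, M i)) := ⟨by simp, by simp⟩

lemma isReduced_append {l r : List (Σ i, M i)} :
    IsReduced (l ++ r) ↔ IsReduced l ∧ IsReduced r ∧
      ∀ x ∈ l.getLast?, ∀ y ∈ r.head?, x.1 ≠ y.1 := by
  constructor
  · rintro ⟨h, h'⟩
    rw [List.isChain_append] at h'
    exact ⟨⟨fun s hs => h s (by simp [hs]), h'.1⟩, ⟨fun s hs => h s (by simp [hs]), h'.2.1⟩,
      h'.2.2⟩
  · rintro ⟨⟨h1, h2⟩, ⟨h3, h4⟩, h5⟩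
    refine ⟨fun s hs => ?_, List.isChain_append.2 ⟨h2, h4, h5⟩⟩
    rcases List.mem_append.1 hs with hs | hs
    exacts [h1 s hs, h3 s hs]

lemma isReduced_singleton {s : Σ i, M i} : IsReduced [s] ↔ s.2 ≠ 1 :=
  ⟨fun h => h.ne_one s (by simp), fun h => ⟨by simpa using h, by simp⟩⟩

lemma isReduced_cons {s : Σ i, M i} {l : List (Σ i, M i)} :
    IsReduced (s :: l) ↔ s.2 ≠ 1 ∧ IsReduced l ∧ ∀ y ∈ l.head?, s.1 ≠ y.1 := by
  rw [← List.singleton_append, isReduced_append, isReduced_singleton]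
  simp

lemma IsReduced.left {l r : List (Σ i, M i)} (h : IsReduced (l ++ r)) : IsReduced l :=
  (isReduced_append.1 h).1

lemma IsReduced.right {l r : List (Σ i, M i)} (h : IsReduced (l ++ r)) : IsReduced r :=
  (isReduced_append.1 h).2.1

/-- Replacing a syllable by another nontrivial syllable of the same factor keeps a list reduced. -/
lemma isReduced_append_cons_of_left_right {l r : List (Σ i, M i)} {i : ι} {a b c : M i}
    (hl : IsReduced (l ++ [⟨i, a⟩])) (hr : IsReduced (⟨i, b⟩ :: r)) (hc : c ≠ 1) :
    IsReduced (l ++ ⟨i, c⟩ :: r) := by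
  rw [isReduced_append] at hl
  rw [isReduced_cons] at hr
  rw [isReduced_append, isReduced_cons]
  simp_all

/-- The formal inverse of a list of syllables. -/
def invRev (l : List (Σ i, M i)) : List (Σ i, M i) := (l.map fun s => ⟨s.1, s.2⁻¹⟩).reverse

@[simp] lemma invRev_nil : invRev ([] : List (Σ i, M i)) = [] := rfl

@[simp] lemma invRev_cons (s : Σ i, M i) (l : List (Σ i, M i)) :
    invRev (s :: l) = invRev l ++ [⟨s.1, s.2⁻¹⟩] := by simp [invRev]

@[simp] lemma invRev_append (l r : List (Σ i, M i)) :
    invRev (l ++ r) = invRev r ++ invRev l := by simp [invRev]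

@[simp] lemma length_invRev (l : List (Σ i, M i)) : (invRev l).length = l.length := by
  simp [invRev]

@[simp] lemma invRev_invRev (l : List (Σ i, M i)) : invRev (invRev l) = l := by
  induction l with
  | nil => rfl
  | cons s l ih => simp [ih]

lemma listProd_invRev (l : List (Σ i, M i)) : listProd (invRev l) = (listProd l)⁻¹ := by
  induction l with
  | nil => simp
  | cons s l ih => simp [ih]

lemma IsReduced.invRev {l : List (Σ i, M i)} (h : IsReduced l) : IsReduced (invRev l) := by
  refine ⟨fun s hs => ?_, ?_⟩
  · simp only [CoprodI.invRev, List.mem_reverse, List.mem_map] at hs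
    obtain ⟨t, ht, rfl⟩ := hs
    simpa using h.ne_one t ht
  · rw [CoprodI.invRev, List.isChain_reverse, List.isChain_map]
    exact h.chain.imp fun _ _ h => h.symm

open Classical in
/-- The normal form of an element of a free product. -/
noncomputable def normalForm (g : CoprodI M) : List (Σ i, M i) := (Word.equiv g).toList

lemma isReduced_normalForm (g : CoprodI M) : IsReduced (normalForm g) := by
  classical exact ⟨(Word.equiv g).ne_one, (Word.equiv g).chain_ne⟩

@[simp] lemma listProd_normalForm (g : CoprodI M) : listProd (normalForm g) = g := by
  classical exact Word.equiv.symm_apply_apply g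

lemma IsReduced.normalForm_listProd {l : List (Σ i, M i)} (h : IsReduced l) :
    normalForm (listProd l) = l := by
  classical exact congrArg Word.toList (Word.equiv.apply_symm_apply ⟨l, h.ne_one, h.chain⟩)

lemma normalForm_eq_of_isReduced {l : List (Σ i, M i)} {g : CoprodI M} (h : IsReduced l)
    (e : listProd l = g) : normalForm g = l := by
  rw [← e, h.normalForm_listProd]

lemma normalForm_injective : Function.Injective (normalForm : CoprodI M → _) := fun g h e => by
  rw [← listProd_normalForm g, e, listProd_normalForm]

@[simp] lemma normalForm_one : normalForm (1 : CoprodI M) = [] :=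
  normalForm_eq_of_isReduced isReduced_nil rfl

lemma normalForm_inv (g : CoprodI M) : normalForm g⁻¹ = invRev (normalForm g) :=
  normalForm_eq_of_isReduced (isReduced_normalForm g).invRev (by simp [listProd_invRev])

lemma prefix_normalForm_mul_of {g : CoprodI M} {s : Σ i, M i} {p : List (Σ i, M i)}
    (hp : p <+: normalForm (g * of s.2)) :
    p <+: normalForm g ∨ p = normalForm (g * of s.2) := by
  obtain ⟨i, a⟩ := s
  by_cases ha : a = 1
  · left; simpa [ha] using hp
  have concat : normalForm (g * of a) = normalForm g ++ [⟨i, a⟩] →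
      p <+: normalForm g ∨ p = normalForm (g * of a) := fun h => by
    simp only [h, List.prefix_concat_iff] at hp ⊢
    exact hp.symm
  have hg := isReduced_normalForm g
  have hgp := listProd_normalForm g
  rcases List.eq_nil_or_concat (normalForm g) with h | ⟨q, ⟨j, c⟩, h⟩
  · refine concat (normalForm_eq_of_isReduced ?_ (by simp))
    rw [h, List.nil_append, isReduced_singleton]
    exact ha
  · rw [List.concat_eq_append] at h
    rw [h] at hg hgp
    by_cases hj : j = i
    · subst hj
      by_cases hc : c * a = 1
      · left
        have : normalForm (g * of a) = q := normalForm_eq_of_isReduced hg.left (by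
          rw [← hgp]
          simp [mul_assoc, ← map_mul, hc])
        rw [h]
        exact (this ▸ hp).trans (List.prefix_append _ _)
      · have : normalForm (g * of a) = q ++ [⟨j, c * a⟩] :=
          normalForm_eq_of_isReduced
            (isReduced_append_cons_of_left_right hg (hg.right) hc) (by
              rw [← hgp]
              simp [mul_assoc])
        simp only [this, List.prefix_concat_iff] at hp ⊢
        rw [h]
        exact hp.symm.imp_left fun h => h.trans (List.prefix_append _ _)
    · refine concat (normalForm_eq_of_isReduced ?_ (by simp))
      rw [h, isReduced_append, isReduced_singleton]
      exact ⟨hg, ha, by simpa using hj⟩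

/-- A path of syllables from `g` passes through every prefix of its endpoint which is not
a prefix of `g`. -/
lemma prefix_normalForm_mul_listProd {g : CoprodI M} {p l : List (Σ i, M i)}
    (hp : p <+: normalForm (g * listProd l)) :
    p <+: normalForm g ∨ ∃ l₁ l₂, l = l₁ ++ l₂ ∧ listProd p = g * listProd l₁ := by
  induction l using List.reverseRecOn with
  | nil => left; simpa using hp
  | append_singleton l s ih =>
    rw [listProd_append, ← mul_assoc] at hp
    simp only [listProd_cons, listProd_nil, mul_one] at hp
    rcases prefix_normalForm_mul_of hp with h | h
    · refine (ih h).imp_right ?_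
      rintro ⟨l₁, l₂, rfl, h'⟩
      exact ⟨l₁, l₂ ++ [s], by simp, h'⟩
    · exact Or.inr ⟨l ++ [s], [], by simp, by simp [h, mul_assoc]⟩

lemma exists_common_prefix_of_isReduced {l₁ l₂ : List (Σ i, M i)} (h₁ : IsReduced l₁)
    (h₂ : IsReduced l₂) :
    ∃ r, r <+: l₁ ∧ r <+: l₂ ∧ (l₁ = r ∨ ∃ d e, l₁ = r ++ d :: e ∧
      invRev e <+: normalForm ((listProd l₁)⁻¹ * listProd l₂)) := by
  induction l₁ generalizing l₂ with
  | nil => exact ⟨[], by simp⟩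
  | cons d e ih =>
    have hd := h₁.invRev
    rw [invRev_cons] at hd
    cases l₂ with
    | nil =>
      refine ⟨[], by simp, by simp, Or.inr ⟨d, e, rfl, ?_⟩⟩
      rw [listProd_nil, mul_one, ← listProd_invRev, h₁.invRev.normalForm_listProd, invRev_cons]
      exact List.prefix_append _ _
    | cons c f =>
      by_cases hdc : d = c
      · subst hdc
        obtain ⟨r, hr₁, hr₂, hr⟩ := ih (isReduced_cons.1 h₁).2.1 (isReduced_cons.1 h₂).2.1
        refine ⟨d :: r, by simpa using hr₁, by simpa using hr₂, ?_⟩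
        refine hr.imp (by simp) ?_
        rintro ⟨d', e', h, h'⟩
        refine ⟨d', e', by simp [h], ?_⟩
        simpa [mul_assoc] using h'
      · refine ⟨[], by simp, by simp, Or.inr ⟨d, e, rfl, ?_⟩⟩
        by_cases hi : d.1 = c.1
        · obtain ⟨i, d⟩ := d
          obtain ⟨j, c⟩ := c
          obtain rfl : i = j := hi
          have hne : d⁻¹ * c ≠ 1 := fun h => hdc (by rw [inv_mul_eq_one.1 h])
          rw [normalForm_eq_of_isReduced (isReduced_append_cons_of_left_right hd h₂ hne)
            (by simp [listProd_invRev, mul_assoc])]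
          exact List.prefix_append _ _
        · have : IsReduced ((invRev e ++ [⟨d.1, d.2⁻¹⟩]) ++ c :: f) :=
            isReduced_append.2 ⟨hd, h₂, by simpa using hi⟩
          rw [normalForm_eq_of_isReduced this (by simp [listProd_invRev, mul_assoc])]
          simp

/-- Let `r` be the common prefix of the normal forms of `g` and `h`. Everything in `g` after the
syllable following `r` survives in `g⁻¹ * h`. -/
lemma exists_common_prefix (g h : CoprodI M) :
    ∃ r, r <+: normalForm g ∧ r <+: normalForm h ∧ (normalForm g = r ∨
      ∃ d e, normalForm g = r ++ d :: e ∧ invRev e <+: normalForm (g⁻¹ * h)) := by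
  simpa using exists_common_prefix_of_isReduced (isReduced_normalForm g) (isReduced_normalForm h)

end NormalForm

section WordLength

variable {G : Type*} [Group G]

/-- The word length of a group element with respect to a set `S`. -/
noncomputable def wordLength (S : Set G) (g : G) : ℕ := sInf {m | g ∈ wordBall S m}

variable {S : Set G}

lemma wordBall_mono {m k : ℕ} (h : m ≤ k) : wordBall S m ⊆ wordBall S k :=
  fun _ ⟨l, hl, hl'⟩ => ⟨l, hl.trans h, hl'⟩

lemma finite_wordBall (hS : S.Finite) (m : ℕ) : (wordBall S m).Finite := by
  induction m with
  | zero =>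
    refine (Set.finite_singleton (1 : G)).subset ?_
    rintro g ⟨l, hl, -, rfl⟩
    simp [List.length_eq_zero_iff.1 (Nat.le_zero.1 hl)]
  | succ m ih =>
    refine ((Set.finite_singleton (1 : G)).union
      (Set.Finite.image2 (· * ·) (hS.union hS.inv) ih)).subset ?_
    rintro g ⟨l, hl, hl', rfl⟩
    cases l with
    | nil => simp
    | cons s l =>
      refine Or.inr ⟨s, by simpa using hl' s (by simp), l.prod,
        ⟨l, by simpa using hl, fun x hx => hl' x (by simp [hx]), rfl⟩, by simp⟩

lemma wordLength_le_of_mem {g : G} {m : ℕ} (h : g ∈ wordBall S m) : wordLength S g ≤ m :=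
  Nat.sInf_le h

lemma wordLength_one : wordLength S (1 : G) = 0 :=
  Nat.le_zero.1 (wordLength_le_of_mem ⟨[], by simp⟩)

lemma mem_wordBall_wordLength (hS : Subgroup.closure S = ⊤) (g : G) :
    g ∈ wordBall S (wordLength S g) := by
  refine Nat.sInf_mem (s := {m | g ∈ wordBall S m}) ?_
  obtain ⟨l, hl, hl'⟩ := Submonoid.exists_list_of_mem_closure (s := S ∪ S⁻¹) (x := g) (by
    rw [← Subgroup.closure_toSubmonoid, hS]
    trivial)
  exact ⟨l.length, l, le_rfl, by simpa using hl, hl'⟩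

lemma mem_wordBall_iff (hS : Subgroup.closure S = ⊤) {g : G} {m : ℕ} :
    g ∈ wordBall S m ↔ wordLength S g ≤ m :=
  ⟨wordLength_le_of_mem, fun h => wordBall_mono h (mem_wordBall_wordLength hS g)⟩

lemma wordLength_mul_le (hS : Subgroup.closure S = ⊤) (g h : G) :
    wordLength S (g * h) ≤ wordLength S g + wordLength S h := by
  obtain ⟨l, hl, hl', e⟩ := mem_wordBall_wordLength hS g
  obtain ⟨r, hr, hr', e'⟩ := mem_wordBall_wordLength hS h
  refine wordLength_le_of_mem ⟨l ++ r, by simp; omega, ?_, by simp [e, e']⟩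
  intro x hx
  exact (List.mem_append.1 hx).elim (hl' x) (hr' x)

lemma wordLength_inv_le (hS : Subgroup.closure S = ⊤) (g : G) :
    wordLength S g⁻¹ ≤ wordLength S g := by
  obtain ⟨l, hl, hl', e⟩ := mem_wordBall_wordLength hS g
  refine wordLength_le_of_mem ⟨(l.map (·⁻¹)).reverse, by simpa using hl, ?_, ?_⟩
  · intro x hx
    simp only [List.mem_reverse, List.mem_map] at hx
    obtain ⟨y, hy, rfl⟩ := hx
    simpa [or_comm] using hl' y hy
  · rw [← e, List.prod_inv_reverse]

lemma wordLength_inv (hS : Subgroup.closure S = ⊤) (g : G) : wordLength S g⁻¹ = wordLength S g :=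
  (wordLength_inv_le hS g).antisymm (by simpa using wordLength_inv_le hS g⁻¹)

/-- Every element has a geodesic: it can be cut at any distance from the identity. -/
lemma exists_wordLength_split (hS : Subgroup.closure S = ⊤) {g : G} {i : ℕ}
    (hi : i ≤ wordLength S g) :
    ∃ h, wordLength S h = i ∧ wordLength S h + wordLength S (h⁻¹ * g) = wordLength S g := by
  obtain ⟨l, hl, hl', e⟩ := mem_wordBall_wordLength hS g
  have h₁ : wordLength S (l.take i).prod ≤ i :=
    wordLength_le_of_mem ⟨l.take i, by simp, fun x hx => hl' x (List.mem_of_mem_take hx), rfl⟩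
  have h₂ : wordLength S (l.drop i).prod ≤ wordLength S g - i :=
    wordLength_le_of_mem ⟨l.drop i, by simp; omega,
      fun x hx => hl' x (List.mem_of_mem_drop hx), rfl⟩
  have e' : (l.take i).prod * (l.drop i).prod = g := by rw [List.prod_take_mul_prod_drop, e]
  have h₃ := wordLength_mul_le hS (l.take i).prod (l.drop i).prod
  rw [e'] at h₃
  refine ⟨(l.take i).prod, by omega, ?_⟩
  rw [← eq_inv_mul_iff_mul_eq.2 e']
  omega

lemma ncard_wordBall_pos (hS : Subgroup.closure S = ⊤) (hfin : S.Finite) (m : ℕ) :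
    0 < (wordBall S m).ncard :=
  (Set.ncard_pos (finite_wordBall hfin m)).2
    ⟨1, (mem_wordBall_iff hS).2 (by simp [wordLength_one])⟩

lemma ncard_wordBall_add_le (hS : Subgroup.closure S = ⊤) (hfin : S.Finite) (m k : ℕ) :
    (wordBall S (m + k)).ncard ≤ (wordBall S m).ncard * (wordBall S k).ncard := by
  rw [← Set.ncard_prod]
  refine (Set.ncard_le_ncard (t := (fun p : G × G => p.1 * p.2) '' (wordBall S m ×ˢ wordBall S k))
    ?_ (((finite_wordBall hfin m).prod (finite_wordBall hfin k)).image _)).trans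
    (Set.ncard_image_le ((finite_wordBall hfin m).prod (finite_wordBall hfin k)))
  intro g hg
  rw [mem_wordBall_iff hS] at hg
  obtain ⟨h, h₁, h₂⟩ := exists_wordLength_split hS (min_le_right m (wordLength S g))
  refine ⟨(h, h⁻¹ * g), ⟨(mem_wordBall_iff hS).2 ?_, (mem_wordBall_iff hS).2 ?_⟩, by simp⟩ <;>
  grind

end WordLength

section Geometry

variable {ι : Type*} {M : ι → Type*} [∀ i, Group (M i)] {S : Set (CoprodI M)}

lemma wordLength_listProd_le (hS : Subgroup.closure S = ⊤) (l : List (Σ i, M i)) :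
    wordLength S (listProd l) ≤ (l.map fun s => wordLength S (of s.2)).sum := by
  induction l with
  | nil => simp [wordLength_one]
  | cons s l ih => simpa using (wordLength_mul_le hS _ _).trans (Nat.add_le_add_left ih _)

/-- Word length is additive up to a constant along normal forms. -/
lemma exists_wordLength_add_le (hS : Subgroup.closure S = ⊤) (hfin : S.Finite) :
    ∃ D, ∀ g p q, normalForm g = p ++ q →
      wordLength S (listProd p) + wordLength S (listProd q) ≤ wordLength S g + D := by
  obtain ⟨D, hD⟩ := ((hfin.union hfin.inv).image fun g : CoprodI M =>
    ((normalForm g).map fun s => wordLength S (of s.2)).sum).bddAbove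
  have hD' : ∀ s l₁ l₂, s ∈ S ∨ s⁻¹ ∈ S → normalForm s = l₁ ++ l₂ →
      wordLength S (listProd l₁) + wordLength S (listProd l₂) ≤ D := by
    intro s l₁ l₂ hs h
    have := hD ⟨s, by simpa using hs, rfl⟩
    simp only [h, List.map_append, List.sum_append] at this
    have h₁ := wordLength_listProd_le hS l₁
    have h₂ := wordLength_listProd_le hS l₂
    omega
  have key : ∀ (w : List (CoprodI M)) (p : List (Σ i, M i)), (∀ x ∈ w, x ∈ S ∨ x⁻¹ ∈ S) →
      p <+: normalForm w.prod →
      wordLength S (listProd p) + wordLength S ((listProd p)⁻¹ * w.prod) ≤ w.length + D := by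
    intro w p hw hp
    induction w using List.reverseRecOn with
    | nil =>
      obtain rfl : p = [] := by simpa using hp
      simp [wordLength_one]
    | append_singleton w s ih =>
      have hs : s ∈ S ∨ s⁻¹ ∈ S := hw s (by simp)
      have hs₁ : wordLength S s ≤ 1 :=
        wordLength_le_of_mem ⟨[s], by simp, by simpa using hs, by simp⟩
      have hw' : ∀ x ∈ w, x ∈ S ∨ x⁻¹ ∈ S := fun x hx => hw x (by simp [hx])
      simp only [List.prod_append, List.prod_singleton, List.length_append, List.length_singleton]
        at hp ⊢
      rw [← listProd_normalForm s] at hp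
      rcases prefix_normalForm_mul_listProd hp with h | ⟨l₁, l₂, h, h'⟩
      · have h₁ := ih hw' h
        have h₂ := wordLength_mul_le hS ((listProd p)⁻¹ * w.prod) s
        rw [mul_assoc] at h₂
        omega
      · have h₁ := hD' s l₁ l₂ hs h
        have h₂ : wordLength S w.prod ≤ w.length := wordLength_le_of_mem ⟨w, le_rfl, hw', rfl⟩
        have h₃ := wordLength_mul_le hS w.prod (listProd l₁)
        have h₄ : (listProd p)⁻¹ * (w.prod * s) = listProd l₂ := by
          rw [h', ← listProd_normalForm s, h, listProd_append]
          group
        rw [h₄, h']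
        omega
  refine ⟨D, fun g p q h => ?_⟩
  obtain ⟨w, hw, hw', rfl⟩ := mem_wordBall_wordLength hS g
  have := key w p hw' (h ▸ List.prefix_append p q)
  have h' : (listProd p)⁻¹ * w.prod = listProd q := by
    rw [← listProd_normalForm w.prod, h, listProd_append, inv_mul_cancel_left]
  rw [h'] at this
  omega

/-- Balls are finite, so syllable length is bounded on each of them. -/
lemma exists_length_normalForm_le (hS : Subgroup.closure S = ⊤) (hfin : S.Finite) (R : ℕ) :
    ∃ k, ∀ g, wordLength S g ≤ R → (normalForm g).length ≤ k := by
  obtain ⟨k, hk⟩ := ((finite_wordBall hfin R).image fun g => (normalForm g).length).bddAbove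
  exact ⟨k, fun g hg => hk ⟨g, (mem_wordBall_iff hS).2 hg, rfl⟩⟩

lemma exists_le_wordLength_listProd (hS : Subgroup.closure S = ⊤) (hfin : S.Finite) (R : ℕ) :
    ∃ k, ∀ w : List (Σ i, M i), IsReduced w → k ≤ w.length → R ≤ wordLength S (listProd w) := by
  obtain ⟨k, hk⟩ := exists_length_normalForm_le hS hfin R
  refine ⟨k + 1, fun w hw h => ?_⟩
  by_contra! h'
  have := hk _ h'.le
  rw [hw.normalForm_listProd] at this
  omega

/-- Points on a geodesic ending at an element with few syllables have few syllables. -/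
lemma exists_length_normalForm_le_of_geodesic (hS : Subgroup.closure S = ⊤) (hfin : S.Finite)
    (L : ℕ) : ∃ L', ∀ x g, (normalForm x).length ≤ L →
      wordLength S g + wordLength S (g⁻¹ * x) = wordLength S x → (normalForm g).length ≤ L' := by
  obtain ⟨D, hD⟩ := exists_wordLength_add_le hS hfin
  obtain ⟨k, hk⟩ := exists_length_normalForm_le hS hfin D
  refine ⟨L + 1 + k, fun x g hx hg => ?_⟩
  obtain ⟨r, hr₁, hr₂, hr⟩ := exists_common_prefix g x
  have hrL : r.length ≤ L := hr₂.length_le.trans hx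
  rcases hr with hr | ⟨d, e, hde, f, hf⟩
  · rw [hr]
    omega
  have he : IsReduced e := by
    have := isReduced_normalForm g
    rw [hde] at this
    exact (isReduced_cons.1 this.right).2.1
  have h₁ := hD g (r ++ [d]) e (by simp [hde])
  have h₂ := hD (g⁻¹ * x) (invRev e) f hf.symm
  have hge : g = listProd (r ++ [d]) * listProd e := by
    rw [← listProd_append, List.append_assoc, List.singleton_append, ← hde, listProd_normalForm]
  have hx' : listProd (r ++ [d]) * listProd f = x := by
    have : g⁻¹ * x = (listProd e)⁻¹ * listProd f := by
      rw [← listProd_invRev, ← listProd_append, hf, listProd_normalForm]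
    rw [inv_mul_eq_iff_eq_mul] at this
    rw [this, hge]
    group
  have h₃ := wordLength_mul_le hS (listProd (r ++ [d])) (listProd f)
  rw [hx'] at h₃
  rw [listProd_invRev, wordLength_inv hS] at h₂
  have h₄ := hk (listProd e) (by omega)
  rw [he.normalForm_listProd] at h₄
  rw [hde]
  simp
  omega

end Geometry

section Growth

variable {ι : Type*} {M : ι → Type*} [∀ i, Group (M i)] {S : Set (CoprodI M)}

/-- Finitely many syllables suffice to extend every normal form in two ways. -/
lemma exists_finite_extensions (M : ι → Type*) [∀ i, Group (M i)] [Nontrivial ι]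
    [∀ i, Infinite (M i)] :
    ∃ F : Set (Σ i, M i), F.Finite ∧ ∀ l : List (Σ i, M i), IsReduced l →
      ∃ t : Bool → Σ i, M i, Function.Injective t ∧
        ∀ β, t β ∈ F ∧ IsReduced (l ++ [t β]) := by
  obtain ⟨i, j, hij⟩ := exists_pair_ne ι
  have h : ∀ i, ∃ a b : M i, a ≠ 1 ∧ b ≠ 1 ∧ a ≠ b := by
    intro i
    obtain ⟨a, ha⟩ := Set.Finite.exists_notMem (Set.finite_singleton (1 : M i))
    obtain ⟨b, hb⟩ := Set.Finite.exists_notMem (Set.toFinite {1, a})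
    simp only [Set.mem_singleton_iff, Set.mem_insert_iff, not_or] at ha hb
    exact ⟨a, b, ha, hb.1, fun h => hb.2 h.symm⟩
  choose a b ha hb hab using h
  have key : ∀ (k : ι) (l : List (Σ i, M i)), IsReduced l → (∀ x ∈ l.getLast?, x.1 ≠ k) →
      Function.Injective (fun β => cond β ⟨k, a k⟩ ⟨k, b k⟩ : Bool → Σ i, M i) ∧
      ∀ β, IsReduced (l ++ [cond β ⟨k, a k⟩ ⟨k, b k⟩]) := by
    intro k l hl hlk
    refine ⟨?_, fun β => isReduced_append.2 ⟨hl, ?_, ?_⟩⟩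
    · rintro (_ | _) (_ | _) h <;> simp_all [eq_comm]
    · cases β <;> simp [isReduced_singleton, ha, hb]
    · cases β <;> simpa using hlk
  refine ⟨{⟨i, a i⟩, ⟨i, b i⟩, ⟨j, a j⟩, ⟨j, b j⟩}, Set.toFinite _, fun l hl => ?_⟩
  by_cases hi : ∀ x ∈ l.getLast?, x.1 ≠ i
  · exact ⟨_, (key i l hl hi).1, fun β => ⟨by cases β <;> simp, (key i l hl hi).2 β⟩⟩
  · have hj : ∀ x ∈ l.getLast?, x.1 ≠ j := by
      push Not at hi
      obtain ⟨x, hx, rfl⟩ := hi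
      intro y hy
      rw [Option.mem_unique hy hx]
      exact hij
    exact ⟨_, (key j l hl hj).1, fun β => ⟨by cases β <;> simp, (key j l hl hj).2 β⟩⟩

/-- Any two normal forms can be joined by one of finitely many connecting words. -/
lemma exists_finite_connectors (M : ι → Type*) [∀ i, Group (M i)] [Nontrivial ι]
    [∀ i, Infinite (M i)] :
    ∃ T : Set (List (Σ i, M i)), T.Finite ∧ ∀ g h : CoprodI M,
      ∃ t ∈ T, IsReduced (normalForm g ++ t ++ normalForm h) := by
  obtain ⟨F, hF, hF'⟩ := exists_finite_extensions M
  refine ⟨(fun s => [s]) '' F ∪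
      (fun p : (Σ i, M i) × (Σ i, M i) => p.1 :: invRev [p.2]) '' (F ×ˢ F),
    (hF.image _).union ((hF.prod hF).image _), fun g h => ?_⟩
  obtain ⟨t, -, ht⟩ := hF' _ (isReduced_normalForm g)
  obtain ⟨htF, htr⟩ := ht true
  by_cases hs : IsReduced ((normalForm g ++ [t true]) ++ normalForm h)
  · exact ⟨_, Or.inl ⟨_, htF, rfl⟩, hs⟩
  obtain ⟨u, -, hu⟩ := hF' _ ((isReduced_normalForm h).invRev)
  obtain ⟨huF, hur⟩ := hu true
  refine ⟨_, Or.inr ⟨(t true, u true), ⟨htF, huF⟩, rfl⟩, ?_⟩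
  have hur' := hur.invRev
  rw [invRev_append, invRev_invRev] at hur'
  have : IsReduced ((normalForm g ++ [t true]) ++ (invRev [u true] ++ normalForm h)) := by
    refine isReduced_append.2 ⟨htr, hur', ?_⟩
    rw [isReduced_append] at hs
    simp only [htr, isReduced_normalForm, true_and, List.getLast?_concat] at hs
    push Not at hs
    obtain ⟨x, hx, y, hy, hxy⟩ := hs
    obtain rfl : t true = x := by simpa using hx
    intro z hz w hw
    obtain rfl : t true = z := by simpa using hz
    obtain rfl : (⟨(u true).1, (u true).2⁻¹⟩ : Σ i, M i) = w := by simpa using hw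
    rw [hxy]
    have := (isReduced_append.1 hur').2.2 ⟨(u true).1, (u true).2⁻¹⟩ (by simp) y hy
    exact this.symm
  simpa using this

variable [Nontrivial ι] [∀ i, Infinite (M i)]

lemma exists_two_mul_ncard_wordBall_le (hS : Subgroup.closure S = ⊤) (hfin : S.Finite) :
    ∃ K, ∀ m, 2 * (wordBall S m).ncard ≤ (wordBall S (m + K)).ncard := by
  obtain ⟨F, hF, hF'⟩ := exists_finite_extensions M
  obtain ⟨K, hK⟩ := (hF.image fun s => wordLength S (of s.2)).bddAbove
  choose t ht ht' using fun g : CoprodI M => hF' _ (isReduced_normalForm g)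
  have hnf : ∀ g β, normalForm (g * of (t g β).2) = normalForm g ++ [t g β] := fun g β =>
    normalForm_eq_of_isReduced (ht' g β).2 (by simp)
  refine ⟨K, fun m => ?_⟩
  have := Set.ncard_prod (s := (Set.univ : Set Bool)) (t := wordBall S m)
  rw [Set.ncard_univ, Nat.card_eq_fintype_card, Fintype.card_bool] at this
  rw [← this]
  refine Set.ncard_le_ncard_of_injOn (fun p => p.2 * of (t p.2 p.1).2) ?_ ?_
    (finite_wordBall hfin _)
  · rintro ⟨β, g⟩ ⟨-, hg⟩
    rw [mem_wordBall_iff hS] at hg ⊢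
    exact (wordLength_mul_le hS _ _).trans (Nat.add_le_add hg (hK ⟨_, (ht' g β).1, rfl⟩))
  · rintro ⟨β, g⟩ - ⟨β', g'⟩ - h
    have h' := congrArg normalForm h
    simp only [hnf] at h'
    obtain ⟨h₁, h₂⟩ := List.append_inj' h' rfl
    obtain rfl := normalForm_injective h₁
    simp only [List.cons.injEq, and_true] at h₂
    rw [ht g h₂]

/-- Balls grow exponentially, with a rate that is uniform in the radius. -/
lemma exists_mul_ncard_wordBall_le (hS : Subgroup.closure S = ⊤) (hfin : S.Finite) (N : ℕ) :
    ∃ R, ∀ m, N * (wordBall S m).ncard ≤ (wordBall S (m + R)).ncard := by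
  obtain ⟨K, hK⟩ := exists_two_mul_ncard_wordBall_le hS hfin
  have key : ∀ j m, 2 ^ j * (wordBall S m).ncard ≤ (wordBall S (m + j * K)).ncard := by
    intro j m
    induction j with
    | zero => simp
    | succ j ih =>
      have := hK (m + j * K)
      rw [add_assoc, ← Nat.succ_mul] at this
      rw [pow_succ]
      linarith
  exact ⟨N * K, fun m => (Nat.mul_le_mul_right _ Nat.lt_two_pow_self.le).trans (key N m)⟩

/-- A set which embeds into a much smaller ball has small proportion. -/
lemma exists_mul_ncard_le_of_injOn (hS : Subgroup.closure S = ⊤) (hfin : S.Finite) (N : ℕ) :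
    ∃ R, ∀ (m : ℕ) (X : Set (CoprodI M)) (f : CoprodI M → CoprodI M), Set.InjOn f X →
      (∀ g ∈ X, wordLength S (f g) + R ≤ m) → N * X.ncard ≤ (wordBall S m).ncard := by
  obtain ⟨R, hR⟩ := exists_mul_ncard_wordBall_le hS hfin N
  refine ⟨R, fun m X f hf hX => ?_⟩
  rcases X.eq_empty_or_nonempty with rfl | ⟨g, hg⟩
  · simp
  have hm : m - R + R = m := by
    have := hX g hg
    omega
  have := hR (m - R)
  rw [hm] at this
  refine (Nat.mul_le_mul_left _ (Set.ncard_le_ncard_of_injOn f (fun x hx => ?_) hf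
    (finite_wordBall hfin (m - R)))).trans this
  rw [mem_wordBall_iff hS]
  have := hX x hx
  omega

/-- Few elements have a normal form starting with a given long word. -/
lemma exists_mul_ncard_prefix_le (hS : Subgroup.closure S = ⊤) (hfin : S.Finite) (N : ℕ) :
    ∃ k, ∀ (w : List (Σ i, M i)) (m : ℕ), k ≤ w.length →
      N * {g ∈ wordBall S m | w <+: normalForm g}.ncard ≤ (wordBall S m).ncard ∧
      N * {g ∈ wordBall S m | w <+: normalForm g⁻¹}.ncard ≤ (wordBall S m).ncard := by
  obtain ⟨D, hD⟩ := exists_wordLength_add_le hS hfin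
  obtain ⟨R, hR⟩ := exists_mul_ncard_le_of_injOn hS hfin N
  obtain ⟨k, hk⟩ := exists_le_wordLength_listProd hS hfin (R + D)
  have key : ∀ w m g, k ≤ w.length → wordLength S g ≤ m → w <+: normalForm g →
      wordLength S ((listProd w)⁻¹ * g) + R ≤ m := by
    rintro w m g hw hg ⟨q, hq⟩
    have h₁ := hD g w q hq.symm
    have h₂ := hk w (by have := isReduced_normalForm g; rw [← hq] at this; exact this.left) hw
    have : (listProd w)⁻¹ * g = listProd q := by
      rw [inv_mul_eq_iff_eq_mul, ← listProd_append, hq, listProd_normalForm]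
    rw [this]
    omega
  refine ⟨k, fun w m hw => ⟨hR m _ (fun g => (listProd w)⁻¹ * g) ?_ ?_,
    hR m _ (fun g => (listProd w)⁻¹ * g⁻¹) ?_ ?_⟩⟩
  · intro g _ h _ e
    simpa using e
  · rintro g ⟨hg, hg'⟩
    exact key w m g hw ((mem_wordBall_iff hS).1 hg) hg'
  · intro g _ h _ e
    simpa using e
  · rintro g ⟨hg, hg'⟩
    refine key w m g⁻¹ hw ?_ hg'
    rw [wordLength_inv hS]
    exact (mem_wordBall_iff hS).1 hg

/-- Few elements have a normal form of the shape `w u w⁻¹` with `w` long. -/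
lemma exists_mul_ncard_take_eq_le (hS : Subgroup.closure S = ⊤) (hfin : S.Finite) (N : ℕ) :
    ∃ k₀, ∀ k m : ℕ, k₀ ≤ k →
      N * {g ∈ wordBall S m | 2 * k ≤ (normalForm g).length ∧
        (normalForm g).take k = (normalForm g⁻¹).take k}.ncard ≤ (wordBall S m).ncard := by
  obtain ⟨D, hD⟩ := exists_wordLength_add_le hS hfin
  obtain ⟨R, hR⟩ := exists_mul_ncard_le_of_injOn hS hfin N
  obtain ⟨k₀, hk₀⟩ := exists_le_wordLength_listProd hS hfin (R + D)
  have key : ∀ (g : CoprodI M) (k : ℕ), 2 * k ≤ (normalForm g).length →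
      (normalForm g).take k = (normalForm g⁻¹).take k → ∃ z,
      normalForm g = z ++ invRev ((normalForm g).take k) ∧
      normalForm (g * listProd ((normalForm g).take k)) = z ∧
      z.take k = (normalForm g).take k := by
    intro g k hg hg'
    set w := (normalForm g).take k with hw
    refine ⟨invRev ((normalForm g⁻¹).drop k), ?_⟩
    have h : normalForm g = invRev ((normalForm g⁻¹).drop k) ++ invRev w := by
      rw [hg', ← invRev_append, List.take_append_drop, normalForm_inv, invRev_invRev]
    refine ⟨h, ?_, ?_⟩
    · have hr := isReduced_normalForm g
      rw [h] at hr
      refine normalForm_eq_of_isReduced hr.left ?_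
      nth_rw 2 [← listProd_normalForm g]
      rw [h, listProd_append, listProd_invRev w, inv_mul_cancel_right]
    · have h' := congrArg (List.take k) h
      rw [List.take_append_of_le_length] at h'
      · exact h'.symm
      · simp only [length_invRev, List.length_drop, normalForm_inv]
        omega
  refine ⟨k₀, fun k m hk =>
    hR m _ (fun g => g * listProd ((normalForm g).take k)) ?_ ?_⟩
  · rintro g ⟨-, hg, hg'⟩ h ⟨-, hh, hh'⟩ e
    obtain ⟨z, -, h₁, h₂⟩ := key g k hg hg'
    obtain ⟨z', -, h₃, h₄⟩ := key h k hh hh'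
    simp only at e
    obtain rfl : z = z' := by rw [← h₁, e, h₃]
    rw [← h₂, ← h₄] at e
    exact mul_right_cancel e
  · rintro g ⟨hg, hg₁, hg₂⟩
    rw [mem_wordBall_iff hS] at hg
    obtain ⟨z, h₁, h₂, -⟩ := key g k hg₁ hg₂
    have h₃ := hD g _ _ h₁
    have h₄ := hk₀ ((normalForm g).take k) (by
      have := isReduced_normalForm g
      rw [← List.take_append_drop k (normalForm g)] at this
      exact this.left) (by simp; omega)
    rw [listProd_invRev, wordLength_inv hS, ← h₂, listProd_normalForm] at h₃
    omega

/-- Few elements have a bounded number of syllables. -/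
lemma exists_mul_ncard_length_le (hS : Subgroup.closure S = ⊤) (hfin : S.Finite) (L N : ℕ) :
    ∃ m₀, ∀ m, m₀ ≤ m →
      N * {g ∈ wordBall S m | (normalForm g).length ≤ L}.ncard ≤ (wordBall S m).ncard := by
  obtain ⟨L', hL'⟩ := exists_length_normalForm_le_of_geodesic hS hfin L
  obtain ⟨T, hT, hT'⟩ := exists_finite_connectors M
  obtain ⟨K, hK⟩ := (hT.image fun t => wordLength S (listProd t)).bddAbove
  choose t htT ht using hT'
  choose! γ hγ₁ hγ₂ using fun (g : CoprodI M) (i : ℕ) (h : i ≤ wordLength S g) =>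
    exists_wordLength_split hS h
  have hcut : ∀ J m, J * {g ∈ wordBall S m | J ≤ wordLength S g ∧ (normalForm g).length ≤ L}.ncard ≤
      (wordBall S m).ncard * ((wordBall S K).ncard * ((L' + 1) * T.ncard)) := by
    intro J m
    have h₁ : (Set.Iio J).ncard = J := by simp [Set.ncard_eq_toFinset_card']
    have h₂ : (Set.Iic L').ncard = L' + 1 := by simp [Set.ncard_eq_toFinset_card']
    refine le_trans ?_ ((Nat.mul_le_mul_right ((L' + 1) * T.ncard)
      (ncard_wordBall_add_le hS hfin m K)).trans_eq (mul_assoc _ _ _))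
    nth_rw 1 [← h₁]
    rw [← h₂, ← Set.ncard_prod, ← Set.ncard_prod, ← Set.ncard_prod]
    refine Set.ncard_le_ncard_of_injOn (fun p =>
      (γ p.2 p.1 * listProd (t (γ p.2 p.1) ((γ p.2 p.1)⁻¹ * p.2)) * ((γ p.2 p.1)⁻¹ * p.2),
        (normalForm (γ p.2 p.1)).length, t (γ p.2 p.1) ((γ p.2 p.1)⁻¹ * p.2))) ?_ ?_
      ((finite_wordBall hfin _).prod ((Set.finite_Iic _).prod hT))
    · rintro ⟨i, g⟩ ⟨hi, hg, hg₁, hg₂⟩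
      simp only [Set.mem_Iio] at hi hg₁ hg₂
      have hγ := hγ₂ g i (hi.le.trans hg₁)
      refine ⟨?_, hL' g _ hg₂ hγ, htT _ _⟩
      have := hK ⟨_, htT (γ g i) ((γ g i)⁻¹ * g), rfl⟩
      rw [mem_wordBall_iff hS] at hg ⊢
      refine (wordLength_mul_le hS _ _).trans ?_
      have := wordLength_mul_le hS (γ g i) (listProd (t (γ g i) ((γ g i)⁻¹ * g)))
      simp only at *
      omega
    · rintro ⟨i, g⟩ ⟨hi, hg, hg₁, hg₂⟩ ⟨j, h⟩ ⟨hj, hh, hh₁, hh₂⟩ e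
      simp only [Set.mem_Iio, Prod.mk.injEq] at hi hg₁ hg₂ hj hh₁ hh₂ e
      obtain ⟨e₁, e₂, e₃⟩ := e
      have hnf : ∀ x y : CoprodI M,
          normalForm (x * listProd (t x y) * y) = normalForm x ++ t x y ++ normalForm y :=
        fun x y => normalForm_eq_of_isReduced (ht x y) (by simp [mul_assoc])
      have e₄ := congrArg normalForm e₁
      rw [hnf, hnf, List.append_assoc, List.append_assoc] at e₄
      have e₅ := normalForm_injective (List.append_inj_left e₄ e₂)
      have e₆ := e₁
      rw [e₃, e₅] at e₆
      have e₇ : g = h := by simpa using e₆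
      rw [← hγ₁ g i (hi.le.trans hg₁), ← hγ₁ h j (hj.le.trans hh₁), e₅, e₇]
  set C := (wordBall S K).ncard * ((L' + 1) * T.ncard) with hC
  obtain ⟨R, hR⟩ := exists_mul_ncard_wordBall_le hS hfin (2 * N)
  set J := 2 * N * C with hJ
  refine ⟨J + R, fun m hm => ?_⟩
  have h₁ := hcut J m
  have h₂ := (hR J).trans (Set.ncard_le_ncard (wordBall_mono hm) (finite_wordBall hfin m))
  have h₃ : {g ∈ wordBall S m | (normalForm g).length ≤ L}.ncard ≤
      {g ∈ wordBall S m | J ≤ wordLength S g ∧ (normalForm g).length ≤ L}.ncard +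
        (wordBall S J).ncard := by
    refine (Set.ncard_le_ncard ?_ (((finite_wordBall hfin m).subset (Set.sep_subset _ _)).union
      (finite_wordBall hfin J))).trans (Set.ncard_union_le _ _)
    rintro g ⟨hg, hg'⟩
    rcases le_total J (wordLength S g) with h | h
    · exact Or.inl ⟨hg, h, hg'⟩
    · exact Or.inr ((mem_wordBall_iff hS).2 h)
  have hC₀ : 0 < C := by
    have : 0 < T.ncard := (Set.ncard_pos hT).2 ⟨_, htT 1 1⟩
    have := ncard_wordBall_pos hS hfin K
    positivity
  have h₄ : 2 * N * {g ∈ wordBall S m | J ≤ wordLength S g ∧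
      (normalForm g).length ≤ L}.ncard ≤ (wordBall S m).ncard := by
    refine Nat.le_of_mul_le_mul_right ?_ hC₀
    refine le_trans (le_of_eq ?_) h₁
    rw [hJ]
    ring
  nlinarith

end Growth

section PingPong

variable {ι : Type*} {M : ι → Type*} [∀ i, Group (M i)]

/-- If `z` does not start like `y⁻¹`, then `y * z` starts like `y`. -/
lemma take_normalForm_mul {k : ℕ} {y z : CoprodI M} (hy : 2 * k ≤ (normalForm y).length)
    (h : (normalForm z).take k ≠ (normalForm y⁻¹).take k) :
    (normalForm (y * z)).take k = (normalForm y).take k := by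
  obtain ⟨r, ⟨u, hu⟩, ⟨v, hv⟩, hr⟩ := exists_common_prefix y⁻¹ z
  have hlen : (normalForm y⁻¹).length = (normalForm y).length := by simp [normalForm_inv]
  have hrk : r.length < k := by
    by_contra! hle
    apply h
    rw [← hu, ← hv, List.take_append_of_le_length hle, List.take_append_of_le_length hle]
  rcases hr with hr | ⟨d, e, hde, f, hf⟩
  · rw [hr] at hlen
    omega
  rw [hde] at hlen
  simp only [List.length_append, List.length_cons] at hlen
  have hy' : normalForm y = invRev e ++ (invRev [d] ++ invRev r) := by
    rw [← invRev_invRev (normalForm y), ← normalForm_inv, hde]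
    simp
  rw [inv_inv] at hf
  have hk : k ≤ (invRev e).length := by simp; omega
  rw [hy', ← hf, List.take_append_of_le_length hk, List.take_append_of_le_length hk]

/-- Elements with long normal forms such that all beginnings of the elements and their inverses
are distinct freely generate a free group. -/
lemma injective_lift_of_take_injective {α : Type*} {k : ℕ} (hk : 0 < k) {x : α → CoprodI M}
    (hx : ∀ i, 2 * k ≤ (normalForm (x i)).length)
    (hinj : Function.Injective fun a : α × Bool =>
      (normalForm (cond a.2 (x a.1) (x a.1)⁻¹)).take k) :
    Function.Injective (FreeGroup.lift x) := by
  have hlen : ∀ a : α × Bool, 2 * k ≤ (normalForm (cond a.2 (x a.1) (x a.1)⁻¹)).length := by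
    rintro ⟨i, _ | _⟩
    · simpa [normalForm_inv] using hx i
    · exact hx i
  have hinv : ∀ a : α × Bool, (cond a.2 (x a.1) (x a.1)⁻¹)⁻¹ =
      cond (!a.2) (x a.1) (x a.1)⁻¹ := by
    rintro ⟨i, _ | _⟩ <;> simp
  have key : ∀ (a : α × Bool) (L : List (α × Bool)), FreeGroup.IsReduced (a :: L) →
      (normalForm ((a :: L).map fun b => cond b.2 (x b.1) (x b.1)⁻¹).prod).take k =
        (normalForm (cond a.2 (x a.1) (x a.1)⁻¹)).take k := by
    intro a L hL
    induction L generalizing a with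
    | nil => simp
    | cons b L ih =>
      rw [FreeGroup.isReduced_cons_cons] at hL
      rw [List.map_cons, List.prod_cons]
      refine take_normalForm_mul (hlen a) ?_
      rw [ih b hL.2, hinv]
      intro h
      obtain rfl : b = (a.1, !a.2) := hinj h
      simpa using hL.1 rfl
  classical
  rw [injective_iff_map_eq_one]
  intro g hg
  rw [← FreeGroup.mk_toWord (x := g)] at hg ⊢
  have hred := FreeGroup.isReduced_toWord (x := g)
  rw [FreeGroup.lift_mk] at hg
  cases hw : g.toWord with
  | nil => rfl
  | cons a L =>
    rw [hw] at hg hred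
    have h := key a L hred
    rw [hg, normalForm_one] at h
    have h' := congrArg List.length h
    have := hlen a
    rw [List.take_nil, List.length_nil, List.length_take] at h'
    omega

end PingPong

section Tuples

lemma mul_ncard_iUnion_le {α κ : Type*} [Fintype κ] {N b : ℕ} {X : κ → Set α}
    (h : ∀ j, Fintype.card κ * N * (X j).ncard ≤ b) : N * (⋃ j, X j).ncard ≤ b := by
  rcases isEmpty_or_nonempty κ with _ | _
  · simp
  refine Nat.le_of_mul_le_mul_left ?_ (Fintype.card_pos (α := κ))
  calc Fintype.card κ * (N * (⋃ j, X j).ncard)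
      ≤ Fintype.card κ * (N * ∑ j, (X j).ncard) := by
        gcongr
        exact Set.ncard_iUnion_le_of_fintype X
    _ = ∑ j, Fintype.card κ * N * (X j).ncard := by
        rw [← mul_assoc, Finset.mul_sum]
    _ ≤ ∑ _j : κ, b := Finset.sum_le_sum fun j _ => h j
    _ = Fintype.card κ * b := by simp

variable {G : Type*} {n : ℕ}

lemma coe_piFinset_const (B : Finset G) :
    (Fintype.piFinset fun _ : Fin n => B : Set (Fin n → G)) = {x | ∀ i, x i ∈ B} := by
  ext x
  simp

lemma finite_forall_mem {B : Set G} (hB : B.Finite) : {x : Fin n → G | ∀ i, x i ∈ B}.Finite := by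
  lift B to Finset G using hB
  exact coe_piFinset_const (n := n) B ▸ Finset.finite_toSet _

lemma ncard_forall_mem {B : Set G} (hB : B.Finite) :
    {x : Fin n → G | ∀ i, x i ∈ B}.ncard = B.ncard ^ n := by
  lift B to Finset G using hB
  have := congrArg Set.ncard (coe_piFinset_const (n := n) B)
  rw [Set.ncard_coe_finset, Fintype.card_piFinset_const] at this
  simp [← this]

/-- If the proportion of a set of tuples is small on every line in direction `i`, then it is
small. -/
lemma mul_ncard_le_pow_of_update {N : ℕ} {B : Set G} (hB : B.Finite) (hB₀ : B.Nonempty)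
    {E : Set (Fin n → G)} (hE : ∀ x ∈ E, ∀ j, x j ∈ B) (i : Fin n)
    (h : ∀ x, N * {y ∈ B | Function.update x i y ∈ E}.ncard ≤ B.ncard) :
    N * E.ncard ≤ B.ncard ^ n := by
  classical
  rcases N.eq_zero_or_pos with rfl | hN
  · simp
  have hEfin : E.Finite := (finite_forall_mem hB).subset hE
  lift B to Finset G using hB
  lift E to Finset (Fin n → G) using hEfin
  have hcoe : ∀ x, {y ∈ (B : Set G) | Function.update x i y ∈ (E : Set (Fin n → G))} =
      (B.filter fun y => Function.update x i y ∈ E : Finset G) := fun x => by simp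
  simp only [hcoe, Set.ncard_coe_finset] at h ⊢
  simp only [Finset.mem_coe] at hE
  have key := Finset.card_le_mul_card_image_of_maps_to (s := E ×ˢ B)
    (t := Fintype.piFinset fun _ => B) (f := fun p => Function.update p.1 i p.2) ?_
    (B.card / N) ?_
  · rw [Finset.card_product, Fintype.card_piFinset_const] at key
    refine Nat.le_of_mul_le_mul_right ?_ (Finset.card_pos.2 (Finset.coe_nonempty.1 hB₀))
    calc N * E.card * B.card = N * (E.card * B.card) := mul_assoc _ _ _
      _ ≤ N * (B.card / N * B.card ^ n) := Nat.mul_le_mul_left _ key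
      _ = N * (B.card / N) * B.card ^ n := (mul_assoc _ _ _).symm
      _ ≤ B.card * B.card ^ n := Nat.mul_le_mul_right _ (Nat.mul_div_le _ _)
      _ = B.card ^ n * B.card := mul_comm _ _
  · rintro ⟨e, y⟩ hp
    rw [Finset.mem_product] at hp
    rw [Fintype.mem_piFinset]
    intro j
    rcases eq_or_ne j i with rfl | hj
    · simpa using hp.2
    · simpa [hj] using hE e hp.1 j
  · intro x _
    rw [Nat.le_div_iff_mul_le hN, mul_comm]
    refine le_trans (Nat.mul_le_mul_left _ ?_) (h x)
    refine Finset.card_le_card_of_injOn (fun p => p.1 i) ?_ ?_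
    · rintro ⟨e, y⟩ hp
      simp only [Finset.coe_filter, Finset.mem_product, Set.mem_ofPred_eq] at hp ⊢
      obtain ⟨⟨he, hy⟩, rfl⟩ := hp
      exact ⟨hE e he i, by simpa using he⟩
    · rintro ⟨e, y⟩ hp ⟨e', y'⟩ hp' h'
      simp only [Finset.coe_filter, Finset.mem_product, Set.mem_ofPred_eq] at hp hp' h'
      have hy : y = x i := by simp [← hp.2]
      have hy' : y' = x i := by simp [← hp'.2]
      have he : e = Function.update x i (e i) := by simp [← hp.2]
      have he' : e' = Function.update x i (e' i) := by simp [← hp'.2]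
      rw [hy, hy', he, he', h']

end Tuples

section Main

variable {ι : Type*} {M : ι → Type*} [∀ i, Group (M i)] {S : Set (CoprodI M)}
variable [Nontrivial ι] [∀ i, Infinite (M i)]

/-- The proportion of tuples in a large ball which are not free bases is small. -/
lemma exists_mul_ncard_not_isFreeBasisTuple_le (hS : Subgroup.closure S = ⊤) (hfin : S.Finite)
    (n N : ℕ) : ∃ m₀, ∀ m, m₀ ≤ m →
      N * {x : Fin n → CoprodI M | (∀ i, x i ∈ wordBall S m) ∧ ¬ IsFreeBasisTuple x}.ncard ≤
        (wordBall S m).ncard ^ n := by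
  set N' := 3 * (Fintype.card (Fin n) * N) with hN'
  obtain ⟨k₁, hk₁⟩ := exists_mul_ncard_prefix_le hS hfin
    (Fintype.card (Fin n × Bool × Bool) * N')
  obtain ⟨k₂, hk₂⟩ := exists_mul_ncard_take_eq_le hS hfin N'
  set k := max k₁ k₂ + 1 with hk
  obtain ⟨m₀, hm₀⟩ := exists_mul_ncard_length_le hS hfin (2 * k) N'
  refine ⟨m₀, fun m hm => ?_⟩
  set B := wordBall S m with hB
  have hBfin : B.Finite := finite_wordBall hfin m
  set start : CoprodI M → Bool → List (Σ i, M i) := fun g β =>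
    (normalForm (cond β g g⁻¹)).take k with hstart
  set E : Fin n → Set (Fin n → CoprodI M) := fun i => {x | (∀ j, x j ∈ B) ∧
    ((normalForm (x i)).length ≤ 2 * k ∨
      (2 * k ≤ (normalForm (x i)).length ∧
        (normalForm (x i)).take k = (normalForm (x i)⁻¹).take k) ∨
      ∃ a : Fin n × Bool × Bool, a.1 ≠ i ∧ k ≤ (start (x a.1) a.2.1).length ∧
        start (x a.1) a.2.1 <+: normalForm (cond a.2.2 (x i) (x i)⁻¹))} with hE
  have hsub : {x : Fin n → CoprodI M | (∀ i, x i ∈ B) ∧ ¬ IsFreeBasisTuple x} ⊆ ⋃ i, E i := by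
    rintro x ⟨hx, hx'⟩
    by_contra hxE
    simp only [hE, Set.mem_iUnion, Set.mem_ofPred_eq, hx, implies_true, true_and, not_exists,
      not_or] at hxE
    refine hx' (injective_lift_of_take_injective (k := k) (by omega)
      (fun i => (not_le.1 (hxE i).1).le) ?_)
    have hlen : ∀ i β, k ≤ (start (x i) β).length := by
      intro i β
      have := (hxE i).1
      cases β <;> simp [hstart, normalForm_inv] <;> omega
    rintro ⟨i, β⟩ ⟨j, β'⟩ h
    simp only at h
    obtain rfl | hij := eq_or_ne j i
    · have h₂ := (hxE j).2.1
      have h₁ := (hxE j).1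
      cases β <;> cases β' <;> simp only [cond_true, cond_false] at h
      · rfl
      · exact absurd ⟨by omega, h.symm⟩ h₂
      · exact absurd ⟨by omega, h⟩ h₂
      · rfl
    · refine absurd ⟨hij, hlen j β', ?_⟩ ((hxE i).2.2 (j, β', β))
      simp only [hstart, ← h]
      exact List.take_prefix _ _
  have hEfin : ∀ i, (E i).Finite := fun i => (finite_forall_mem hBfin).subset fun x hx => hx.1
  refine (Nat.mul_le_mul_left N (Set.ncard_le_ncard hsub (Set.finite_iUnion hEfin))).trans
    (mul_ncard_iUnion_le fun i => mul_ncard_le_pow_of_update hBfin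
      ((Set.ncard_pos hBfin).1 (ncard_wordBall_pos hS hfin m)) (fun x hx => hx.1) i fun x => ?_)
  set X : Fin n × Bool × Bool → Set (CoprodI M) := fun a =>
    {y ∈ B | k ≤ (start (x a.1) a.2.1).length ∧
      start (x a.1) a.2.1 <+: normalForm (cond a.2.2 y y⁻¹)} with hX
  have h₁ : N' * {g ∈ B | (normalForm g).length ≤ 2 * k}.ncard ≤ B.ncard := hm₀ m hm
  have h₂ : N' * {g ∈ B | 2 * k ≤ (normalForm g).length ∧
      (normalForm g).take k = (normalForm g⁻¹).take k}.ncard ≤ B.ncard := hk₂ k m (by omega)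
  have h₃ : N' * (⋃ a, X a).ncard ≤ B.ncard := by
    refine mul_ncard_iUnion_le fun a => ?_
    by_cases ha : k ≤ (start (x a.1) a.2.1).length
    · have := hk₁ (start (x a.1) a.2.1) m (by omega)
      obtain ⟨j, β, _ | _⟩ := a
      · refine le_trans (Nat.mul_le_mul_left _ (Set.ncard_le_ncard ?_
          (hBfin.subset (Set.sep_subset _ _)))) this.2
        exact fun y hy => ⟨hy.1, hy.2.2⟩
      · refine le_trans (Nat.mul_le_mul_left _ (Set.ncard_le_ncard ?_
          (hBfin.subset (Set.sep_subset _ _)))) this.1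
        exact fun y hy => ⟨hy.1, hy.2.2⟩
    · simp [hX, ha]
  have hcover : {y ∈ B | Function.update x i y ∈ E i} ⊆
      ({g ∈ B | (normalForm g).length ≤ 2 * k} ∪
        {g ∈ B | 2 * k ≤ (normalForm g).length ∧
          (normalForm g).take k = (normalForm g⁻¹).take k}) ∪ ⋃ a, X a := by
    rintro y ⟨hy, -, hy'⟩
    simp only [Function.update_self] at hy'
    rcases hy' with h | h | ⟨a, ha, h, h'⟩
    · exact Or.inl (Or.inl ⟨hy, h⟩)
    · exact Or.inl (Or.inr ⟨hy, h⟩)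
    · rw [Function.update_of_ne ha] at h h'
      exact Or.inr (Set.mem_iUnion.2 ⟨a, hy, h, h'⟩)
  have hcard := (Set.ncard_le_ncard hcover (((hBfin.subset (Set.sep_subset _ _)).union
    (hBfin.subset (Set.sep_subset _ _))).union
      (Set.finite_iUnion fun a => hBfin.subset (Set.sep_subset _ _)))).trans
    ((Set.ncard_union_le _ _).trans (Nat.add_le_add_right (Set.ncard_union_le _ _) _))
  rw [hN', mul_assoc] at h₁ h₂ h₃
  have := Nat.mul_le_mul_left (Fintype.card (Fin n) * N) hcard
  simp only [mul_add] at this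
  omega

/-- Nontrivial free products of infinite groups have the strong generic free group property. -/
theorem hasStrongGenericFreeGroupProperty (M : ι → Type*) [∀ i, Group (M i)]
    [∀ i, Infinite (M i)] : HasStrongGenericFreeGroupProperty (CoprodI M) := by
  intro S hfin hS n _
  rw [Metric.tendsto_atTop]
  intro ε hε
  obtain ⟨N, hN⟩ := exists_nat_gt (1 / ε)
  obtain ⟨m₀, hm₀⟩ := exists_mul_ncard_not_isFreeBasisTuple_le hS hfin n N
  refine ⟨m₀, fun m hm => ?_⟩
  have hB := finite_wordBall hfin m
  set P := {x : Fin n → CoprodI M | ∀ i, x i ∈ wordBall S m}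
  have hP : P.Finite := finite_forall_mem hB
  have hcard : {x : Fin n → CoprodI M | (∀ i, x i ∈ wordBall S m) ∧ IsFreeBasisTuple x}.ncard +
      {x : Fin n → CoprodI M | (∀ i, x i ∈ wordBall S m) ∧ ¬ IsFreeBasisTuple x}.ncard =
      (wordBall S m).ncard ^ n := by
    rw [← ncard_forall_mem hB]
    exact Set.ncard_inter_add_ncard_sdiff_eq_ncard P {x | IsFreeBasisTuple x} hP
  have hbad := hm₀ m hm
  have hpos : (0 : ℝ) < ((wordBall S m).ncard : ℝ) ^ n := by
    have := ncard_wordBall_pos hS hfin m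
    positivity
  have hNpos : (0 : ℝ) < N := (by positivity : (0 : ℝ) < 1 / ε).trans hN
  rify at hcard hbad
  rw [div_lt_iff₀ hε] at hN
  rw [Real.dist_eq, div_sub_one hpos.ne', abs_div, abs_of_pos hpos, div_lt_iff₀ hpos, ← hcard,
    sub_add_cancel_left, abs_neg, Nat.abs_cast, hcard]
  refine lt_of_mul_lt_mul_left (hbad.trans_lt ?_) hNpos.le
  nlinarith

end Main

section Transfer

variable {G H : Type*} [Group G] [Group H]

lemma map_mem_wordBall (f : G →* H) {S : Set G} {m : ℕ} {g : G} (hg : g ∈ wordBall S m) :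
    f g ∈ wordBall (f '' S) m := by
  obtain ⟨l, hl, hl', rfl⟩ := hg
  refine ⟨l.map f, by simpa using hl, ?_, by simp [map_list_prod]⟩
  intro x hx
  obtain ⟨y, hy, rfl⟩ := List.mem_map.1 hx
  refine (hl' y hy).imp (fun h => ⟨y, h, rfl⟩) fun h => ⟨y⁻¹, h, by simp⟩

lemma mem_wordBall_image_iff (e : G ≃* H) {S : Set G} {m : ℕ} {g : G} :
    e g ∈ wordBall (e '' S) m ↔ g ∈ wordBall S m := by
  refine ⟨fun h => ?_, fun h => map_mem_wordBall e.toMonoidHom h⟩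
  have := map_mem_wordBall e.symm.toMonoidHom h
  simpa [Set.image_image] using this

lemma isFreeBasisTuple_comp_iff (e : G ≃* H) {n : ℕ} {x : Fin n → G} :
    IsFreeBasisTuple (e ∘ x) ↔ IsFreeBasisTuple x := by
  have : FreeGroup.lift (e ∘ x) = e.toMonoidHom.comp (FreeGroup.lift x) := by
    ext i
    simp
  rw [IsFreeBasisTuple, this]
  exact e.injective.of_comp_iff _

theorem _root_.HasStrongGenericFreeGroupProperty.of_mulEquiv (e : G ≃* H)
    (h : HasStrongGenericFreeGroupProperty H) : HasStrongGenericFreeGroupProperty G := by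
  intro S hfin hS n hn
  have hS' : Subgroup.closure (e '' S) = ⊤ := by
    have := MonoidHom.map_closure e.toMonoidHom S
    rw [hS, Subgroup.map_top_of_surjective _ e.surjective] at this
    exact this.symm
  have key := h (e '' S) (hfin.image e) hS' n hn
  refine key.congr fun m => ?_
  have h₁ : wordBall (e '' S) m = e '' wordBall S m := by
    ext y
    obtain ⟨g, rfl⟩ := e.surjective y
    simp [mem_wordBall_image_iff]
  have h₂ : {y : Fin n → H | (∀ i, y i ∈ wordBall (e '' S) m) ∧ IsFreeBasisTuple y} =
      (fun x => e ∘ x) '' {x | (∀ i, x i ∈ wordBall S m) ∧ IsFreeBasisTuple x} := by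
    ext y
    obtain ⟨x, rfl⟩ := e.surjective.comp_left y
    rw [(e.injective.comp_left (α := Fin n)).mem_set_image]
    simp [mem_wordBall_image_iff, isFreeBasisTuple_comp_iff]
  rw [h₂, h₁, Set.ncard_image_of_injective _ e.injective.comp_left,
    Set.ncard_image_of_injective _ e.injective]

end Transfer

section Binary

universe u v

/-- Two groups as a family indexed by `Bool`. -/
def BoolFamily (A : Type u) (B : Type v) : Bool → Type (max u v)
  | true => ULift A
  | false => ULift B

variable (A : Type u) (B : Type v)

instance [Group A] [Group B] : ∀ b, Group (BoolFamily A B b)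
  | true => inferInstanceAs (Group (ULift A))
  | false => inferInstanceAs (Group (ULift B))

instance [Infinite A] [Infinite B] : ∀ b, Infinite (BoolFamily A B b)
  | true => inferInstanceAs (Infinite (ULift A))
  | false => inferInstanceAs (Infinite (ULift B))

variable [Group A] [Group B]

/-- The binary free product is the free product of a family indexed by `Bool`. -/
def coprodMulEquiv : Monoid.Coprod A B ≃* CoprodI (BoolFamily A B) :=
  MonoidHom.toMulEquiv
    (Coprod.lift ((of (M := BoolFamily A B) (i := true)).comp
        (MulEquiv.ulift (α := A)).symm.toMonoidHom)
      ((of (M := BoolFamily A B) (i := false)).comp (MulEquiv.ulift (α := B)).symm.toMonoidHom))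
    (CoprodI.lift fun b => match b with
      | true => Coprod.inl.comp (MulEquiv.ulift (α := A)).toMonoidHom
      | false => Coprod.inr.comp (MulEquiv.ulift (α := B)).toMonoidHom)
    (by
      ext x
      · simp only [MonoidHom.comp_apply, Coprod.lift_apply_inl]
        rfl
      · simp only [MonoidHom.comp_apply, Coprod.lift_apply_inr]
        rfl)
    (by
      ext b x
      cases b
      · simp only [MonoidHom.comp_apply, lift_of]
        rfl
      · simp only [MonoidHom.comp_apply, lift_of]
        rfl)

end Binary

end Monoid.CoprodI

/-- The free product of two finitely generated infinite groups satisfies the strong generic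
free group property with respect to every finite generating set. -/
theorem freeProduct_hasStrongGenericFreeGroupProperty (A B : Type*) [Group A] [Group B]
    [Group.FG A] [Group.FG B] [Infinite A] [Infinite B] :
    HasStrongGenericFreeGroupProperty (Monoid.Coprod A B) :=
  (Monoid.CoprodI.hasStrongGenericFreeGroupProperty _).of_mulEquiv
    (Monoid.CoprodI.coprodMulEquiv A B)
end

section
/- Let G = F₁ ∗_{U=V} F₂ be a cyclically pinched one-relator group, i.e., the amalgamated free product of finitely generated free groups F₁ and F₂ identifying the cyclic subgroup generated by a nontrivial element U ∈ F₁ with the cyclic subgroup generated by a nontrivial element V ∈ F₂ (via U ↦ V). If U is not a power of a primitive element of F₁ and V is not a power of a primitive element of F₂, then G satisfies the strong generic free group property with respect to every finite generating set of G. -/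
open Filter Set

/-- `(G, ia, ib)` is a pushout of the group homomorphisms `f : H →* A` and `g : H →* B`. -/
def IsGroupPushout {H A B G : Type*} [Group H] [Group A] [Group B] [Group G]
    (f : H →* A) (g : H →* B) (ia : A →* G) (ib : B →* G) : Prop :=
  ia.comp f = ib.comp g ∧
    ∀ (K : Type*) [Group K] (ja : A →* K) (jb : B →* K), ja.comp f = jb.comp g →
      ∃! φ : G →* K, φ.comp ia = ja ∧ φ.comp ib = jb

/-- An element of a group is primitive if it belongs to some free basis. -/
def IsPrimitiveElement {F : Type u} [Group F] (p : F) : Prop :=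
  ∃ (ι : Type u) (b : FreeGroupBasis ι F) (i : ι), b i = p

section WordBall

variable {G : Type*} [Group G] {S : Set G}

lemma one_mem_wordBall (m : ℕ) : (1 : G) ∈ wordBall S m := ⟨[], by simp, by simp, by simp⟩

lemma wordBall_mono {m n : ℕ} (h : m ≤ n) : wordBall S m ⊆ wordBall S n := by
  rintro g ⟨l, hl, hS, hp⟩
  exact ⟨l, hl.trans h, hS, hp⟩

lemma mul_mem_wordBall {m n : ℕ} {x y : G} (hx : x ∈ wordBall S m) (hy : y ∈ wordBall S n) :
    x * y ∈ wordBall S (m + n) := by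
  obtain ⟨l, hl, hS, rfl⟩ := hx
  obtain ⟨l', hl', hS', rfl⟩ := hy
  refine ⟨l ++ l', by simp; omega, ?_, by simp⟩
  intro x hx
  rcases List.mem_append.1 hx with h | h
  exacts [hS x h, hS' x h]

lemma inv_mem_wordBall {m : ℕ} {x : G} (hx : x ∈ wordBall S m) : x⁻¹ ∈ wordBall S m := by
  obtain ⟨l, hl, hS, rfl⟩ := hx
  refine ⟨(l.map (·⁻¹)).reverse, by simpa using hl, ?_, (List.prod_inv_reverse l).symm⟩
  intro x hx
  simp only [List.mem_reverse, List.mem_map] at hx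
  obtain ⟨y, hy, rfl⟩ := hx
  simpa using (hS y hy).symm

lemma mem_wordBall_succ {m : ℕ} {g : G} (hg : g ∈ wordBall S (m + 1)) :
    ∃ x y, x ∈ wordBall S m ∧ y ∈ wordBall S 1 ∧ x * y = g := by
  obtain ⟨l, hl, hS, rfl⟩ := hg
  rcases l.eq_nil_or_concat with rfl | ⟨l', s, rfl⟩
  · exact ⟨1, 1, one_mem_wordBall _, one_mem_wordBall _, by simp⟩
  · refine ⟨l'.prod, s, ⟨l', by simpa using hl, fun x hx => hS x (by simp [hx]), rfl⟩,
      ⟨[s], by simp, fun x hx => hS x ?_, by simp⟩, by simp⟩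
    simp at hx
    simp [hx]

lemma wordBall_one_finite (hS : S.Finite) : (wordBall S 1).Finite := by
  refine ((hS.union hS.inv).union (finite_singleton (1 : G))).subset ?_
  rintro g ⟨l, hl, hS, rfl⟩
  match l, hl with
  | [], _ => simp
  | [s], _ =>
    have := hS s (by simp)
    simp only [List.prod_singleton, mem_union, Set.mem_inv]
    exact Or.inl this

lemma wordBall_finite (hS : S.Finite) (m : ℕ) : (wordBall S m).Finite := by
  induction m with
  | zero =>
    refine (finite_singleton (1 : G)).subset ?_
    rintro g ⟨l, hl, -, rfl⟩
    simp at hl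
    simp [hl]
  | succ m ih =>
    refine (ih.mul (wordBall_one_finite hS)).subset ?_
    intro g hg
    obtain ⟨x, y, hx, hy, rfl⟩ := mem_wordBall_succ hg
    exact Set.mul_mem_mul hx hy

lemma exists_mem_wordBall (hS : Subgroup.closure S = ⊤) (g : G) : ∃ m, g ∈ wordBall S m := by
  have hg : g ∈ Subgroup.closure S := by simp [hS]
  induction hg using Subgroup.closure_induction with
  | mem x hx => exact ⟨1, [x], by simp, by simpa using Or.inl hx, by simp⟩
  | one => exact ⟨0, one_mem_wordBall 0⟩
  | mul x y _ _ hx hy =>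
    obtain ⟨m, hm⟩ := hx
    obtain ⟨n, hn⟩ := hy
    exact ⟨m + n, mul_mem_wordBall hm hn⟩
  | inv x _ hx =>
    obtain ⟨m, hm⟩ := hx
    exact ⟨m, inv_mem_wordBall hm⟩

/-- A path of length `n` from `1` to `g`, extended arbitrarily. -/
structure IsWordPath (S : Set G) (n : ℕ) (g : G) (p : ℕ → G) : Prop where
  zero : p 0 = 1
  last : p n = g
  step : ∀ i, (p i)⁻¹ * p (i + 1) ∈ wordBall S 1

lemma exists_isWordPath {n : ℕ} {g : G} (hg : g ∈ wordBall S n) :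
    ∃ p : ℕ → G, IsWordPath S n g p := by
  induction n generalizing g with
  | zero =>
    obtain ⟨l, hl, -, rfl⟩ := hg
    simp at hl
    exact ⟨fun _ => 1, by simp, by simp [hl], fun i => by simpa using one_mem_wordBall 1⟩
  | succ n ih =>
    obtain ⟨x, y, hx, hy, rfl⟩ := mem_wordBall_succ hg
    obtain ⟨p, hp⟩ := ih hx
    refine ⟨fun i => if i ≤ n then p i else x * y, by simp [hp.zero], by simp, fun i => ?_⟩
    rcases lt_trichotomy i n with h | rfl | h
    · simpa [h.le, Nat.succ_le_of_lt h] using hp.step i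
    · simpa [hp.last] using hy
    · have h1 : ¬ i ≤ n := by omega
      have h2 : ¬ i + 1 ≤ n := by omega
      simpa [h1, h2] using one_mem_wordBall 1

lemma IsWordPath.inv_mul_mem {n : ℕ} {g : G} {p : ℕ → G} (hp : IsWordPath S n g p) {i j : ℕ}
    (hij : i ≤ j) : (p i)⁻¹ * p j ∈ wordBall S (j - i) := by
  obtain ⟨k, rfl⟩ := Nat.exists_eq_add_of_le hij
  rw [Nat.add_sub_cancel_left]
  clear hij
  induction k with
  | zero => simpa using one_mem_wordBall 0
  | succ k ih =>
    have := mul_mem_wordBall ih (hp.step (i + k))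
    rwa [mul_assoc, mul_inv_cancel_left] at this

lemma IsWordPath.mem {n : ℕ} {g : G} {p : ℕ → G} (hp : IsWordPath S n g p) (i : ℕ) :
    p i ∈ wordBall S i := by
  simpa [hp.zero] using hp.inv_mul_mem (Nat.zero_le i)

lemma IsWordPath.inv_mul_last_mem {n : ℕ} {g : G} {p : ℕ → G} (hp : IsWordPath S n g p) {i : ℕ}
    (hi : i ≤ n) : (p i)⁻¹ * g ∈ wordBall S (n - i) := by
  simpa [hp.last] using hp.inv_mul_mem hi

end WordBall

/-- A `G`-set of walls, where `sep g` is the set of walls separating `1` from `g`, which behaves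
like the set of edges of a tree, and on which balls of `G` with respect to `S` grow slowly along
stabilizers. -/
structure IsWallSystem {G Ω : Type*} [Group G] [MulAction G Ω] (S : Set G) (sep : G → Set Ω)
    (α β : G) (o₁ o₂ : Ω) : Prop where
  finite_sep : ∀ g, (sep g).Finite
  mem_sep_mul : ∀ g h e, e ∈ sep (g * h) ↔ ¬ (e ∈ sep g ↔ g⁻¹ • e ∈ sep h)
  nested : ∀ x y z, sep x ∩ sep y ⊆ sep z ∨ sep z ∩ sep y ⊆ sep x
  detect : ∀ p q, ∃ p' q', (p' = p ∨ p' = p * β) ∧ (q' = q ∨ q' = β * q) ∧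
    p' • o₁ ∈ sep (p' * α * q') ∧ p' • o₂ ∈ sep (p' * α * q')
  faithful : ∀ p q : G, p • o₁ = q • o₁ → p • o₂ = q • o₂ → p = q
  transporter : ∀ w w' : Ω, ∃ c, ∀ j, {g | g ∈ wordBall S j ∧ g • w = w'}.ncard ≤ c * (j + 1)
  growth : ∃ N, 0 < N ∧ ∀ n, 2 ^ n ≤ (wordBall S (N * n)).ncard

namespace IsWallSystem

variable {G Ω : Type*} [Group G] [MulAction G Ω] {S : Set G} {sep : G → Set Ω}
  {α β : G} {o₁ o₂ : Ω}

lemma sep_one (h : IsWallSystem S sep α β o₁ o₂) : sep 1 = ∅ := by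
  ext e
  have := h.mem_sep_mul 1 1 e
  simp at this
  simpa using this

lemma mem_sep_inv (h : IsWallSystem S sep α β o₁ o₂) (g : G) (e : Ω) :
    e ∈ sep g⁻¹ ↔ g • e ∈ sep g := by
  have := h.mem_sep_mul g⁻¹ g e
  simp [h.sep_one] at this
  exact this

lemma ncard_sep_inv (h : IsWallSystem S sep α β o₁ o₂) (g : G) :
    (sep g⁻¹).ncard = (sep g).ncard := by
  have : sep g = (fun e => g • e) '' sep g⁻¹ := by
    ext e
    constructor
    · intro he
      exact ⟨g⁻¹ • e, by rw [h.mem_sep_inv]; simpa using he, by simp⟩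
    · rintro ⟨e, he, rfl⟩
      exact (h.mem_sep_inv _ _).1 he
  rw [this, Set.ncard_image_of_injective _ (MulAction.injective g)]

lemma ncard_sep_mul_le (h : IsWallSystem S sep α β o₁ o₂) (x y : G) :
    (sep (x * y)).ncard ≤ (sep x).ncard + (sep y).ncard := by
  have : sep (x * y) ⊆ sep x ∪ (fun e => x • e) '' sep y := by
    intro e he
    rw [h.mem_sep_mul] at he
    by_cases h1 : e ∈ sep x
    · exact Or.inl h1
    · refine Or.inr ⟨x⁻¹ • e, ?_, by simp⟩
      tauto
  refine (Set.ncard_le_ncard this ((h.finite_sep x).union ((h.finite_sep y).image _))).trans ?_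
  refine (Set.ncard_union_le _ _).trans ?_
  exact Nat.add_le_add_left (Set.ncard_image_le (h.finite_sep y)) _

lemma ncard_inter_lt_of_lt (h : IsWallSystem S sep α β o₁ o₂) {k : ℕ} {x y z : G}
    (hx : k ≤ (sep x ∩ sep y).ncard)
    (hz : (sep z ∩ sep x).ncard < k) : (sep z ∩ sep y).ncard < k := by
  rcases h.nested z y x with h1 | h1
  · refine lt_of_le_of_lt (Set.ncard_le_ncard ?_ ((h.finite_sep z).inter_of_left _)) hz
    exact fun e he => ⟨he.1, h1 he⟩
  · exfalso
    refine absurd (lt_of_le_of_lt (Set.ncard_le_ncard (t := sep z ∩ sep x) ?_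
      ((h.finite_sep z).inter_of_left _)) hz) (not_lt.2 hx)
    exact fun e he => ⟨h1 he, he.1⟩

lemma ncard_sep_inv_le (h : IsWallSystem S sep α β o₁ o₂) (x y : G) :
    (sep x).ncard ≤ (sep x ∩ sep (x * y)).ncard + (sep x⁻¹ ∩ sep y).ncard := by
  have : sep x ⊆ (sep x ∩ sep (x * y)) ∪ (fun e => x • e) '' (sep x⁻¹ ∩ sep y) := by
    intro e he
    by_cases h1 : e ∈ sep (x * y)
    · exact Or.inl ⟨he, h1⟩
    · refine Or.inr ⟨x⁻¹ • e, ⟨by rw [h.mem_sep_inv]; simpa using he, ?_⟩, by simp⟩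
      rw [h.mem_sep_mul] at h1
      tauto
  refine (Set.ncard_le_ncard this (((h.finite_sep x).inter_of_left _).union
    (((h.finite_sep _).inter_of_left _).image _))).trans ?_
  refine (Set.ncard_union_le _ _).trans ?_
  exact Nat.add_le_add_left (Set.ncard_image_le ((h.finite_sep _).inter_of_left _)) _

/-- A small cancellation criterion for freeness. -/
lemma injective_lift (h : IsWallSystem S sep α β o₁ o₂) {ι : Type*} (x : ι → G) {k : ℕ} (hk : 0 < k)
    (hlen : ∀ i, 2 * k ≤ (sep (x i)).ncard)
    (hsmall : ∀ a b : ι × Bool, a ≠ b →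
      (sep (cond a.2 (x a.1) (x a.1)⁻¹) ∩ sep (cond b.2 (x b.1) (x b.1)⁻¹)).ncard < k) :
    Function.Injective (FreeGroup.lift x) := by
  have key : ∀ (L : List (ι × Bool)) (a : ι × Bool), FreeGroup.IsReduced (a :: L) →
      k ≤ (sep (cond a.2 (x a.1) (x a.1)⁻¹) ∩
        sep (((a :: L).map fun b => cond b.2 (x b.1) (x b.1)⁻¹).prod)).ncard := by
    have hlen' : ∀ a : ι × Bool, 2 * k ≤ (sep (cond a.2 (x a.1) (x a.1)⁻¹)).ncard := by
      rintro ⟨i, _ | _⟩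
      · simpa [h.ncard_sep_inv] using hlen i
      · simpa using hlen i
    intro L
    induction L with
    | nil =>
      intro a _
      have := hlen' a
      simp only [List.map_cons, List.map_nil, List.prod_singleton, Set.inter_self]
      omega
    | cons c L ih =>
      intro a ha
      rw [FreeGroup.isReduced_cons_cons] at ha
      have h1 := ih c ha.2
      have hne : (a.1, !a.2) ≠ c := by
        rintro rfl
        have := ha.1 rfl
        simp at this
      have h2 := h.ncard_inter_lt_of_lt h1 (hsmall _ _ hne)
      have h3 := h.ncard_sep_inv_le (cond a.2 (x a.1) (x a.1)⁻¹)
        (((c :: L).map fun b => cond b.2 (x b.1) (x b.1)⁻¹).prod)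
      have h4 : (cond a.2 (x a.1) (x a.1)⁻¹)⁻¹ = cond (!a.2) (x a.1) (x a.1)⁻¹ := by
        cases a.2 <;> simp
      rw [h4] at h3
      have h5 := hlen' a
      rw [List.map_cons, List.prod_cons]
      dsimp only at h2
      omega
  rw [injective_iff_map_eq_one]
  intro w hw
  classical
  by_contra hne
  rw [← FreeGroup.mk_toWord (x := w), FreeGroup.lift_mk] at hw
  have hr := FreeGroup.isReduced_toWord (x := w)
  have hne' : w.toWord ≠ [] := by rwa [Ne, FreeGroup.toWord_eq_nil_iff]
  obtain ⟨a, L, hL⟩ := List.exists_cons_of_ne_nil hne'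
  rw [hL] at hw hr
  have := key L a hr
  rw [hw, h.sep_one] at this
  simp at this
  omega

end IsWallSystem

section Counting

lemma ncard_le_mul_of_fiber {X Y : Type*} {s : Set X} {t : Set Y} (hs : s.Finite) (ht : t.Finite)
    (f : X → Y) (hf : ∀ a ∈ s, f a ∈ t) (n : ℕ) (hn : ∀ b ∈ t, {a | a ∈ s ∧ f a = b}.ncard ≤ n) :
    s.ncard ≤ n * t.ncard := by
  classical
  rw [Set.ncard_eq_toFinset_card s hs, Set.ncard_eq_toFinset_card t ht]
  refine Finset.card_le_mul_card_image_of_maps_to (f := f) (by simpa using hf) n fun b hb => ?_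
  rw [← Set.ncard_coe_finset]
  simpa using hn b (by simpa using hb)

lemma mul_ncard_le_of_fiber {X Y : Type*} {s : Set X} {t : Set Y} (hs : s.Finite) (ht : t.Finite)
    (f : X → Y) (hf : ∀ a ∈ s, f a ∈ t) (n : ℕ) (hn : ∀ b ∈ t, n ≤ {a | a ∈ s ∧ f a = b}.ncard) :
    n * t.ncard ≤ s.ncard := by
  classical
  rw [Set.ncard_eq_toFinset_card s hs, Set.ncard_eq_toFinset_card t ht]
  refine Finset.mul_card_image_le_card_of_maps_to (f := f) (by simpa using hf) n fun b hb => ?_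
  rw [← Set.ncard_coe_finset]
  simpa using hn b (by simpa using hb)

lemma ncard_le_of_subset_iUnion₂ {X : Type*} {E : Set X} {m M : ℕ} (A : ℕ → ℕ → Set X)
    (hA : ∀ i j, (A i j).Finite)
    (hE : ∀ x ∈ E, ∃ i ≤ m, ∃ j ≤ m, x ∈ A i j) (hM : ∀ i ≤ m, ∀ j ≤ m, (A i j).ncard ≤ M) :
    E.ncard ≤ (m + 1) ^ 2 * M := by
  have hsub : E ⊆ ⋃ q ∈ (Finset.range (m + 1) ×ˢ Finset.range (m + 1)), A q.1 q.2 := by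
    intro x hx
    obtain ⟨i, hi, j, hj, hx⟩ := hE x hx
    simp only [Set.mem_iUnion]
    exact ⟨(i, j), by simp; omega, hx⟩
  refine (Set.ncard_le_ncard hsub
    (Set.Finite.biUnion (Finset.finite_toSet _) fun q _ => hA q.1 q.2)).trans ?_
  refine (Finset.set_ncard_biUnion_le _ _).trans ?_
  refine (Finset.sum_le_card_nsmul _ _ M ?_).trans (by simp [sq])
  rintro ⟨i, j⟩ hq
  simp only [Finset.mem_product, Finset.mem_range] at hq
  exact hM i (by omega) j (by omega)

end Counting

/-- The walls separating `1` from the elements of the unit ball. -/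
def stepWalls {G Ω : Type*} [Group G] (S : Set G) (sep : G → Set Ω) : Set Ω :=
  ⋃ s ∈ wordBall S 1, sep s

/-- The elements moving a wall of `stepWalls` to another one. -/
def stepTransporter {G : Type*} (Ω : Type*) [Group G] [MulAction G Ω] (S : Set G)
    (sep : G → Set Ω) : Set G :=
  {δ | ∃ w ∈ stepWalls S sep, ∃ w' ∈ stepWalls S sep, δ • w = w'}

namespace IsWallSystem

variable {G Ω : Type*} [Group G] [MulAction G Ω] {S : Set G} {sep : G → Set Ω}
  {α β : G} {o₁ o₂ : Ω}

lemma finite_stepWalls (h : IsWallSystem S sep α β o₁ o₂) (hS : S.Finite) :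
    (stepWalls S sep).Finite :=
  (wordBall_one_finite hS).biUnion fun s _ => h.finite_sep s

lemma exists_crossing (h : IsWallSystem S sep α β o₁ o₂) {n : ℕ} {g : G} {p : ℕ → G}
    (hp : IsWordPath S n g p) {i j : ℕ} (hij : i ≤ j) {e : Ω}
    (he : ¬ (e ∈ sep (p i) ↔ e ∈ sep (p j))) :
    ∃ t, i ≤ t ∧ t < j ∧ (p t)⁻¹ • e ∈ stepWalls S sep := by
  induction j, hij using Nat.le_induction with
  | base => exact absurd Iff.rfl he
  | succ j hij ih =>
    by_cases h1 : e ∈ sep (p i) ↔ e ∈ sep (p j)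
    · refine ⟨j, hij, by omega, ?_⟩
      have h2 := h.mem_sep_mul (p j) ((p j)⁻¹ * p (j + 1)) e
      rw [mul_inv_cancel_left] at h2
      refine Set.mem_biUnion (hp.step j) ?_
      tauto
    · obtain ⟨t, ht, ht', hte⟩ := ih h1
      exact ⟨t, ht, by omega, hte⟩

lemma exists_crossing_of_mem (h : IsWallSystem S sep α β o₁ o₂) {n : ℕ} {g : G} {p : ℕ → G}
    (hp : IsWordPath S n g p) {i : ℕ} {e : Ω} (he : e ∈ sep (p i)) :
    ∃ t < i, (p t)⁻¹ • e ∈ stepWalls S sep := by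
  obtain ⟨t, -, ht, hte⟩ := h.exists_crossing hp (Nat.zero_le i) (e := e)
    (by simp [hp.zero, h.sep_one, he])
  exact ⟨t, ht, hte⟩

lemma ncard_near_le (h : IsWallSystem S sep α β o₁ o₂) (hS : S.Finite) (p : ℕ → G) (i j : ℕ) :
    {e | ∃ t, i ≤ t ∧ t < j ∧ (p t)⁻¹ • e ∈ stepWalls S sep}.Finite ∧
    {e | ∃ t, i ≤ t ∧ t < j ∧ (p t)⁻¹ • e ∈ stepWalls S sep}.ncard ≤
      (stepWalls S sep).ncard * (j - i) := by
  have hfin : (⋃ t ∈ Finset.Ico i j, (fun e => p t • e) '' stepWalls S sep).Finite :=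
    Set.Finite.biUnion (Finset.finite_toSet _) fun t _ => (h.finite_stepWalls hS).image _
  have hsub : {e | ∃ t, i ≤ t ∧ t < j ∧ (p t)⁻¹ • e ∈ stepWalls S sep} ⊆
      ⋃ t ∈ Finset.Ico i j, (fun e => p t • e) '' stepWalls S sep := by
    rintro e ⟨t, h1, h2, h3⟩
    simp only [Set.mem_iUnion]
    exact ⟨t, by simp [h1, h2], _, h3, by simp⟩
  refine ⟨hfin.subset hsub, (Set.ncard_le_ncard hsub hfin).trans ?_⟩
  refine (Finset.set_ncard_biUnion_le _ _).trans ?_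
  refine (Finset.sum_le_card_nsmul _ _ (stepWalls S sep).ncard fun t _ =>
    Set.ncard_image_le (h.finite_stepWalls hS)).trans ?_
  simp [mul_comm]

lemma ncard_sep_le (h : IsWallSystem S sep α β o₁ o₂) (hS : S.Finite) {n : ℕ} {g : G}
    (hg : g ∈ wordBall S n) : (sep g).ncard ≤ (stepWalls S sep).ncard * n := by
  obtain ⟨p, hp⟩ := exists_isWordPath hg
  obtain ⟨h1, h2⟩ := h.ncard_near_le hS p 0 n
  refine (Set.ncard_le_ncard ?_ h1).trans h2
  intro e he
  rw [← hp.last] at he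
  obtain ⟨t, ht, hte⟩ := h.exists_crossing_of_mem hp he
  exact ⟨t, Nat.zero_le t, ht, hte⟩

lemma exists_stepTransporter_le (h : IsWallSystem S sep α β o₁ o₂) (hS : S.Finite) :
    ∃ c, ∀ j, (stepTransporter Ω S sep ∩ wordBall S j).ncard ≤ c * (j + 1) := by
  choose c hc using h.transporter
  have hfin := h.finite_stepWalls hS
  refine ⟨∑ q ∈ hfin.toFinset ×ˢ hfin.toFinset, c q.1 q.2, fun j => ?_⟩
  have hsub : stepTransporter Ω S sep ∩ wordBall S j ⊆
      ⋃ q ∈ hfin.toFinset ×ˢ hfin.toFinset, {g | g ∈ wordBall S j ∧ g • q.1 = q.2} := by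
    rintro g ⟨⟨w, hw, w', hw', hg⟩, hgj⟩
    simp only [Set.mem_iUnion]
    exact ⟨(w, w'), by simp [hw, hw'], hgj, hg⟩
  refine (Set.ncard_le_ncard hsub (Set.Finite.biUnion (Finset.finite_toSet _) fun q _ =>
    (wordBall_finite hS j).subset fun _ hx => hx.1)).trans ?_
  refine (Finset.set_ncard_biUnion_le _ _).trans ?_
  rw [Finset.sum_mul]
  exact Finset.sum_le_sum fun q _ => hc q.1 q.2 j

/-- Inserting a detectable element between the two entries of a pair is a map with small
fibres. -/
lemma ncard_pairs_le (h : IsWallSystem S sep α β o₁ o₂) {X : Set (G × G)} {Y : Set G} {R : ℕ}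
    (hX : X.Finite) (hY : Y.Finite)
    (hXY : ∀ x ∈ X, ∀ p' q', (p' = x.1 ∨ p' = x.1 * β) → (q' = x.2 ∨ q' = β * x.2) →
      p' * α * q' ∈ Y ∧ (sep (p' * α * q')).ncard ≤ R) :
    X.ncard ≤ 4 * R ^ 2 * Y.ncard := by
  choose P Q hP hQ hPo hPo' using h.detect
  refine ncard_le_mul_of_fiber hX hY (fun x => P x.1 x.2 * α * Q x.1 x.2)
    (fun x hx => (hXY x hx _ _ (hP _ _) (hQ _ _)).1) _ fun y hy => ?_
  by_cases hyR : (sep y).ncard ≤ R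
  swap
  · have : {a | a ∈ X ∧ P a.1 a.2 * α * Q a.1 a.2 = y} = ∅ := by
      ext a
      simp only [Set.mem_ofPred_eq, Set.mem_empty_iff_false, iff_false, not_and]
      rintro ha rfl
      exact hyR (hXY a ha _ _ (hP _ _) (hQ _ _)).2
    simp [this]
  classical
  have hfin := h.finite_sep y
  have := Set.ncard_le_ncard_of_injOn (s := {a | a ∈ X ∧ P a.1 a.2 * α * Q a.1 a.2 = y})
    (t := (sep y ×ˢ sep y) ×ˢ (Set.univ : Set (Bool × Bool)))
    (fun a => ((P a.1 a.2 • o₁, P a.1 a.2 • o₂),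
      (decide (P a.1 a.2 = a.1), decide (Q a.1 a.2 = a.2)))) ?_ ?_
    ((hfin.prod hfin).prod Set.finite_univ)
  · refine this.trans ?_
    rw [Set.ncard_prod, Set.ncard_prod, Set.ncard_univ]
    simp only [Nat.card_eq_fintype_card, Fintype.card_prod, Fintype.card_bool]
    nlinarith
  · rintro a ⟨-, rfl⟩
    exact ⟨⟨hPo _ _, hPo' _ _⟩, Set.mem_univ _⟩
  · rintro ⟨a, a'⟩ ⟨-, ha⟩ ⟨b, b'⟩ ⟨-, hb⟩ hab
    simp only [Prod.mk.injEq, decide_eq_decide] at hab ha hb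
    obtain ⟨⟨h1, h2⟩, h3, h4⟩ := hab
    have hPP := h.faithful _ _ h1 h2
    have hQQ : Q a a' = Q b b' := by
      rw [← hb, hPP] at ha
      exact mul_left_cancel ha
    rw [hPP] at h3
    rw [hQQ] at h4
    refine Prod.ext ?_ ?_
    · by_cases h5 : P b b' = b
      · exact (h3.2 h5).symm.trans h5
      · have h6 := (hP a a').resolve_left (by rw [hPP]; exact fun h7 => h5 (h3.1 h7))
        have h7 := (hP b b').resolve_left h5
        rw [hPP, h7] at h6
        exact (mul_right_cancel h6).symm
    · by_cases h5 : Q b b' = b'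
      · exact (h4.2 h5).symm.trans h5
      · have h6 := (hQ a a').resolve_left (by rw [hQQ]; exact fun h7 => h5 (h4.1 h7))
        have h7 := (hQ b b').resolve_left h5
        rw [hQQ, h7] at h6
        exact (mul_left_cancel h6).symm

lemma mem_wordBall_of_insert {r : ℕ} (hα : α ∈ wordBall S r) (hβ : β ∈ wordBall S r) {i j : ℕ}
    {p q p' q' : G} (hp : p ∈ wordBall S i) (hq : q ∈ wordBall S j)
    (hp' : p' = p ∨ p' = p * β) (hq' : q' = q ∨ q' = β * q) :
    p' * α * q' ∈ wordBall S (i + j + 3 * r) := by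
  have h1 : p' ∈ wordBall S (i + r) := by
    rcases hp' with rfl | rfl
    · exact wordBall_mono (by omega) hp
    · exact mul_mem_wordBall hp hβ
  have h2 : q' ∈ wordBall S (r + j) := by
    rcases hq' with rfl | rfl
    · exact wordBall_mono (by omega) hq
    · exact mul_mem_wordBall hβ hq
  exact wordBall_mono (by omega) (mul_mem_wordBall (mul_mem_wordBall h1 hα) h2)

lemma _root_.ncard_wordBall_add_le (hS : S.Finite) (i j : ℕ) :
    (wordBall S (i + j)).ncard ≤ (wordBall S i).ncard * (wordBall S j).ncard := by
  have hsub : wordBall S (i + j) ⊆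
      (fun x : G × G => x.1 * x.2) '' (wordBall S i ×ˢ wordBall S j) := by
    intro g hg
    obtain ⟨p, hp⟩ := exists_isWordPath hg
    refine ⟨(p i, (p i)⁻¹ * g), ⟨hp.mem i, ?_⟩, by simp⟩
    simpa using hp.inv_mul_last_mem (Nat.le_add_right i j)
  have hfin := (wordBall_finite hS i).prod (wordBall_finite hS j)
  refine (Set.ncard_le_ncard hsub (hfin.image _)).trans ((Set.ncard_image_le hfin).trans ?_)
  rw [Set.ncard_prod]

lemma exists_wordBall_mul_le (h : IsWallSystem S sep α β o₁ o₂) (hS : S.Finite)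
    (hgen : Subgroup.closure S = ⊤) :
    ∃ c, ∀ i j, (wordBall S i).ncard * (wordBall S j).ncard ≤
      c * (i + j + 1) ^ 2 * (wordBall S (i + j)).ncard := by
  obtain ⟨r₁, hr₁⟩ := exists_mem_wordBall hgen α
  obtain ⟨r₂, hr₂⟩ := exists_mem_wordBall hgen β
  set r := max r₁ r₂
  have hα : α ∈ wordBall S r := wordBall_mono (le_max_left _ _) hr₁
  have hβ : β ∈ wordBall S r := wordBall_mono (le_max_right _ _) hr₂
  set K := (stepWalls S sep).ncard
  refine ⟨4 * (K * (3 * r + 1)) ^ 2 * (wordBall S (3 * r)).ncard, fun i j => ?_⟩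
  have h1 := h.ncard_pairs_le (X := wordBall S i ×ˢ wordBall S j)
    (Y := wordBall S (i + j + 3 * r)) (R := K * (i + j + 3 * r))
    ((wordBall_finite hS i).prod (wordBall_finite hS j)) (wordBall_finite hS _)
    (fun x hx p' q' hp' hq' => by
      have := mem_wordBall_of_insert hα hβ hx.1 hx.2 hp' hq'
      exact ⟨this, h.ncard_sep_le hS this⟩)
  rw [Set.ncard_prod] at h1
  refine h1.trans ?_
  have h2 : K * (i + j + 3 * r) ≤ K * (3 * r + 1) * (i + j + 1) := by
    rw [mul_assoc]
    exact Nat.mul_le_mul_left _ (by nlinarith [Nat.zero_le (r * i), Nat.zero_le (r * j)])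
  calc 4 * (K * (i + j + 3 * r)) ^ 2 * (wordBall S (i + j + 3 * r)).ncard
      ≤ 4 * (K * (3 * r + 1) * (i + j + 1)) ^ 2 *
        ((wordBall S (i + j)).ncard * (wordBall S (3 * r)).ncard) := by
        gcongr
        exact ncard_wordBall_add_le hS _ _
    _ = _ := by ring

end IsWallSystem

lemma finite_image₃ {X Y Z W : Type*} {A : Set X} {B : Set Y} {C : Set Z} (hA : A.Finite)
    (hB : B.Finite) (hC : C.Finite) (f : X → Y → Z → W) :
    {g | ∃ x ∈ A, ∃ y ∈ B, ∃ z ∈ C, f x y z = g}.Finite := by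
  refine ((hA.prod (hB.prod hC)).image fun t => f t.1 t.2.1 t.2.2).subset ?_
  rintro g ⟨x, hx, y, hy, z, hz, rfl⟩
  exact ⟨(x, y, z), ⟨hx, hy, hz⟩, rfl⟩

lemma ncard_image₃_le {X Y Z W : Type*} {A : Set X} {B : Set Y} {C : Set Z} (hA : A.Finite)
    (hB : B.Finite) (hC : C.Finite) (f : X → Y → Z → W) :
    {g | ∃ x ∈ A, ∃ y ∈ B, ∃ z ∈ C, f x y z = g}.ncard ≤ A.ncard * B.ncard * C.ncard := by
  have hfin := hA.prod (hB.prod hC)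
  have hsub : {g | ∃ x ∈ A, ∃ y ∈ B, ∃ z ∈ C, f x y z = g} ⊆
      (fun t => f t.1 t.2.1 t.2.2) '' (A ×ˢ (B ×ˢ C)) := by
    rintro g ⟨x, hx, y, hy, z, hz, rfl⟩
    exact ⟨(x, y, z), ⟨hx, hy, hz⟩, rfl⟩
  refine (Set.ncard_le_ncard hsub (hfin.image _)).trans ((Set.ncard_image_le hfin).trans ?_)
  rw [Set.ncard_prod, Set.ncard_prod, mul_assoc]

/-- The products `x * q * r` of total length at most `m` in which `q` is an element of
`stepTransporter` of length at least `L`. -/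
def longTransport {G : Type*} (Ω : Type*) [Group G] [MulAction G Ω] (S : Set G)
    (sep : G → Set Ω) (m L : ℕ) : Set G :=
  {g | ∃ i ℓ, L ≤ ℓ ∧ i + ℓ ≤ m ∧ ∃ x ∈ wordBall S i, ∃ q ∈ stepTransporter Ω S sep ∩ wordBall S ℓ,
    ∃ r ∈ wordBall S (m - i - ℓ), x * q * r = g}

namespace IsWallSystem

variable {G Ω : Type*} [Group G] [MulAction G Ω] {S : Set G} {sep : G → Set Ω}
  {α β : G} {o₁ o₂ : Ω}

lemma _root_.ncard_wordBall_mono (hS : S.Finite) {i j : ℕ} (hij : i ≤ j) :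
    (wordBall S i).ncard ≤ (wordBall S j).ncard :=
  Set.ncard_le_ncard (wordBall_mono hij) (wordBall_finite hS j)

lemma exists_longTransport_le (h : IsWallSystem S sep α β o₁ o₂) (hS : S.Finite)
    (hgen : Subgroup.closure S = ⊤) :
    ∃ c, ∀ m L, (longTransport Ω S sep m L).Finite ∧ (longTransport Ω S sep m L).ncard ≤
      c * (m + 1) ^ 5 * (wordBall S (m - L)).ncard := by
  obtain ⟨c₁, hc₁⟩ := h.exists_stepTransporter_le hS
  obtain ⟨c₂, hc₂⟩ := h.exists_wordBall_mul_le hS hgen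
  refine ⟨c₁ * c₂, fun m L => ⟨?_, ?_⟩⟩
  · refine (wordBall_finite hS m).subset ?_
    rintro g ⟨i, ℓ, hℓ, hi, x, hx, q, hq, r, hr, rfl⟩
    exact wordBall_mono (by omega) (mul_mem_wordBall (mul_mem_wordBall hx hq.2) hr)
  · refine (ncard_le_of_subset_iUnion₂ (m := m) (M := c₁ * c₂ * (m + 1) ^ 3 *
      (wordBall S (m - L)).ncard)
      (fun i ℓ => {g | ∃ x ∈ wordBall S i, ∃ q ∈ stepTransporter Ω S sep ∩ wordBall S ℓ,
        ∃ r ∈ {r | L ≤ ℓ ∧ i + ℓ ≤ m ∧ r ∈ wordBall S (m - i - ℓ)}, x * q * r = g})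
      (fun i ℓ => ?_) ?_ fun i hi ℓ hℓ => ?_).trans (le_of_eq (by ring))
    · exact finite_image₃ (wordBall_finite hS i) ((wordBall_finite hS ℓ).inter_of_right _)
        ((wordBall_finite hS (m - i - ℓ)).subset fun r hr => hr.2.2) _
    · rintro g ⟨i, ℓ, hℓ, hi, x, hx, q, hq, r, hr, rfl⟩
      exact ⟨i, by omega, ℓ, by omega, x, hx, q, hq, r, ⟨hℓ, hi, hr⟩, rfl⟩
    · by_cases hcase : L ≤ ℓ ∧ i + ℓ ≤ m
      swap
      · have : ∀ r, ¬ (L ≤ ℓ ∧ i + ℓ ≤ m ∧ r ∈ wordBall S (m - i - ℓ)) := fun r hr =>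
          hcase ⟨hr.1, hr.2.1⟩
        simp [this]
      have hset : {r | L ≤ ℓ ∧ i + ℓ ≤ m ∧ r ∈ wordBall S (m - i - ℓ)} =
          wordBall S (m - i - ℓ) := by
        ext r
        simp [hcase.1, hcase.2]
      rw [hset]
      refine (ncard_image₃_le (wordBall_finite hS i) ((wordBall_finite hS ℓ).inter_of_right _)
        (wordBall_finite hS (m - i - ℓ)) _).trans ?_
      have h1 := hc₁ ℓ
      have h2 := hc₂ i (m - i - ℓ)
      have h3 : i + (m - i - ℓ) = m - ℓ := by omega
      rw [h3] at h2
      calc _ = (stepTransporter Ω S sep ∩ wordBall S ℓ).ncard *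
            ((wordBall S i).ncard * (wordBall S (m - i - ℓ)).ncard) := by ring
        _ ≤ (c₁ * (m + 1)) * (c₂ * (m + 1) ^ 2 * (wordBall S (m - L)).ncard) := by
            refine Nat.mul_le_mul (h1.trans (by gcongr)) (h2.trans ?_)
            exact Nat.mul_le_mul (by gcongr; omega) (ncard_wordBall_mono hS (by omega))
        _ = _ := by ring

lemma exists_self_le (h : IsWallSystem S sep α β o₁ o₂) (hS : S.Finite)
    (hgen : Subgroup.closure S = ⊤) :
    ∃ c, ∀ m L, L ≤ m →
      {g | g ∈ wordBall S m ∧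
        2 * (stepWalls S sep).ncard * L + 1 ≤ (sep g ∩ sep g⁻¹).ncard}.ncard ≤
      c * (m + 1) ^ 5 * (wordBall S (m - L)).ncard := by
  obtain ⟨c₁, hc₁⟩ := h.exists_stepTransporter_le hS
  obtain ⟨c₂, hc₂⟩ := h.exists_wordBall_mul_le hS hgen
  refine ⟨6 * c₁ * c₂, fun m L hL => ?_⟩
  have hfin₁ : ∀ i j, {g | ∃ x ∈ wordBall S i, ∃ δ ∈ stepTransporter Ω S sep ∩ wordBall S (3 * m),
      ∃ y ∈ wordBall S j, x * y * δ * x⁻¹ = g}.Finite := fun i j =>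
    finite_image₃ (wordBall_finite hS i) ((wordBall_finite hS _).inter_of_right _)
      (wordBall_finite hS j) fun x δ y => x * y * δ * x⁻¹
  have hfin₂ : ∀ i j, {g | ∃ x ∈ wordBall S i, ∃ δ ∈ stepTransporter Ω S sep ∩ wordBall S (3 * m),
      ∃ y ∈ wordBall S j, x * δ * (x * y)⁻¹ = g}.Finite := fun i j =>
    finite_image₃ (wordBall_finite hS i) ((wordBall_finite hS _).inter_of_right _)
      (wordBall_finite hS j) fun x δ y => x * δ * (x * y)⁻¹
  refine (ncard_le_of_subset_iUnion₂ (m := m) (M := 6 * c₁ * c₂ * (m + 1) ^ 3 *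
    (wordBall S (m - L)).ncard)
    (fun i j => {g | i + j ≤ m - L ∧ g ∈ {g | ∃ x ∈ wordBall S i,
      ∃ δ ∈ stepTransporter Ω S sep ∩ wordBall S (3 * m),
      ∃ y ∈ wordBall S j, x * y * δ * x⁻¹ = g} ∪ {g | ∃ x ∈ wordBall S i,
      ∃ δ ∈ stepTransporter Ω S sep ∩ wordBall S (3 * m),
      ∃ y ∈ wordBall S j, x * δ * (x * y)⁻¹ = g}})
    (fun i j => ((hfin₁ i j).union (hfin₂ i j)).subset fun g hg => hg.2) ?_
    fun i hi j hj => ?_).trans (le_of_eq (by ring))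
  · rintro g ⟨hg, hk⟩
    obtain ⟨p, hp⟩ := exists_isWordPath hg
    obtain ⟨hf, hN⟩ := h.ncard_near_le hS p (m - L) m
    have hmL : m - (m - L) = L := by omega
    rw [hmL] at hN
    set near := {e | ∃ t, m - L ≤ t ∧ t < m ∧ (p t)⁻¹ • e ∈ stepWalls S sep}
    have hf' : ((fun e => g⁻¹ • e) '' near).Finite := hf.image _
    have hN' : ((fun e => g⁻¹ • e) '' near).ncard ≤ (stepWalls S sep).ncard * L :=
      (Set.ncard_image_le hf).trans hN
    have hlt : (near ∪ (fun e => g⁻¹ • e) '' near).ncard < (sep g ∩ sep g⁻¹).ncard := by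
      refine lt_of_le_of_lt (Set.ncard_union_le _ _) ?_
      nlinarith
    obtain ⟨e, he, hne⟩ := Set.exists_mem_notMem_of_ncard_lt_ncard hlt (hf.union hf')
    have he1 := he.1
    have he2 : g • e ∈ sep (p m) := by
      rw [hp.last]
      exact (h.mem_sep_inv g e).1 he.2
    rw [← hp.last] at he1
    obtain ⟨t, ht, hte⟩ := h.exists_crossing_of_mem hp he1
    obtain ⟨t', ht', hte'⟩ := h.exists_crossing_of_mem hp he2
    have hlt : t < m - L := by
      by_contra hcon
      exact hne (Or.inl ⟨t, not_lt.1 hcon, ht, hte⟩)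
    have hlt' : t' < m - L := by
      by_contra hcon
      exact hne (Or.inr ⟨g • e, ⟨t', not_lt.1 hcon, ht', hte'⟩, by simp⟩)
    have hδ : (p t')⁻¹ * g * p t ∈ stepTransporter Ω S sep ∩ wordBall S (3 * m) := by
      refine ⟨⟨_, hte, _, hte', by simp [mul_smul]⟩, ?_⟩
      exact wordBall_mono (by omega)
        (mul_mem_wordBall (mul_mem_wordBall (inv_mem_wordBall (hp.mem t')) hg) (hp.mem t))
    rcases le_total t t' with htt | htt
    · refine ⟨t, by omega, t' - t, by omega, by omega, Or.inl ⟨p t, hp.mem t, _, hδ, _,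
        hp.inv_mul_mem htt, by group⟩⟩
    · refine ⟨t', by omega, t - t', by omega, by omega, Or.inr ⟨p t', hp.mem t', _, hδ, _,
        hp.inv_mul_mem htt, by group⟩⟩
  · by_cases hij : i + j ≤ m - L
    swap
    · simp [hij]
    refine (Set.ncard_le_ncard (fun g hg => hg.2) ((hfin₁ i j).union (hfin₂ i j))).trans
      ((Set.ncard_union_le _ _).trans ?_)
    have h1 := ncard_image₃_le (wordBall_finite hS i)
      ((wordBall_finite hS (3 * m)).inter_of_right (stepTransporter Ω S sep))
      (wordBall_finite hS j) fun x δ y => x * y * δ * x⁻¹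
    have h2 := ncard_image₃_le (wordBall_finite hS i)
      ((wordBall_finite hS (3 * m)).inter_of_right (stepTransporter Ω S sep))
      (wordBall_finite hS j) fun x δ y => x * δ * (x * y)⁻¹
    have h3 : (wordBall S i).ncard * (stepTransporter Ω S sep ∩ wordBall S (3 * m)).ncard *
        (wordBall S j).ncard ≤ 3 * c₁ * c₂ * (m + 1) ^ 3 * (wordBall S (m - L)).ncard := by
      calc _ = (stepTransporter Ω S sep ∩ wordBall S (3 * m)).ncard *
            ((wordBall S i).ncard * (wordBall S j).ncard) := by ring
        _ ≤ (c₁ * (3 * (m + 1))) * (c₂ * (m + 1) ^ 2 * (wordBall S (m - L)).ncard) := by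
            refine Nat.mul_le_mul ((hc₁ _).trans ?_) ((hc₂ i j).trans ?_)
            · gcongr; omega
            · exact Nat.mul_le_mul (by gcongr; omega) (ncard_wordBall_mono hS (by omega))
        _ = _ := by ring
    refine (Nat.add_le_add (h1.trans h3) (h2.trans h3)).trans (le_of_eq (by ring))

lemma exists_pair_le (h : IsWallSystem S sep α β o₁ o₂) (hS : S.Finite)
    (hgen : Subgroup.closure S = ⊤) :
    ∃ c, ∀ m L, L ≤ m →
      {x : G × G | x.1 ∈ wordBall S m ∧ x.2 ∈ wordBall S m ∧
        2 * (stepWalls S sep).ncard * L + 1 ≤ (sep x.1 ∩ sep x.2).ncard}.ncard ≤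
      c * (m + 1) ^ 5 * (wordBall S m).ncard * (wordBall S (m - L)).ncard := by
  obtain ⟨c₁, hc₁⟩ := h.exists_stepTransporter_le hS
  obtain ⟨c₂, hc₂⟩ := h.exists_wordBall_mul_le hS hgen
  refine ⟨2 * c₁ * c₂, fun m L hL => ?_⟩
  have hΔ := (wordBall_finite hS (2 * m)).inter_of_right (stepTransporter Ω S sep)
  refine (ncard_le_of_subset_iUnion₂ (m := m) (M := 2 * c₁ * c₂ * (m + 1) ^ 3 *
    (wordBall S m).ncard * (wordBall S (m - L)).ncard)
    (fun i _ => {x : G × G | ∃ y ∈ wordBall S i ×ˢ wordBall S (m - i),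
      ∃ δ ∈ stepTransporter Ω S sep ∩ wordBall S (2 * m), ∃ q ∈ wordBall S (m - L),
      (y.1 * y.2, y.1 * δ * q) = x})
    (fun i _ => ?_) ?_ fun i hi _ _ => ?_).trans (le_of_eq (by ring))
  · exact finite_image₃ ((wordBall_finite hS i).prod (wordBall_finite hS (m - i))) hΔ
      (wordBall_finite hS _) fun (y : G × G) δ q => (y.1 * y.2, y.1 * δ * q)
  · rintro ⟨g, g'⟩ ⟨hg, hg', hk⟩
    dsimp only at hg hg' hk
    obtain ⟨p, hp⟩ := exists_isWordPath hg
    obtain ⟨p', hp'⟩ := exists_isWordPath hg'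
    obtain ⟨hf, hN⟩ := h.ncard_near_le hS p' 0 L
    have hlt := lt_of_le_of_lt hN (show _ < (sep g ∩ sep g').ncard by
      rw [Nat.sub_zero]; nlinarith [Nat.zero_le ((stepWalls S sep).ncard * L)])
    obtain ⟨e, he, hne⟩ := Set.exists_mem_notMem_of_ncard_lt_ncard hlt hf
    have he1 := he.1
    have he2 := he.2
    rw [← hp.last] at he1
    rw [← hp'.last] at he2
    obtain ⟨t, ht, hte⟩ := h.exists_crossing_of_mem hp he1
    obtain ⟨t', ht', hte'⟩ := h.exists_crossing_of_mem hp' he2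
    have hLt : L ≤ t' := by
      by_contra hcon
      exact hne ⟨t', Nat.zero_le _, not_le.1 hcon, hte'⟩
    refine ⟨t, ht.le, 0, Nat.zero_le _, (p t, (p t)⁻¹ * g),
      ⟨hp.mem t, hp.inv_mul_last_mem ht.le⟩, (p t)⁻¹ * p' t', ⟨⟨_, hte', _, hte, ?_⟩, ?_⟩,
      (p' t')⁻¹ * g', wordBall_mono (by omega) (hp'.inv_mul_last_mem ht'.le), ?_⟩
    · simp [mul_smul]
    · exact wordBall_mono (by omega) (mul_mem_wordBall (inv_mem_wordBall (hp.mem t)) (hp'.mem t'))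
    · simp
  · refine (ncard_image₃_le ((wordBall_finite hS i).prod (wordBall_finite hS (m - i))) hΔ
      (wordBall_finite hS _) fun (y : G × G) δ q => (y.1 * y.2, y.1 * δ * q)).trans ?_
    have h2 := hc₂ i (m - i)
    rw [show i + (m - i) = m by omega] at h2
    rw [Set.ncard_prod]
    calc _ ≤ c₂ * (m + 1) ^ 2 * (wordBall S m).ncard * (c₁ * (2 * (m + 1))) *
          (wordBall S (m - L)).ncard := by
          gcongr
          exact (hc₁ _).trans (by gcongr; omega)
      _ = _ := by ring

end IsWallSystem

namespace IsWallSystem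

variable {G Ω : Type*} [Group G] [MulAction G Ω] {S : Set G} {sep : G → Set Ω}
  {α β : G} {o₁ o₂ : Ω}

/-- Along a geodesic ending at an element outside `longTransport`, the number of walls
separating `1` from an initial segment is controlled by the number of walls separating `1` from the
endpoint. -/
lemma ncard_sep_path_le (h : IsWallSystem S sep α β o₁ o₂) (hS : S.Finite) {m L n : ℕ} {g : G}
    {p : ℕ → G} (hp : IsWordPath S n g p) (hn : n ≤ m) (hg : g ∉ longTransport Ω S sep m L)
    {i : ℕ} (hi : i ≤ n) :
    (sep (p i)).ncard ≤ (sep g).ncard + (stepWalls S sep).ncard * L := by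
  obtain ⟨hf, hN⟩ := h.ncard_near_le hS p (i - L) i
  have hsub : sep (p i) ⊆
      sep g ∪ {e | ∃ t, i - L ≤ t ∧ t < i ∧ (p t)⁻¹ • e ∈ stepWalls S sep} := by
    intro e he
    by_cases heg : e ∈ sep g
    · exact Or.inl heg
    refine Or.inr ?_
    obtain ⟨t, ht, hte⟩ := h.exists_crossing_of_mem hp he
    obtain ⟨t', hit, ht', hte'⟩ := h.exists_crossing hp hi (e := e) (by
      rw [hp.last]; tauto)
    refine ⟨t, ?_, ht, hte⟩
    by_contra hcon
    refine hg ⟨t, t' - t, by omega, by omega, p t, hp.mem t, (p t)⁻¹ * p t',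
      ⟨⟨_, hte', _, hte, by simp [mul_smul]⟩, hp.inv_mul_mem (by omega)⟩, (p t')⁻¹ * g,
      wordBall_mono (by omega) (hp.inv_mul_last_mem ht'.le), by group⟩
  refine (Set.ncard_le_ncard hsub ((h.finite_sep g).union hf)).trans
    ((Set.ncard_union_le _ _).trans (Nat.add_le_add_left (hN.trans ?_) _))
  exact Nat.mul_le_mul_left _ (by omega)

lemma exists_short_le (h : IsWallSystem S sep α β o₁ o₂) (hS : S.Finite)
    (hgen : Subgroup.closure S = ⊤) :
    ∃ c, ∀ m L D, L ≤ m →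
      (m - L) * {g | g ∈ wordBall S m ∧ g ∉ wordBall S (m - L) ∧ g ∉ longTransport Ω S sep m L ∧
        (sep g).ncard ≤ D}.ncard ≤ c * (D + L + 1) ^ 2 * (wordBall S m).ncard := by
  obtain ⟨r₁, hr₁⟩ := exists_mem_wordBall hgen α
  obtain ⟨r₂, hr₂⟩ := exists_mem_wordBall hgen β
  set r := max r₁ r₂
  have hα : α ∈ wordBall S r := wordBall_mono (le_max_left _ _) hr₁
  have hβ : β ∈ wordBall S r := wordBall_mono (le_max_right _ _) hr₂
  set K := (stepWalls S sep).ncard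
  set c₀ := 2 * (sep β).ncard + (sep α).ncard with hc₀
  refine ⟨4 * (3 + 2 * K + c₀) ^ 2 * (wordBall S (3 * r)).ncard, fun m L D hL => ?_⟩
  set E := {g | g ∈ wordBall S m ∧ g ∉ wordBall S (m - L) ∧ g ∉ longTransport Ω S sep m L ∧
    (sep g).ncard ≤ D} with hE
  have hEfin : E.Finite := (wordBall_finite hS m).subset fun g hg => hg.1
  set X := {x : G × G | x.1 * x.2 ∈ E ∧ (sep x.1).ncard ≤ D + K * L ∧
    ∃ i ≤ m, x.1 ∈ wordBall S i ∧ x.2 ∈ wordBall S (m - i)} with hX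
  have hXfin : X.Finite := by
    refine ((wordBall_finite hS m).prod (wordBall_finite hS m)).subset ?_
    rintro x ⟨-, -, i, hi, h1, h2⟩
    exact ⟨wordBall_mono hi h1, wordBall_mono (by omega) h2⟩
  have h1 : (m - L) * E.ncard ≤ X.ncard := by
    refine mul_ncard_le_of_fiber hXfin hEfin (fun x => x.1 * x.2) (fun x hx => hx.1) _ ?_
    intro g hg
    classical
    have hex : ∃ n, g ∈ wordBall S n := ⟨m, hg.1⟩
    set n := Nat.find hex with hn
    have hgn : g ∈ wordBall S n := Nat.find_spec hex
    have hnm : n ≤ m := Nat.find_min' hex hg.1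
    have hmin : ∀ k, g ∈ wordBall S k → n ≤ k := fun k hk => Nat.find_min' hex hk
    have hLn : m - L < n := by
      by_contra hcon
      exact hg.2.1 (wordBall_mono (not_lt.1 hcon) hgn)
    obtain ⟨p, hp⟩ := exists_isWordPath hgn
    have hinj : ∀ i j, i < j → j ≤ n → p i ≠ p j := by
      intro i j hij hj heq
      have h2 := mul_mem_wordBall (hp.mem i) (hp.inv_mul_last_mem hj)
      rw [heq, mul_inv_cancel_left] at h2
      have := hmin _ h2
      omega
    have h3 := Set.ncard_le_ncard_of_injOn (s := (Finset.range (m - L) : Set ℕ))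
      (t := {a | a ∈ X ∧ a.1 * a.2 = g}) (fun i => (p i, (p i)⁻¹ * g)) ?_ ?_
      (hXfin.subset fun x hx => hx.1)
    · simpa [Set.ncard_coe_finset] using h3
    · intro i hi
      simp only [Finset.coe_range, Set.mem_Iio] at hi
      refine ⟨⟨by simpa using hg, ?_, i, by omega, hp.mem i,
        wordBall_mono (by omega) (hp.inv_mul_last_mem (show i ≤ n by omega))⟩, by simp⟩
      exact (h.ncard_sep_path_le hS hp hnm hg.2.2.1 (by omega)).trans
        (Nat.add_le_add_right hg.2.2.2 _)
    · intro i hi j hj hij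
      simp only [Finset.coe_range, Set.mem_Iio, Prod.mk.injEq] at hi hj hij
      rcases lt_trichotomy i j with hlt | rfl | hlt
      · exact absurd hij.1 (hinj i j hlt (by omega))
      · rfl
      · exact absurd hij.1.symm (hinj j i hlt (by omega))
  have h2 := h.ncard_pairs_le (X := X) (Y := wordBall S (m + 3 * r))
    (R := 3 * D + 2 * (K * L) + c₀) hXfin (wordBall_finite hS _) ?_
  · calc (m - L) * E.ncard ≤ X.ncard := h1
      _ ≤ 4 * (3 * D + 2 * (K * L) + c₀) ^ 2 * (wordBall S (m + 3 * r)).ncard := h2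
      _ ≤ 4 * ((3 + 2 * K + c₀) * (D + L + 1)) ^ 2 *
          ((wordBall S m).ncard * (wordBall S (3 * r)).ncard) := by
          have : 3 * D + 2 * (K * L) + c₀ ≤ (3 + 2 * K + c₀) * (D + L + 1) := by
            nlinarith [Nat.zero_le (K * D), Nat.zero_le (c₀ * D), Nat.zero_le (c₀ * L)]
          exact Nat.mul_le_mul (by gcongr) (ncard_wordBall_add_le hS _ _)
      _ = _ := by ring
  · rintro ⟨x, y⟩ ⟨hxE, hx, i, hi, hxi, hyi⟩ p' q' hp' hq'
    dsimp only at *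
    refine ⟨wordBall_mono (by omega) (mem_wordBall_of_insert hα hβ hxi hyi hp' hq'), ?_⟩
    have hy : (sep y).ncard ≤ 2 * D + K * L := by
      have := h.ncard_sep_mul_le x⁻¹ (x * y)
      rw [inv_mul_cancel_left, h.ncard_sep_inv] at this
      have h4 : (sep (x * y)).ncard ≤ D := hxE.2.2.2
      omega
    have hx' : (sep p').ncard ≤ (sep x).ncard + (sep β).ncard := by
      rcases hp' with rfl | rfl
      · exact Nat.le_add_right _ _
      · exact h.ncard_sep_mul_le _ _
    have hy' : (sep q').ncard ≤ (sep β).ncard + (sep y).ncard := by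
      rcases hq' with rfl | rfl
      · exact Nat.le_add_left _ _
      · exact h.ncard_sep_mul_le _ _
    have h5 := h.ncard_sep_mul_le (p' * α) q'
    have h6 := h.ncard_sep_mul_le p' α
    omega

/-- The elements and the pairs to be avoided by the entries of a tuple for it to satisfy the
small cancellation criterion are rare. -/
lemma exists_exceptional (h : IsWallSystem S sep α β o₁ o₂) (hS : S.Finite)
    (hgen : Subgroup.closure S = ⊤) :
    ∃ c, ∀ m L, L ≤ m → ∃ (k : ℕ) (E₁ : Set G) (E₂ : Set (G × G)), 0 < k ∧ E₁.Finite ∧ E₂.Finite ∧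
      (∀ g ∈ wordBall S m, g ∉ E₁ → 2 * k ≤ (sep g).ncard ∧ (sep g ∩ sep g⁻¹).ncard < k) ∧
      (∀ g ∈ wordBall S m, ∀ g' ∈ wordBall S m, (g, g') ∉ E₂ → (sep g ∩ sep g').ncard < k) ∧
      (m - L) * E₁.ncard ≤ c * ((L + 1) ^ 2 * (wordBall S m).ncard +
        (m + 1) ^ 6 * (wordBall S (m - L)).ncard) ∧
      E₂.ncard ≤ c * (m + 1) ^ 5 * (wordBall S m).ncard * (wordBall S (m - L)).ncard := by
  obtain ⟨c₁, hc₁⟩ := h.exists_longTransport_le hS hgen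
  obtain ⟨c₂, hc₂⟩ := h.exists_self_le hS hgen
  obtain ⟨c₃, hc₃⟩ := h.exists_pair_le hS hgen
  obtain ⟨c₄, hc₄⟩ := h.exists_short_le hS hgen
  set K := (stepWalls S sep).ncard
  refine ⟨1 + c₁ + c₂ + c₃ + c₄ * (4 * K + 3) ^ 2, fun m L hL => ?_⟩
  set k := 2 * K * L + 1 with hk
  have hfin := wordBall_finite hS m
  set A := {g | g ∈ wordBall S m ∧ k ≤ (sep g ∩ sep g⁻¹).ncard} with hA
  set B := {g | g ∈ wordBall S m ∧ g ∉ wordBall S (m - L) ∧ g ∉ longTransport Ω S sep m L ∧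
    (sep g).ncard ≤ 2 * k} with hB
  have hAfin : A.Finite := hfin.subset fun g hg => hg.1
  have hBfin : B.Finite := hfin.subset fun g hg => hg.1
  refine ⟨k, wordBall S (m - L) ∪ longTransport Ω S sep m L ∪ A ∪ B,
    {x : G × G | x.1 ∈ wordBall S m ∧ x.2 ∈ wordBall S m ∧ k ≤ (sep x.1 ∩ sep x.2).ncard},
    by omega, (((wordBall_finite hS _).union (hc₁ m L).1).union hAfin).union hBfin,
    (hfin.prod hfin).subset fun x hx => ⟨hx.1, hx.2.1⟩, ?_, ?_, ?_, ?_⟩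
  · intro g hg hgE
    simp only [Set.mem_union, not_or] at hgE
    obtain ⟨⟨⟨h1, h2⟩, h3⟩, h4⟩ := hgE
    refine ⟨?_, ?_⟩
    · by_contra hcon
      exact h4 ⟨hg, h1, h2, by omega⟩
    · by_contra hcon
      exact h3 ⟨hg, not_lt.1 hcon⟩
  · intro g hg g' hg' hgE
    by_contra hcon
    exact hgE ⟨hg, hg', not_lt.1 hcon⟩
  · have h1 := (hc₁ m L).2
    have h2 : A.ncard ≤ _ := hc₂ m L hL
    have h4 : (m - L) * B.ncard ≤ _ := hc₄ m L (2 * k) hL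
    set b := (wordBall S m).ncard
    set b' := (wordBall S (m - L)).ncard
    have h5 : (2 * k + L + 1) ≤ (4 * K + 3) * (L + 1) := by
      rw [hk]
      nlinarith [Nat.zero_le K]
    have h6 := ((Set.ncard_union_le (wordBall S (m - L) ∪ longTransport Ω S sep m L ∪ A) B).trans
      (Nat.add_le_add_right ((Set.ncard_union_le (wordBall S (m - L) ∪ longTransport Ω S sep m L)
      A).trans (Nat.add_le_add_right (Set.ncard_union_le _ _) _)) _))
    calc _ ≤ (m - L) * (b' + (longTransport Ω S sep m L).ncard + A.ncard + B.ncard) :=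
          Nat.mul_le_mul_left _ h6
      _ = (m - L) * (b' + (longTransport Ω S sep m L).ncard + A.ncard) + (m - L) * B.ncard := by
          ring
      _ ≤ (m + 1) * ((m + 1) ^ 5 * b' + c₁ * (m + 1) ^ 5 * b' + c₂ * (m + 1) ^ 5 * b') +
          c₄ * ((4 * K + 3) * (L + 1)) ^ 2 * b := by
          refine Nat.add_le_add (Nat.mul_le_mul (by omega) ?_) (h4.trans (by gcongr))
          refine Nat.add_le_add (Nat.add_le_add ?_ h1) h2
          exact Nat.le_mul_of_pos_left _ (by positivity)
      _ = (1 + c₁ + c₂) * ((m + 1) ^ 6 * b') +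
          (c₄ * (4 * K + 3) ^ 2) * ((L + 1) ^ 2 * b) := by ring
      _ ≤ (1 + c₁ + c₂ + c₃ + c₄ * (4 * K + 3) ^ 2) * ((m + 1) ^ 6 * b') +
          (1 + c₁ + c₂ + c₃ + c₄ * (4 * K + 3) ^ 2) * ((L + 1) ^ 2 * b) := by
          exact Nat.add_le_add (Nat.mul_le_mul_right _ (by omega))
            (Nat.mul_le_mul_right _ (by omega))
      _ = _ := by ring
  · refine (hc₃ m L hL).trans ?_
    gcongr
    omega

end IsWallSystem

section Tuples

variable {X : Type*} {n : ℕ}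

lemma finite_pi_tuples {B : Set X} (hB : B.Finite) : {x : Fin n → X | ∀ i, x i ∈ B}.Finite := by
  refine (Set.Finite.pi (t := fun _ : Fin n => B) fun _ => hB).subset ?_
  intro x hx i _
  exact hx i

lemma ncard_pi_tuples {B : Set X} (hB : B.Finite) :
    {x : Fin n → X | ∀ i, x i ∈ B}.ncard = B.ncard ^ n := by
  classical
  have : {x : Fin n → X | ∀ i, x i ∈ B} =
      (Fintype.piFinset fun _ : Fin n => hB.toFinset : Finset (Fin n → X)) := by
    ext x
    simp
  rw [this, Set.ncard_coe_finset, Set.ncard_eq_toFinset_card B hB]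
  simp

lemma ncard_tuples_mem_le {B E : Set X} (hB : B.Finite) (hE : E.Finite) (i : Fin n) :
    {x : Fin n → X | (∀ i, x i ∈ B) ∧ x i ∈ E}.ncard * B.ncard ≤ E.ncard * B.ncard ^ n := by
  rw [← ncard_pi_tuples (n := n) hB, ← Set.ncard_prod, ← Set.ncard_prod]
  refine Set.ncard_le_ncard_of_injOn (fun y => (y.1 i, Function.update y.1 i y.2)) ?_ ?_
    (hE.prod (finite_pi_tuples hB))
  · rintro ⟨x, u⟩ ⟨⟨hx, hxi⟩, hu⟩
    refine ⟨hxi, fun j => ?_⟩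
    by_cases hj : j = i
    · subst hj
      simpa using hu
    · simpa [hj] using hx j
  · rintro ⟨x, u⟩ - ⟨y, v⟩ - hxy
    simp only [Prod.mk.injEq] at hxy
    obtain ⟨h1, h2⟩ := hxy
    refine Prod.ext ?_ ?_
    · funext j
      by_cases hj : j = i
      · exact hj ▸ h1
      · simpa [hj] using congrFun h2 j
    · simpa using congrFun h2 i

lemma ncard_tuples_pair_le {B : Set X} {E : Set (X × X)} (hB : B.Finite) (hE : E.Finite)
    {i j : Fin n} (hij : i ≠ j) (σ τ : X → X) (hσ : Function.Injective σ)
    (hτ : Function.Injective τ) :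
    {x : Fin n → X | (∀ i, x i ∈ B) ∧ (σ (x i), τ (x j)) ∈ E}.ncard * B.ncard ^ 2 ≤
      E.ncard * B.ncard ^ n := by
  rw [← ncard_pi_tuples (n := n) hB, sq, ← Set.ncard_prod, ← Set.ncard_prod, ← Set.ncard_prod]
  refine Set.ncard_le_ncard_of_injOn (fun y => ((σ (y.1 i), τ (y.1 j)),
    Function.update (Function.update y.1 i y.2.1) j y.2.2)) ?_ ?_
    (hE.prod (finite_pi_tuples hB))
  · rintro ⟨x, u, v⟩ ⟨⟨hx, hxi⟩, hu, hv⟩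
    refine ⟨hxi, fun k => ?_⟩
    by_cases hkj : k = j
    · subst hkj
      simpa using hv
    by_cases hki : k = i
    · subst hki
      simpa [hkj] using hu
    · simpa [hkj, hki] using hx k
  · rintro ⟨x, u, v⟩ - ⟨y, u', v'⟩ - hxy
    simp only [Prod.mk.injEq] at hxy
    obtain ⟨⟨h1, h1'⟩, h2⟩ := hxy
    refine Prod.ext ?_ (Prod.ext ?_ ?_)
    · funext k
      by_cases hkj : k = j
      · exact hkj ▸ hτ h1'
      by_cases hki : k = i
      · exact hki ▸ hσ h1
      · simpa [hkj, hki] using congrFun h2 k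
    · simpa [hij] using congrFun h2 i
    · simpa using congrFun h2 j

end Tuples

namespace IsWallSystem

variable {G Ω : Type*} [Group G] [MulAction G Ω] {S : Set G} {sep : G → Set Ω}
  {α β : G} {o₁ o₂ : Ω}

/-- If the exceptional sets are small then most tuples are free basis tuples. -/
lemma ncard_freeBasisTuple_ge (h : IsWallSystem S sep α β o₁ o₂) (hS : S.Finite) {m k n : ℕ}
    {E₁ : Set G} {E₂ : Set (G × G)} (hk : 0 < k) (hE₁ : E₁.Finite) (hE₂ : E₂.Finite)
    (h₁ : ∀ g ∈ wordBall S m, g ∉ E₁ → 2 * k ≤ (sep g).ncard ∧ (sep g ∩ sep g⁻¹).ncard < k)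
    (h₂ : ∀ g ∈ wordBall S m, ∀ g' ∈ wordBall S m, (g, g') ∉ E₂ → (sep g ∩ sep g').ncard < k) :
    (1 : ℝ) - (n * (E₁.ncard / (wordBall S m).ncard) +
        4 * n ^ 2 * (E₂.ncard / (wordBall S m).ncard ^ 2)) ≤
      ({x : Fin n → G | (∀ i, x i ∈ wordBall S m) ∧ IsFreeBasisTuple x}.ncard : ℝ) /
          ((wordBall S m).ncard : ℝ) ^ n := by
  classical
  have hB := wordBall_finite hS m
  set B := wordBall S m with hBdef
  have hpos : 0 < B.ncard := by
    rw [Set.ncard_pos hB]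
    exact ⟨1, one_mem_wordBall m⟩
  set T := {x : Fin n → G | (∀ i, x i ∈ B) ∧ IsFreeBasisTuple x} with hT
  have hTfin : T.Finite := (finite_pi_tuples hB).subset fun x hx => hx.1
  let A₁ : Fin n → Set (Fin n → G) := fun i => {x | (∀ i, x i ∈ B) ∧ x i ∈ E₁}
  let s : Bool → G → G := fun ε g => cond ε g g⁻¹
  have hs : ∀ ε, Function.Injective (s ε) := by
    rintro (_ | _)
    · exact inv_injective
    · exact fun _ _ h => h
  let A₂ : (Fin n × Fin n) × (Bool × Bool) → Set (Fin n → G) := fun a =>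
    {x | a.1.1 ≠ a.1.2 ∧ (∀ i, x i ∈ B) ∧ (s a.2.1 (x a.1.1), s a.2.2 (x a.1.2)) ∈ E₂}
  have hfin₁ : (⋃ i ∈ (Finset.univ : Finset (Fin n)), A₁ i).Finite :=
    Set.Finite.biUnion (Finset.finite_toSet _) fun i _ => (finite_pi_tuples hB).subset
      fun x hx => hx.1
  have hfin₂ : (⋃ a ∈ (Finset.univ : Finset ((Fin n × Fin n) × (Bool × Bool))), A₂ a).Finite :=
    Set.Finite.biUnion (Finset.finite_toSet _) fun i _ => (finite_pi_tuples hB).subset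
      fun x hx => hx.2.1
  have hcover : {x : Fin n → G | ∀ i, x i ∈ B} ⊆ T ∪ ((⋃ i ∈ (Finset.univ : Finset (Fin n)), A₁ i) ∪
      ⋃ a ∈ (Finset.univ : Finset ((Fin n × Fin n) × (Bool × Bool))), A₂ a) := by
    intro x hx
    by_cases hx1 : x ∈ ⋃ i ∈ (Finset.univ : Finset (Fin n)), A₁ i
    · exact Or.inr (Or.inl hx1)
    by_cases hx2 : x ∈ ⋃ a ∈ (Finset.univ : Finset ((Fin n × Fin n) × (Bool × Bool))), A₂ a
    · exact Or.inr (Or.inr hx2)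
    refine Or.inl ⟨hx, ?_⟩
    simp only [Finset.mem_univ, Set.iUnion_true, Set.mem_iUnion, not_exists] at hx1 hx2
    have hx1' : ∀ i, x i ∉ E₁ := fun i hi => hx1 i ⟨hx, hi⟩
    refine h.injective_lift x hk (fun i => (h₁ _ (hx i) (hx1' i)).1) ?_
    rintro ⟨i, ε⟩ ⟨j, δ⟩ hne
    have hmem : ∀ ε i, s ε (x i) ∈ B := by
      rintro (_ | _) i
      · exact inv_mem_wordBall (hx i)
      · exact hx i
    by_cases hij : i = j
    · subst hij
      have h3 := (h₁ _ (hx i) (hx1' i)).2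
      rcases ε with _ | _ <;> rcases δ with _ | _ <;> simp at hne ⊢
      · rwa [Set.inter_comm]
      · exact h3
    · exact h₂ _ (hmem ε i) _ (hmem δ j) fun hcon => hx2 ⟨⟨i, j⟩, ⟨ε, δ⟩⟩ ⟨hij, hx, hcon⟩
  have hle := (Set.ncard_le_ncard hcover (hTfin.union (hfin₁.union hfin₂))).trans
    ((Set.ncard_union_le _ _).trans (Nat.add_le_add_left ((Set.ncard_union_le _ _).trans
      (Nat.add_le_add (Finset.set_ncard_biUnion_le _ _) (Finset.set_ncard_biUnion_le _ _))) _))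
  rw [ncard_pi_tuples hB] at hle
  have hb : (0 : ℝ) < B.ncard := by exact_mod_cast hpos
  have e₁ : ∀ i, ((A₁ i).ncard : ℝ) ≤ (E₁.ncard / B.ncard) * (B.ncard : ℝ) ^ n := by
    intro i
    have := ncard_tuples_mem_le hB hE₁ i
    rw [div_mul_eq_mul_div, le_div_iff₀ hb]
    exact_mod_cast this
  have e₂ : ∀ a, ((A₂ a).ncard : ℝ) ≤ (E₂.ncard / B.ncard ^ 2) * (B.ncard : ℝ) ^ n := by
    rintro ⟨⟨i, j⟩, ε, δ⟩
    rw [div_mul_eq_mul_div, le_div_iff₀ (by positivity)]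
    by_cases hij : i = j
    · have : A₂ ((i, j), (ε, δ)) = ∅ := by
        ext x
        simp [A₂, hij]
      rw [this]
      simp
      positivity
    · have := ncard_tuples_pair_le hB hE₂ hij (s ε) (s δ) (hs ε) (hs δ)
      simp only [A₂, ne_eq, hij, not_false_eq_true, true_and]
      exact_mod_cast this
  have hle' : (B.ncard : ℝ) ^ n ≤
      T.ncard + (∑ i, ((A₁ i).ncard : ℝ) + ∑ a, ((A₂ a).ncard : ℝ)) := by
    exact_mod_cast hle
  have e₃ := Finset.sum_le_card_nsmul Finset.univ (fun i => ((A₁ i).ncard : ℝ)) _ fun i _ => e₁ i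
  have e₄ := Finset.sum_le_card_nsmul Finset.univ (fun i => ((A₂ i).ncard : ℝ)) _ fun i _ => e₂ i
  simp only [Finset.card_univ, Fintype.card_fin, nsmul_eq_mul, Fintype.card_prod,
    Fintype.card_bool, Nat.cast_mul] at e₃ e₄
  rw [le_div_iff₀ (by positivity)]
  push_cast at e₃ e₄
  nlinarith

end IsWallSystem

lemma tendsto_sqrt_sqrt_atTop : Tendsto (fun m : ℕ => m.sqrt.sqrt) atTop atTop := by
  refine tendsto_atTop_atTop.2 fun b => ⟨(b ^ 2) ^ 2, fun m hm => ?_⟩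
  rw [Nat.le_sqrt', Nat.le_sqrt']
  exact hm

lemma tendsto_succ_pow_div_two_pow {N : ℕ} (hN : 0 < N) (a : ℕ) :
    Tendsto (fun s : ℕ => ((s : ℝ) + 1) ^ a / 2 ^ (s / N)) atTop (nhds 0) := by
  have h1 : Tendsto (fun s : ℕ => s / N + 1) atTop atTop :=
    tendsto_atTop_atTop.2 fun b => ⟨b * N, fun s hs => by
      have := (Nat.le_div_iff_mul_le hN).2 hs
      omega⟩
  have h2 := (tendsto_pow_const_div_const_pow_of_one_lt a (show (1 : ℝ) < 2 by norm_num)).comp h1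
  have h3 := h2.const_mul (2 * (N : ℝ) ^ a)
  rw [mul_zero] at h3
  refine squeeze_zero (fun s => by positivity) (fun s => ?_) h3
  have h4 : s + 1 ≤ N * (s / N + 1) := Nat.lt_mul_div_succ s hN
  have h5 : (s : ℝ) + 1 ≤ N * ((s / N + 1 : ℕ) : ℝ) := by exact_mod_cast h4
  simp only [Function.comp]
  rw [pow_succ, ← mul_div_assoc, div_le_div_iff₀ (by positivity) (by positivity)]
  calc ((s : ℝ) + 1) ^ a * (2 ^ (s / N) * 2) ≤
        (N * ((s / N + 1 : ℕ) : ℝ)) ^ a * (2 ^ (s / N) * 2) := by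
        gcongr
    _ = _ := by ring

lemma IsWallSystem.strongGenericFreeGroupProperty {G Ω : Type*} [Group G] [MulAction G Ω]
    {S : Set G} {sep : G → Set Ω} {α β : G} {o₁ o₂ : Ω} (h : IsWallSystem S sep α β o₁ o₂)
    (hS : S.Finite) (hgen : Subgroup.closure S = ⊤) : StrongGenericFreeGroupProperty S := by
  intro n _
  obtain ⟨c, hc⟩ := h.exists_exceptional hS hgen
  obtain ⟨d, hd⟩ := h.exists_wordBall_mul_le hS hgen
  obtain ⟨N, hN, hgrow⟩ := h.growth
  let X : ℕ → ℝ := fun s => d * (((s : ℝ) + 1) ^ 32 / 2 ^ (s / N))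
  let φ : ℕ → ℝ := fun s => 1 - (n * (c * (4 / s + X s)) + 4 * n ^ 2 * (c * X s))
  have hX : Tendsto X atTop (nhds 0) := by
    simpa using (tendsto_succ_pow_div_two_pow hN 32).const_mul (d : ℝ)
  have hφ : Tendsto φ atTop (nhds 1) := by
    have h1 :=
      ((((tendsto_const_div_atTop_nhds_zero_nat (4 : ℝ)).add hX).const_mul (c : ℝ)).const_mul
        (n : ℝ)).add ((hX.const_mul (c : ℝ)).const_mul (4 * (n : ℝ) ^ 2))
    simpa [φ] using h1.const_sub 1
  refine tendsto_of_tendsto_of_tendsto_of_le_of_le' (hφ.comp tendsto_sqrt_sqrt_atTop)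
    tendsto_const_nhds ?_ (Eventually.of_forall fun m => ?_)
  · filter_upwards [tendsto_sqrt_sqrt_atTop.eventually_ge_atTop 2] with m hm
    simp only [Function.comp]
    set s := m.sqrt.sqrt with hs
    have hsm : s ^ 4 ≤ m := by
      calc s ^ 4 = (s ^ 2) ^ 2 := by ring
        _ ≤ m.sqrt ^ 2 := Nat.pow_le_pow_left (Nat.sqrt_le' _) 2
        _ ≤ m := Nat.sqrt_le' _
    have hms : m + 1 ≤ (s + 1) ^ 4 := by
      calc m + 1 ≤ (m.sqrt + 1) ^ 2 := Nat.lt_succ_sqrt' m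
        _ ≤ ((s + 1) ^ 2) ^ 2 := Nat.pow_le_pow_left (Nat.lt_succ_sqrt' _) 2
        _ = _ := by ring
    have hsub : s ^ 3 + s ≤ m := by
      refine le_trans ?_ hsm
      have : s * 1 ≤ s * s ^ 2 := Nat.mul_le_mul_left _ (Nat.one_le_pow _ _ (by omega))
      calc s ^ 3 + s ≤ 2 * s ^ 3 := by nlinarith
        _ ≤ s * s ^ 3 := Nat.mul_le_mul_right _ hm
        _ = s ^ 4 := by ring
    have hsm' : s ≤ m := by omega
    obtain ⟨k, E₁, E₂, hk, hE₁, hE₂, h₁, h₂, hc₁, hc₂⟩ := hc m s hsm'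
    refine le_trans ?_ (h.ncard_freeBasisTuple_ge hS hk hE₁ hE₂ h₁ h₂)
    have hb : (0 : ℝ) < (wordBall S m).ncard := by
      have : 0 < (wordBall S m).ncard := by
        rw [Set.ncard_pos (wordBall_finite hS m)]
        exact ⟨1, one_mem_wordBall m⟩
      exact_mod_cast this
    have hρ : (wordBall S (m - s)).ncard * 2 ^ (s / N) ≤
        d * (m + 1) ^ 2 * (wordBall S m).ncard := by
      have h1 := hd (m - s) s
      rw [Nat.sub_add_cancel hsm'] at h1
      refine le_trans (Nat.mul_le_mul_left _ ((hgrow _).trans (ncard_wordBall_mono hS ?_))) h1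
      exact Nat.mul_div_le s N
    set b : ℝ := ((wordBall S m).ncard : ℝ) with hbdef
    set b' : ℝ := ((wordBall S (m - s)).ncard : ℝ) with hb'def
    have hs0 : (0 : ℝ) < s := by exact_mod_cast (by omega : 0 < s)
    have hms' : (m : ℝ) + 1 ≤ ((s : ℝ) + 1) ^ 4 := by exact_mod_cast hms
    have hρ' : b' / b ≤ d * (((s : ℝ) + 1) ^ 8 / 2 ^ (s / N)) := by
      have h1 : b' * 2 ^ (s / N) ≤ d * ((m : ℝ) + 1) ^ 2 * b := by
        rw [hbdef, hb'def]
        exact_mod_cast hρ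
      rw [← mul_div_assoc, div_le_div_iff₀ hb (by positivity)]
      refine h1.trans ?_
      gcongr
      calc ((m : ℝ) + 1) ^ 2 ≤ (((s : ℝ) + 1) ^ 4) ^ 2 := by gcongr
        _ = _ := by ring
    have hρ0 : 0 ≤ b' / b := by positivity
    have hmain : ∀ r : ℕ, r ≤ 6 → ((m : ℝ) + 1) ^ r * (b' / b) ≤ X s := by
      intro r hr
      have h1 : (1 : ℝ) ≤ (s : ℝ) + 1 := by linarith
      calc ((m : ℝ) + 1) ^ r * (b' / b)
          ≤ (((s : ℝ) + 1) ^ 4) ^ r * (d * (((s : ℝ) + 1) ^ 8 / 2 ^ (s / N))) := by gcongr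
        _ = d * (((s : ℝ) + 1) ^ (4 * r + 8) / 2 ^ (s / N)) := by rw [pow_add, pow_mul]; ring
        _ ≤ d * (((s : ℝ) + 1) ^ 32 / 2 ^ (s / N)) := by
            gcongr
            omega
    have hX0 : 0 ≤ X s := by positivity
    have e₁ : E₁.ncard / b ≤ c * (4 / s + X s) := by
      have h1 : ((m - s : ℕ) : ℝ) * E₁.ncard ≤
          c * (((s : ℝ) + 1) ^ 2 * b + ((m : ℝ) + 1) ^ 6 * b') := by
        rw [hbdef, hb'def]
        exact_mod_cast hc₁
      have h2 : (s : ℝ) ^ 3 ≤ ((m - s : ℕ) : ℝ) := by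
        exact_mod_cast (by omega : s ^ 3 ≤ m - s)
      have h3 : (s : ℝ) ^ 3 * (E₁.ncard / b) ≤ c * (((s : ℝ) + 1) ^ 2 + X s) := by
        calc (s : ℝ) ^ 3 * (E₁.ncard / b) ≤ ((m - s : ℕ) : ℝ) * (E₁.ncard / b) := by gcongr
          _ = ((m - s : ℕ) : ℝ) * E₁.ncard / b := by ring
          _ ≤ c * (((s : ℝ) + 1) ^ 2 * b + ((m : ℝ) + 1) ^ 6 * b') / b := by gcongr
          _ = c * (((s : ℝ) + 1) ^ 2 + ((m : ℝ) + 1) ^ 6 * (b' / b)) := by field_simp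
          _ ≤ _ := by
            gcongr
            exact hmain 6 le_rfl
      have hs2 : (2 : ℝ) ≤ s := by exact_mod_cast hm
      have h4 : c * (((s : ℝ) + 1) ^ 2 + X s) ≤ (s : ℝ) ^ 3 * (c * (4 / s + X s)) := by
        have : (s : ℝ) ^ 3 * (c * (4 / s + X s)) = c * (4 * (s : ℝ) ^ 2 + (s : ℝ) ^ 3 * X s) := by
          field_simp
        rw [this]
        have h5 : (1 : ℝ) ≤ (s : ℝ) ^ 3 := one_le_pow₀ (by linarith)
        gcongr
        · nlinarith
        · exact le_mul_of_one_le_left hX0 h5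
      exact le_of_mul_le_mul_left (h3.trans h4) (by positivity)
    have e₂ : E₂.ncard / b ^ 2 ≤ c * X s := by
      have h1 : (E₂.ncard : ℝ) ≤ c * ((m : ℝ) + 1) ^ 5 * b * b' := by
        rw [hbdef, hb'def]
        exact_mod_cast hc₂
      calc E₂.ncard / b ^ 2 ≤ c * ((m : ℝ) + 1) ^ 5 * b * b' / b ^ 2 := by gcongr
        _ = c * (((m : ℝ) + 1) ^ 5 * (b' / b)) := by field_simp
        _ ≤ _ := by
          gcongr
          exact hmain 5 (by omega)
    simp only [φ]
    gcongr
  · refine div_le_one_of_le₀ ?_ (by positivity)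
    have h1 := Set.ncard_le_ncard (s := {x : Fin n → G | (∀ i, x i ∈ wordBall S m) ∧
      IsFreeBasisTuple x}) (t := {x | ∀ i, x i ∈ wordBall S m}) (fun x hx => hx.1)
      (finite_pi_tuples (wordBall_finite hS m))
    rw [ncard_pi_tuples (wordBall_finite hS m)] at h1
    exact_mod_cast h1

/-- `IsReducedProduct P C i j g` means that `g` is a product of elements taken alternately from
`P true` and `P false`, none of them in `C`, the first one in `P i` and the last one in `P j`. -/
inductive IsReducedProduct {G : Type*} [Group G] (P : Bool → Subgroup G) (C : Subgroup G) :
    Bool → Bool → G → Prop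
  | single {i x} : x ∈ P i → x ∉ C → IsReducedProduct P C i i x
  | cons {i j x g} : x ∈ P i → x ∉ C → IsReducedProduct P C (!i) j g →
      IsReducedProduct P C i j (x * g)

/-- An internal characterization of amalgamated free products: `G` is generated by `P true` and
`P false`, and no reduced product lies in the amalgamated subgroup. -/
structure IsInternalAmalgam {G : Type*} [Group G] (P : Bool → Subgroup G) (C : Subgroup G) :
    Prop where
  le : ∀ i, C ≤ P i
  sup_eq_top : P true ⊔ P false = ⊤
  notMem : ∀ {i j g}, IsReducedProduct P C i j g → g ∉ C

namespace IsReducedProduct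

variable {G : Type*} [Group G] {P : Bool → Subgroup G} {C : Subgroup G} {i j k l : Bool} {g h x : G}

lemma append (hg : IsReducedProduct P C i j g) (hh : IsReducedProduct P C (!j) k h) :
    IsReducedProduct P C i k (g * h) := by
  induction hg with
  | single hx hxC => exact .cons hx hxC hh
  | cons hx hxC _ ih =>
    rw [mul_assoc]
    exact .cons hx hxC (ih hh)

lemma inv (hg : IsReducedProduct P C i j g) : IsReducedProduct P C j i g⁻¹ := by
  induction hg with
  | single hx hxC => exact .single (inv_mem hx) (by simpa using hxC)
  | @cons i j x g hx hxC _ ih =>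
    rw [mul_inv_rev]
    refine ih.append ?_
    rw [Bool.not_not]
    exact .single (inv_mem hx) (by simpa using hxC)

lemma mul_mem_left (hP : IsInternalAmalgam P C) {c : G} (hc : c ∈ C)
    (hg : IsReducedProduct P C i j g) : IsReducedProduct P C i j (c * g) := by
  cases hg with
  | single hx hxC =>
    exact .single (mul_mem (hP.le _ hc) hx) (by rwa [C.mul_mem_cancel_left hc])
  | cons hx hxC h =>
    rw [← mul_assoc]
    exact .cons (mul_mem (hP.le _ hc) hx) (by rwa [C.mul_mem_cancel_left hc]) h

lemma mul_mem_right (hP : IsInternalAmalgam P C) {c : G} (hc : c ∈ C)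
    (hg : IsReducedProduct P C i j g) : IsReducedProduct P C i j (g * c) := by
  simpa using (hg.inv.mul_mem_left hP (inv_mem hc)).inv

lemma first_unique (hP : IsInternalAmalgam P C) (hg : IsReducedProduct P C i j g)
    (hh : IsReducedProduct P C k l g) : i = k := by
  by_contra hne
  have hk : k = !i := by cases i <;> cases k <;> simp_all
  subst hk
  have := hP.notMem (hg.inv.append hh)
  simp at this

lemma mul_left (hP : IsInternalAmalgam P C) (hx : x ∈ P i) (hg : IsReducedProduct P C j k g) :
    x * g ∈ C ∨ ∃ j', IsReducedProduct P C j' k (x * g) := by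
  by_cases hxC : x ∈ C
  · exact Or.inr ⟨j, hg.mul_mem_left hP hxC⟩
  by_cases hij : j = i
  · subst hij
    cases hg with
    | single hy hyC =>
      by_cases hxy : x * g ∈ C
      · exact Or.inl hxy
      · exact Or.inr ⟨_, .single (mul_mem hx hy) hxy⟩
    | @cons _ _ y g hy hyC hg =>
      rw [← mul_assoc]
      by_cases hxy : x * y ∈ C
      · exact Or.inr ⟨_, hg.mul_mem_left hP hxy⟩
      · exact Or.inr ⟨_, .cons (mul_mem hx hy) hxy hg⟩
  · have : j = !i := by cases i <;> cases j <;> simp_all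
    subst this
    exact Or.inr ⟨_, .cons hx hxC hg⟩

lemma mul_right (hP : IsInternalAmalgam P C) (hx : x ∈ P i) (hg : IsReducedProduct P C j k g) :
    g * x ∈ C ∨ ∃ k', IsReducedProduct P C j k' (g * x) := by
  rcases hg.inv.mul_left hP (inv_mem hx) with h | ⟨k', h⟩
  · left
    simpa using inv_mem h
  · right
    exact ⟨k', by simpa using h.inv⟩

end IsReducedProduct

namespace IsInternalAmalgam

variable {G : Type*} [Group G] {P : Bool → Subgroup G} {C : Subgroup G} {i j k l : Bool} {g h x : G}

lemma induction_left (hP : IsInternalAmalgam P C) {p : G → Prop} (one : p 1)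
    (mul : ∀ i, ∀ x ∈ P i, ∀ g, p g → p (x * g)) (g : G) : p g := by
  have hg : g ∈ Subgroup.closure ((P true : Set G) ∪ P false) := by
    rw [← Subgroup.sup_eq_closure, hP.sup_eq_top]
    trivial
  induction hg using Subgroup.closure_induction_left with
  | one => exact one
  | mul_left x hx y _ hy => exact hx.elim (fun h => mul _ x h y hy) fun h => mul _ x h y hy
  | inv_mul_cancel x hx y _ hy =>
    exact hx.elim (fun h => mul _ _ (inv_mem h) y hy) fun h => mul _ _ (inv_mem h) y hy

lemma mem_or_isReducedProduct (hP : IsInternalAmalgam P C) (g : G) :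
    g ∈ C ∨ ∃ i j, IsReducedProduct P C i j g := by
  refine hP.induction_left (p := fun g => g ∈ C ∨ ∃ i j, IsReducedProduct P C i j g)
    (Or.inl C.one_mem) ?_ g
  rintro i x hx g (hg | ⟨j, k, hg⟩)
  · by_cases hxg : x * g ∈ C
    · exact Or.inl hxg
    · exact Or.inr ⟨i, i, .single (mul_mem hx (hP.le i hg)) hxg⟩
  · rcases hg.mul_left hP hx with h | ⟨j', h⟩
    · exact Or.inl h
    · exact Or.inr ⟨j', k, h⟩

end IsInternalAmalgam

/-- The elements whose reduced products start in `P true`. -/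
def halfSpace {G : Type*} [Group G] (P : Bool → Subgroup G) (C : Subgroup G) : Set G :=
  {g | ∃ j, IsReducedProduct P C true j g}

/-- The elements on the positive side of a coset of the amalgamated subgroup, i.e. of an edge of
the Bass-Serre tree. -/
def cosetHalfSpace {G : Type*} [Group G] (P : Bool → Subgroup G) (C : Subgroup G) (e : G ⧸ C) :
    Set G :=
  {x | ∃ a : G, (a : G ⧸ C) = e ∧ a⁻¹ * x ∈ halfSpace P C}

/-- The edges of the Bass-Serre tree separating `1` from `g`. -/
def separatingEdges {G : Type*} [Group G] (P : Bool → Subgroup G) (C : Subgroup G) (g : G) :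
    Set (G ⧸ C) :=
  {e | ¬ (1 ∈ cosetHalfSpace P C e ↔ g ∈ cosetHalfSpace P C e)}

namespace IsInternalAmalgam

variable {G : Type*} [Group G] {P : Bool → Subgroup G} {C : Subgroup G} {i j k l : Bool} {g h x : G}

lemma mem_halfSpace_iff (hP : IsInternalAmalgam P C) (hg : IsReducedProduct P C i j g) :
    g ∈ halfSpace P C ↔ i = true :=
  ⟨fun ⟨_, h⟩ => hg.first_unique hP h, by rintro rfl; exact ⟨j, hg⟩⟩

lemma mul_mem_halfSpace_iff (hP : IsInternalAmalgam P C) {c : G} (hc : c ∈ C) :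
    c * g ∈ halfSpace P C ↔ g ∈ halfSpace P C :=
  ⟨fun ⟨j, h⟩ => ⟨j, by simpa using h.mul_mem_left hP (inv_mem hc)⟩,
    fun ⟨j, h⟩ => ⟨j, h.mul_mem_left hP hc⟩⟩

lemma mem_cosetHalfSpace_mk (hP : IsInternalAmalgam P C) (a x : G) :
    x ∈ cosetHalfSpace P C (a : G ⧸ C) ↔ a⁻¹ * x ∈ halfSpace P C := by
  refine ⟨?_, fun h => ⟨a, rfl, h⟩⟩
  rintro ⟨b, hb, h⟩
  have := (hP.mul_mem_halfSpace_iff (inv_mem (QuotientGroup.eq.1 hb))).2 h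
  simpa [mul_assoc] using this

lemma mem_cosetHalfSpace_smul (hP : IsInternalAmalgam P C) (g x : G) (e : G ⧸ C) :
    x ∈ cosetHalfSpace P C (g • e) ↔ g⁻¹ * x ∈ cosetHalfSpace P C e := by
  obtain ⟨a, rfl⟩ := QuotientGroup.mk_surjective e
  rw [show (g • ((a : G) : G ⧸ C)) = ((g * a : G) : G ⧸ C) from rfl]
  rw [hP.mem_cosetHalfSpace_mk, hP.mem_cosetHalfSpace_mk, mul_inv_rev, mul_assoc]

lemma mem_separatingEdges_mul (hP : IsInternalAmalgam P C) (g h : G) (e : G ⧸ C) :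
    e ∈ separatingEdges P C (g * h) ↔
      ¬ (e ∈ separatingEdges P C g ↔ g⁻¹ • e ∈ separatingEdges P C h) := by
  simp only [separatingEdges, Set.mem_ofPred_eq, hP.mem_cosetHalfSpace_smul, inv_inv, mul_one]
  tauto

lemma finite_separatingEdges (hP : IsInternalAmalgam P C) (g : G) :
    (separatingEdges P C g).Finite := by
  refine hP.induction_left (p := fun g => (separatingEdges P C g).Finite) ?_ ?_ g
  · simp [separatingEdges]
  · intro i x hx g hg
    have hxfin : (separatingEdges P C x).Finite := by
      refine (Set.toFinite {((1 : G) : G ⧸ C), (x : G ⧸ C)}).subset ?_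
      intro e he
      obtain ⟨a, rfl⟩ := QuotientGroup.mk_surjective e
      rw [separatingEdges, Set.mem_ofPred_eq, hP.mem_cosetHalfSpace_mk,
        hP.mem_cosetHalfSpace_mk, mul_one] at he
      rcases hP.mem_or_isReducedProduct a⁻¹ with h | ⟨j, k, h⟩
      · left
        exact QuotientGroup.eq.2 (by simpa using h)
      · rcases h.mul_right hP hx with h' | ⟨k', h'⟩
        · right
          exact QuotientGroup.eq.2 h'
        · rw [hP.mem_halfSpace_iff h, hP.mem_halfSpace_iff h'] at he
          exact absurd Iff.rfl he
    refine (hxfin.union (hg.image fun e => x • e)).subset ?_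
    intro e he
    rw [hP.mem_separatingEdges_mul] at he
    by_cases h1 : e ∈ separatingEdges P C x
    · exact Or.inl h1
    · exact Or.inr ⟨x⁻¹ • e, by by_contra h2; exact he (iff_of_false h1 h2), by simp⟩

/-- One of the four quadrants determined by two edges of the Bass-Serre tree is empty. -/
lemma exists_quadrant (hP : IsInternalAmalgam P C) (h : G) :
    (∀ g, g ∈ halfSpace P C → h⁻¹ * g ∈ halfSpace P C) ∨
    (∀ g, h⁻¹ * g ∈ halfSpace P C → g ∈ halfSpace P C) ∨
    (∀ g, g ∈ halfSpace P C → h⁻¹ * g ∉ halfSpace P C) ∨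
    (∀ g, h⁻¹ * g ∉ halfSpace P C → g ∈ halfSpace P C) := by
  rcases hP.mem_or_isReducedProduct h with hC | ⟨i, j, hh⟩
  · exact Or.inl fun g hg => (hP.mul_mem_halfSpace_iff (inv_mem hC)).2 hg
  cases j
  · have key : ∀ g, h⁻¹ * g ∈ halfSpace P C → (g ∈ halfSpace P C ↔ i = true) := by
      rintro g ⟨k, hg⟩
      have := hh.append (h := h⁻¹ * g) hg
      rw [mul_inv_cancel_left] at this
      exact hP.mem_halfSpace_iff this
    cases i
    · refine Or.inr (Or.inr (Or.inl fun g hg hg' => ?_))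
      simpa using (key g hg').1 hg
    · exact Or.inr (Or.inl fun g hg => (key g hg).2 rfl)
  · have key : ∀ g, h⁻¹ * g ∉ halfSpace P C → (g ∈ halfSpace P C ↔ i = true) := by
      intro g hg
      rcases hP.mem_or_isReducedProduct (h⁻¹ * g) with h1 | ⟨k, l, h1⟩
      · have := hh.mul_mem_right hP h1
        rw [mul_inv_cancel_left] at this
        exact hP.mem_halfSpace_iff this
      · rw [hP.mem_halfSpace_iff h1, Bool.not_eq_true] at hg
        subst hg
        have := hh.append h1
        rw [mul_inv_cancel_left] at this
        exact hP.mem_halfSpace_iff this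
    cases i
    · refine Or.inl fun g hg => ?_
      by_contra hg'
      simpa using (key g hg').1 hg
    · exact Or.inr (Or.inr (Or.inr fun g hg => (key g hg).2 rfl))

lemma _root_.not_all_quadrants {A₁ Ax Ay Az B₁ Bx By Bz : Prop} (hx : ¬ (A₁ ↔ Ax))
    (hy : ¬ (A₁ ↔ Ay)) (hz : A₁ ↔ Az) (hx' : B₁ ↔ Bx) (hy' : ¬ (B₁ ↔ By)) (hz' : ¬ (B₁ ↔ Bz))
    {f : Prop → Prop → Prop} (h : (∀ p q, f p q → p → q) ∨ (∀ p q, f p q → q → p) ∨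
      (∀ p q, f p q → p → ¬ q) ∨ (∀ p q, f p q → ¬ q → p)) (h₁ : f A₁ B₁) (h₂ : f Ax Bx)
    (h₃ : f Ay By) (h₄ : f Az Bz) : False := by
  rcases h with h | h | h | h
  all_goals
    have := h _ _ h₁
    have := h _ _ h₂
    have := h _ _ h₃
    have := h _ _ h₄
    clear h h₁ h₂ h₃ h₄
    by_cases A₁ <;> by_cases B₁ <;> simp_all

lemma separatingEdges_nested (hP : IsInternalAmalgam P C) (x y z : G) :
    separatingEdges P C x ∩ separatingEdges P C y ⊆ separatingEdges P C z ∨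
      separatingEdges P C z ∩ separatingEdges P C y ⊆ separatingEdges P C x := by
  by_contra! hcon
  obtain ⟨h1, h2⟩ := hcon
  obtain ⟨e, he, he'⟩ := Set.not_subset.1 h1
  obtain ⟨f, hf, hf'⟩ := Set.not_subset.1 h2
  obtain ⟨a, rfl⟩ := QuotientGroup.mk_surjective e
  obtain ⟨b, rfl⟩ := QuotientGroup.mk_surjective f
  simp only [separatingEdges, Set.mem_inter_iff, Set.mem_ofPred_eq, hP.mem_cosetHalfSpace_mk] at *
  have hq := hP.exists_quadrant (a⁻¹ * b)
  have hr : ∀ g, (a⁻¹ * b)⁻¹ * (a⁻¹ * g) = b⁻¹ * g := fun g => by group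
  refine not_all_quadrants he.1 he.2 (not_not.1 he') (not_not.1 hf') hf.2 hf.1 (f := fun p q =>
    ∃ g, (a⁻¹ * g ∈ halfSpace P C ↔ p) ∧ (b⁻¹ * g ∈ halfSpace P C ↔ q)) ?_
    ⟨1, Iff.rfl, Iff.rfl⟩ ⟨x, Iff.rfl, Iff.rfl⟩ ⟨y, Iff.rfl, Iff.rfl⟩ ⟨z, Iff.rfl, Iff.rfl⟩
  refine hq.imp ?_ (Or.imp ?_ (Or.imp ?_ ?_))
  all_goals
    rintro hq p q ⟨g, h1, h2⟩
    rw [← h1, ← h2, ← hr]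
    exact hq _

lemma exists_detect (hP : IsInternalAmalgam P C) {α β : G} (hα : α ∈ P true) (hαC : α ∉ C)
    (hβ : β ∈ P false) (hβC : β ∉ C) (p q : G) :
    ∃ p' q', (p' = p ∨ p' = p * β) ∧ (q' = q ∨ q' = β * q) ∧
      p' • ((1 : G) : G ⧸ C) ∈ separatingEdges P C (p' * α * q') ∧
      p' • (α : G ⧸ C) ∈ separatingEdges P C (p' * α * q') := by
  have hleft : ∀ g, g ∈ halfSpace P C → ∀ b ∈ P false, b ∉ C → b * g ∉ halfSpace P C := by
    rintro g ⟨j, hg⟩ b hb hbC hmem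
    simpa using (hP.mem_halfSpace_iff (.cons hb hbC hg)).1 hmem
  have hright : ∀ g, g ∉ halfSpace P C → ∀ a ∈ P true, a ∉ C → a * g ∈ halfSpace P C := by
    intro g hg a ha haC
    rcases hP.mem_or_isReducedProduct g with h | ⟨i, j, h⟩
    · exact ⟨_, (IsReducedProduct.single ha haC).mul_mem_right hP h⟩
    · rw [hP.mem_halfSpace_iff h, Bool.not_eq_true] at hg
      subst hg
      exact ⟨_, .cons ha haC h⟩
  have hp : ∃ p', (p' = p ∨ p' = p * β) ∧ p'⁻¹ ∉ halfSpace P C := by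
    by_cases h : p⁻¹ ∈ halfSpace P C
    · refine ⟨_, Or.inr rfl, ?_⟩
      rw [mul_inv_rev]
      exact hleft _ h _ (inv_mem hβ) (by simpa using hβC)
    · exact ⟨p, Or.inl rfl, h⟩
  have hq : ∃ q', (q' = q ∨ q' = β * q) ∧ q' ∉ halfSpace P C := by
    by_cases h : q ∈ halfSpace P C
    · exact ⟨_, Or.inr rfl, hleft _ h _ hβ hβC⟩
    · exact ⟨q, Or.inl rfl, h⟩
  obtain ⟨p', hp', hpH⟩ := hp
  obtain ⟨q', hq', hqH⟩ := hq
  refine ⟨p', q', hp', hq', ?_, ?_⟩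
  · rw [separatingEdges, Set.mem_ofPred_eq, hP.mem_cosetHalfSpace_smul,
      hP.mem_cosetHalfSpace_smul, hP.mem_cosetHalfSpace_mk, hP.mem_cosetHalfSpace_mk]
    have := hright _ hqH α hα hαC
    simp only [inv_one, one_mul, mul_one, mul_assoc, inv_mul_cancel_left]
    tauto
  · rw [separatingEdges, Set.mem_ofPred_eq, hP.mem_cosetHalfSpace_smul,
      hP.mem_cosetHalfSpace_smul, hP.mem_cosetHalfSpace_mk, hP.mem_cosetHalfSpace_mk]
    have := hright _ hpH _ (inv_mem hα) (by simpa using hαC)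
    simp only [mul_one, mul_assoc, inv_mul_cancel_left]
    tauto

lemma transporter_le {S : Set G} (hS : S.Finite) (hgen : Subgroup.closure S = ⊤) {c : ℕ}
    (hc : ∀ j, ((C : Set G) ∩ wordBall S j).ncard ≤ c * (j + 1)) (w w' : G ⧸ C) :
    ∃ c', ∀ j, {g | g ∈ wordBall S j ∧ g • w = w'}.ncard ≤ c' * (j + 1) := by
  obtain ⟨a, rfl⟩ := QuotientGroup.mk_surjective w
  obtain ⟨b, rfl⟩ := QuotientGroup.mk_surjective w'
  obtain ⟨r, hr⟩ := exists_mem_wordBall hgen a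
  obtain ⟨s, hs⟩ := exists_mem_wordBall hgen b
  refine ⟨c * (r + s + 1), fun j => ?_⟩
  have h1 := Set.ncard_le_ncard_of_injOn (s := {g | g ∈ wordBall S j ∧ g • (a : G ⧸ C) = b})
    (t := (C : Set G) ∩ wordBall S (s + j + r)) (fun g => b⁻¹ * g * a) ?_ ?_
    ((wordBall_finite hS _).inter_of_right _)
  · refine (h1.trans (hc _)).trans ?_
    rw [mul_assoc]
    exact Nat.mul_le_mul_left _ (by nlinarith [Nat.zero_le (r * j), Nat.zero_le (s * j)])
  · rintro g ⟨hg, hgw⟩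
    refine ⟨?_, mul_mem_wordBall (mul_mem_wordBall (inv_mem_wordBall hs) hg) hr⟩
    have : ((g * a : G) : G ⧸ C) = b := hgw
    rw [mul_assoc]
    exact QuotientGroup.eq.1 this.symm
  · intro g _ g' _ h
    simpa using h

lemma exists_growth (hP : IsInternalAmalgam P C) {S : Set G} (hgen : Subgroup.closure S = ⊤)
    (hS : S.Finite) {α β : G} (hα : α ∈ P true) (hα2 : α * α ∉ C)
    (hβ : β ∈ P false) (hβC : β ∉ C) : ∃ N, 0 < N ∧ ∀ n, 2 ^ n ≤ (wordBall S (N * n)).ncard := by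
  have hαC : α ∉ C := fun h => hα2 (mul_mem h h)
  obtain ⟨r₁, hr₁⟩ := exists_mem_wordBall hgen α
  obtain ⟨r₂, hr₂⟩ := exists_mem_wordBall hgen β
  refine ⟨r₁ + r₂ + 1, by omega, fun n => ?_⟩
  have key : ∃ T : Set G, T ⊆ wordBall S ((r₁ + r₂ + 1) * n) ∧ T.ncard = 2 ^ n ∧
      ∀ x ∈ T, x ∈ C ∨ ∃ j, IsReducedProduct P C true j x := by
    induction n with
    | zero => exact ⟨{1}, by simpa using one_mem_wordBall 0, by simp, by simp [C.one_mem]⟩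
    | succ n ih =>
      obtain ⟨T, hT, hcard, hred⟩ := ih
      have hTfin : T.Finite := (wordBall_finite hS _).subset hT
      have hβx : ∀ x ∈ T, ∃ j, IsReducedProduct P C false j (β * x) := by
        intro x hx
        rcases hred x hx with h | ⟨j, h⟩
        · exact ⟨_, (IsReducedProduct.single hβ hβC).mul_mem_right hP h⟩
        · exact ⟨j, .cons hβ hβC h⟩
      have hball : ∀ x ∈ T, ∀ a ∈ wordBall S r₁,
          a * (β * x) ∈ wordBall S ((r₁ + r₂ + 1) * (n + 1)) := by
        intro x hx a ha
        exact wordBall_mono (by ring_nf; omega)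
          (mul_mem_wordBall ha (mul_mem_wordBall hr₂ (hT hx)))
      refine ⟨(fun x => α * (β * x)) '' T ∪ (fun x => α⁻¹ * (β * x)) '' T, ?_, ?_, ?_⟩
      · rintro _ (⟨x, hx, rfl⟩ | ⟨x, hx, rfl⟩)
        · exact hball x hx _ hr₁
        · exact hball x hx _ (inv_mem_wordBall hr₁)
      · rw [Set.ncard_union_eq _ (hTfin.image _) (hTfin.image _),
          Set.ncard_image_of_injective _ fun x y h => by simpa using h,
          Set.ncard_image_of_injective _ fun x y h => by simpa using h, hcard]
        · ring
        · rw [Set.disjoint_left]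
          rintro _ ⟨x, hx, rfl⟩ ⟨y, hy, hxy⟩
          obtain ⟨j, hj⟩ := hβx x hx
          obtain ⟨k, hk⟩ := hβx y hy
          have h1 : β * y = α * α * (β * x) := by
            have := congrArg (α * ·) hxy
            simpa [mul_assoc] using this
          have h2 := IsReducedProduct.cons (i := true) (mul_mem hα hα) hα2 hj
          rw [← h1] at h2
          simpa using h2.first_unique hP hk
      · rintro _ (⟨x, hx, rfl⟩ | ⟨x, hx, rfl⟩)
        · obtain ⟨j, hj⟩ := hβx x hx
          exact Or.inr ⟨j, .cons hα hαC hj⟩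
        · obtain ⟨j, hj⟩ := hβx x hx
          exact Or.inr ⟨j, .cons (inv_mem hα) (by simpa using hαC) hj⟩
  obtain ⟨T, hT, hcard, -⟩ := key
  rw [← hcard]
  exact Set.ncard_le_ncard hT (wordBall_finite hS _)

/-- The edges of the Bass-Serre tree of an amalgamated free product form a wall system. -/
lemma isWallSystem (hP : IsInternalAmalgam P C) {S : Set G} (hS : S.Finite)
    (hgen : Subgroup.closure S = ⊤) {α β : G} (hα : α ∈ P true) (hα2 : α * α ∉ C)
    (hβ : β ∈ P false) (hβC : β ∉ C) (hmal : ∀ c ∈ C, α⁻¹ * c * α ∈ C → c = 1) {c : ℕ}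
    (hc : ∀ j, ((C : Set G) ∩ wordBall S j).ncard ≤ c * (j + 1)) :
    IsWallSystem S (separatingEdges P C) α β ((1 : G) : G ⧸ C) (α : G ⧸ C) where
  finite_sep := hP.finite_separatingEdges
  mem_sep_mul := hP.mem_separatingEdges_mul
  nested := hP.separatingEdges_nested
  detect := hP.exists_detect hα (fun h => hα2 (mul_mem h h)) hβ hβC
  faithful p q h1 h2 := by
    have h1' : ((p * 1 : G) : G ⧸ C) = ((q * 1 : G) : G ⧸ C) := h1
    have h2' : ((p * α : G) : G ⧸ C) = ((q * α : G) : G ⧸ C) := h2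
    rw [mul_one, mul_one] at h1'
    have := hmal _ (QuotientGroup.eq.1 h1') (by
      simpa [mul_assoc] using QuotientGroup.eq.1 h2')
    rw [inv_mul_eq_one] at this
    exact this
  transporter := transporter_le hS hgen hc
  growth := hP.exists_growth hgen hS hα hα2 hβ hβC

end IsInternalAmalgam

/-- Reduced products starting in `P i` all of whose factors, measured by `ℓ`, have total length
at most `n`. -/
inductive IsBoundedProduct {G : Type*} [Group G] (P : Bool → Subgroup G) (C : Subgroup G)
    (ℓ : Bool → G → ℕ) : Bool → ℕ → G → Prop
  | single {i n x} : x ∈ P i → x ∉ C → ℓ i x ≤ n → IsBoundedProduct P C ℓ i n x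
  | cons {i m n x g} : x ∈ P i → x ∉ C → IsBoundedProduct P C ℓ (!i) m g → ℓ i x + m ≤ n →
      IsBoundedProduct P C ℓ i n (x * g)

/-- The elements of `C` of length at most `n`, and the bounded reduced products. -/
def IsBoundedElement {G : Type*} [Group G] (P : Bool → Subgroup G) (C : Subgroup G)
    (ℓ : Bool → G → ℕ) (n : ℕ) (g : G) : Prop :=
  (g ∈ C ∧ ∀ i, ℓ i g ≤ n) ∨ ∃ i, IsBoundedProduct P C ℓ i n g

section Undistorted

variable {G : Type*} [Group G] {P : Bool → Subgroup G} {C : Subgroup G} {ℓ : Bool → G → ℕ}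

lemma IsBoundedProduct.isReducedProduct {i : Bool} {n : ℕ} {g : G}
    (hg : IsBoundedProduct P C ℓ i n g) : ∃ j, IsReducedProduct P C i j g := by
  induction hg with
  | single hx hxC _ => exact ⟨_, .single hx hxC⟩
  | cons hx hxC _ _ ih =>
    obtain ⟨j, hj⟩ := ih
    exact ⟨j, .cons hx hxC hj⟩

lemma IsBoundedProduct.mono {i : Bool} {m n : ℕ} {g : G} (hmn : m ≤ n)
    (hg : IsBoundedProduct P C ℓ i m g) : IsBoundedProduct P C ℓ i n g := by
  cases hg with
  | single hx hxC h => exact .single hx hxC (h.trans hmn)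
  | cons hx hxC hg h => exact .cons hx hxC hg (h.trans hmn)

lemma IsBoundedElement.mono {m n : ℕ} {g : G} (hmn : m ≤ n) (hg : IsBoundedElement P C ℓ m g) :
    IsBoundedElement P C ℓ n g :=
  hg.imp (fun h => ⟨h.1, fun i => (h.2 i).trans hmn⟩) fun ⟨i, h⟩ => ⟨i, h.mono hmn⟩

lemma IsBoundedProduct.mul_mem_left (hP : IsInternalAmalgam P C)
    (hℓ : ∀ i, ∀ x ∈ P i, ∀ y ∈ P i, ℓ i (x * y) ≤ ℓ i x + ℓ i y) {i : Bool} {n : ℕ} {c g : G}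
    (hc : c ∈ C) (hg : IsBoundedProduct P C ℓ i n g) :
    IsBoundedProduct P C ℓ i (ℓ i c + n) (c * g) := by
  cases hg with
  | single hx hxC h =>
    exact .single (mul_mem (hP.le _ hc) hx) (by rwa [C.mul_mem_cancel_left hc])
      ((hℓ i _ (hP.le _ hc) _ hx).trans (by omega))
  | @cons _ m _ x g hx hxC hg h =>
    rw [← mul_assoc]
    have := hℓ i _ (hP.le _ hc) _ hx
    exact .cons (mul_mem (hP.le _ hc) hx) (by rwa [C.mul_mem_cancel_left hc]) hg (by omega)

lemma IsBoundedElement.mul_left (hP : IsInternalAmalgam P C)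
    (hℓ : ∀ i, ∀ x ∈ P i, ∀ y ∈ P i, ℓ i (x * y) ≤ ℓ i x + ℓ i y)
    (hℓC : ∀ c ∈ C, ∀ i j, ℓ i c = ℓ j c) {n : ℕ} {g y : G} {k : Bool} (hy : y ∈ P k)
    (hg : IsBoundedElement P C ℓ n g) : IsBoundedElement P C ℓ (ℓ k y + n) (y * g) := by
  rcases hg with ⟨hgC, hg⟩ | ⟨i, hg⟩
  · have h1 := (hℓ k y hy g (hP.le k hgC)).trans (Nat.add_le_add_left (hg k) _)
    by_cases hyg : y * g ∈ C
    · exact Or.inl ⟨hyg, fun i => by rwa [hℓC _ hyg i k]⟩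
    · exact Or.inr ⟨k, .single (mul_mem hy (hP.le k hgC)) hyg h1⟩
  · by_cases hyC : y ∈ C
    · exact Or.inr ⟨i, by simpa only [hℓC y hyC k i] using hg.mul_mem_left hP hℓ hyC⟩
    by_cases hik : i = k
    · subst hik
      cases hg with
      | single hx hxC h =>
        have h1 := (hℓ i _ hy _ hx).trans (Nat.add_le_add_left h _)
        by_cases hyx : y * g ∈ C
        · exact Or.inl ⟨hyx, fun j => by rwa [hℓC _ hyx j i]⟩
        · exact Or.inr ⟨i, .single (mul_mem hy hx) hyx h1⟩
      | @cons _ m _ x g hx hxC hg h =>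
        rw [← mul_assoc]
        have h1 := hℓ i _ hy _ hx
        by_cases hyx : y * x ∈ C
        · refine Or.inr ⟨_, (hg.mul_mem_left hP hℓ hyx).mono ?_⟩
          rw [hℓC _ hyx (!i) i]
          omega
        · exact Or.inr ⟨_, .cons (mul_mem hy hx) hyx hg (by omega)⟩
    · have : i = !k := by cases i <;> cases k <;> simp_all
      subst this
      exact Or.inr ⟨k, .cons hy hyC hg le_rfl⟩

/-- The amalgamated cyclic subgroup is undistorted as soon as it is undistorted in both factors
in a compatible way. -/
lemma IsInternalAmalgam.exists_zpowers_inter_le (hP : IsInternalAmalgam P C) {S : Set G}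
    (hS : S.Finite)
    (hℓ : ∀ i, ∀ x ∈ P i, ∀ y ∈ P i, ℓ i (x * y) ≤ ℓ i x + ℓ i y) {u : G}
    (hu : C = Subgroup.zpowers u) {τ : ℕ} (hτ : 0 < τ)
    (hℓu : ∀ i (a : ℤ), ℓ i (u ^ a) = a.natAbs * τ) :
    ∃ c, ∀ j, ((C : Set G) ∩ wordBall S j).ncard ≤ c * (j + 1) := by
  have hℓC : ∀ c ∈ C, ∀ i j, ℓ i c = ℓ j c := by
    rw [hu]
    rintro _ ⟨a, rfl⟩ i j
    simp only [hℓu]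
  have hex : ∀ s, ∃ M, ∀ n g, IsBoundedElement P C ℓ n g →
      IsBoundedElement P C ℓ (n + M) (s * g) := by
    intro s
    refine hP.induction_left (p := fun s => ∃ M, ∀ n g, IsBoundedElement P C ℓ n g →
      IsBoundedElement P C ℓ (n + M) (s * g)) ⟨0, fun n g hg => by simpa using hg⟩ ?_ s
    rintro i x hx s ⟨M, hM⟩
    refine ⟨ℓ i x + M, fun n g hg => ?_⟩
    rw [mul_assoc]
    exact ((hM n g hg).mul_left hP hℓ hℓC hx).mono (by omega)
  choose M hM using hex
  obtain ⟨K, hK⟩ := ((wordBall_one_finite hS).image M).bddAbove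
  have hstep : ∀ s ∈ wordBall S 1, ∀ n g, IsBoundedElement P C ℓ n g →
      IsBoundedElement P C ℓ (n + K) (s * g) := fun s hs n g hg =>
    (hM s n g hg).mono (Nat.add_le_add_left (hK ⟨s, hs, rfl⟩) _)
  have hball : ∀ j, ∀ g ∈ wordBall S j, IsBoundedElement P C ℓ (j * K) g⁻¹ := by
    intro j
    induction j with
    | zero =>
      rintro _ ⟨l, hl, -, rfl⟩
      simp only [nonpos_iff_eq_zero, List.length_eq_zero_iff] at hl
      subst hl
      refine Or.inl ⟨by simp, fun i => ?_⟩
      simpa using (hℓu i 0).le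
    | succ j ih =>
      intro g hg
      obtain ⟨x, y, hx, hy, rfl⟩ := mem_wordBall_succ hg
      rw [mul_inv_rev, Nat.succ_mul]
      exact hstep _ (inv_mem_wordBall hy) _ _ (ih x hx)
  refine ⟨2 * K + 1, fun j => ?_⟩
  have hsub : (C : Set G) ∩ wordBall S j ⊆
      (fun a : ℤ => u ^ a) '' (Finset.Icc (-((j * K : ℕ) : ℤ)) ((j * K : ℕ) : ℤ) : Set ℤ) := by
    rintro g ⟨hgC, hg⟩
    have hgC' := hgC
    rw [SetLike.mem_coe, hu] at hgC'
    obtain ⟨a, rfl⟩ := hgC'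
    refine ⟨a, ?_, rfl⟩
    have h1 := hball j _ (inv_mem_wordBall hg)
    dsimp only at h1 hgC
    rw [inv_inv] at h1
    rcases h1 with ⟨-, h1⟩ | ⟨i, h1⟩
    · have h2 := h1 true
      rw [hℓu] at h2
      have h3 : a.natAbs ≤ j * K := (Nat.le_mul_of_pos_right _ hτ).trans h2
      simp only [Finset.coe_Icc, Set.mem_Icc]
      omega
    · obtain ⟨k, hk⟩ := h1.isReducedProduct
      exact absurd hgC (hP.notMem hk)
  refine (Set.ncard_le_ncard hsub ((Finset.finite_toSet _).image _)).trans
    ((Set.ncard_image_le (Finset.finite_toSet _)).trans ?_)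
  rw [Set.ncard_coe_finset, Int.card_Icc]
  have : ((j * K : ℕ) + 1 - -((j * K : ℕ) : ℤ)).toNat = 2 * (j * K) + 1 := by omega
  rw [this]
  nlinarith

end Undistorted

section FreeGroupFacts

open FreeGroup in
lemma FreeGroup.exists_conj_isCyclicallyReduced {X : Type*} [DecidableEq X] (u : FreeGroup X)
    (hu : u ≠ 1) : ∃ (c : FreeGroup X) (L : List (X × Bool)), L ≠ [] ∧ IsCyclicallyReduced L ∧
      u = c * mk L * c⁻¹ := by
  have h : u = mk (reduceCyclically.conjugator u.toWord) *
      mk (reduceCyclically u.toWord) * (mk (reduceCyclically.conjugator u.toWord))⁻¹ := by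
    rw [inv_mk, mul_mk, mul_mk, reduceCyclically.conj_conjugator_reduceCyclically, mk_toWord]
  refine ⟨_, _, fun h0 => hu ?_, reduceCyclically.isCyclicallyReduced isReduced_toWord, h⟩
  rw [h, h0, ← one_eq_mk]
  group

lemma FreeGroup.norm_mk_zpow {X : Type*} [DecidableEq X] {L : List (X × Bool)}
    (hL : IsCyclicallyReduced L) (a : ℤ) : norm (mk L ^ a) = a.natAbs * L.length := by
  have h (n : ℕ) : norm (mk L ^ n) = n * L.length := by
    rw [norm, pow_mk, toWord_mk, (hL.flatten_replicate n).isReduced.reduce_eq]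
    simp
  obtain ha | ha := Int.natAbs_eq a
  · rw [ha, zpow_natCast, h, Int.natAbs_natCast]
  · rw [ha, zpow_neg, norm_inv_eq, zpow_natCast, h, Int.natAbs_neg, Int.natAbs_natCast]

lemma FreeGroup.exists_norm_conj_zpow {X : Type*} [DecidableEq X] [Nontrivial X]
    {L : List (X × Bool)} (hL : IsCyclicallyReduced L) (hne : L ≠ []) :
    ∃ t : FreeGroup X, ∀ a : ℤ, a ≠ 0 →
      norm (t * mk L ^ a * t⁻¹) = a.natAbs * L.length + 2 := by
  obtain ⟨t, ht⟩ : ∃ t : X × Bool, IsReduced ([t] ++ L ++ [(t.1, !t.2)]) := by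
    have key (t : X × Bool) (h₁ : t.1 = (L.head hne).1 → t.2 = (L.head hne).2)
        (h₂ : (L.getLast hne).1 = t.1 → (L.getLast hne).2 = !t.2) :
        IsReduced ([t] ++ L ++ [(t.1, !t.2)]) := by
      rw [IsReduced, List.isChain_append, List.isChain_append]
      refine ⟨⟨by simp, hL.isReduced, ?_⟩, by simp, ?_⟩
      · intro x hx y hy
        rw [List.head?_eq_some_head hne] at hy
        simp only [List.getLast?_singleton, Option.mem_def, Option.some.injEq] at hx hy
        subst hx hy
        exact h₁
      · intro x hx y hy
        rw [List.getLast?_append_of_ne_nil _ hne, List.getLast?_eq_some_getLast hne] at hx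
        simp only [List.head?_cons, Option.mem_def, Option.some.injEq] at hx hy
        subst hx hy
        exact h₂
    by_cases h : (L.head hne).1 = (L.getLast hne).1
    · obtain ⟨x, hx⟩ := exists_ne (L.head hne).1
      exact ⟨(x, true), key _ (fun h' => absurd h' hx) fun h' => absurd (h'.symm.trans h.symm) hx⟩
    · exact ⟨L.head hne, key _ (fun _ => rfl) fun h' => absurd h'.symm h⟩
  have hn (n : ℕ) (hn : n ≠ 0) : norm (mk [t] * mk L ^ n * (mk [t])⁻¹) = n * L.length + 2 := by
    have := IsReduced.append_flatten_replicate_append hL ht hn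
    rw [norm, pow_mk, inv_mk, mul_mk, mul_mk, toWord_mk]
    rw [show invRev [t] = [(t.1, !t.2)] by simp [invRev], this.reduce_eq]
    simp
  refine ⟨mk [t], fun a ha => ?_⟩
  have ha' : a.natAbs ≠ 0 := by simpa using ha
  obtain h | h := Int.natAbs_eq a
  · have := hn _ ha'
    rwa [← zpow_natCast, ← h] at this
  · have := hn _ ha'
    rw [← zpow_natCast, ← norm_inv_eq, mul_inv_rev, mul_inv_rev, ← zpow_neg, ← h, inv_inv,
      ← mul_assoc] at this
    exact this

variable {F : Type*} [Group F] [IsFreeGroup F]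

/-- A translation-length function: the word length relative to a conjugated basis. -/
lemma IsFreeGroup.exists_length {u : F} (hu : u ≠ 1) :
    ∃ (ℓ : F → ℕ) (τ : ℕ), 0 < τ ∧ (∀ x y, ℓ (x * y) ≤ ℓ x + ℓ y) ∧
      ∀ a : ℤ, ℓ (u ^ a) = a.natAbs * τ := by
  classical
  let e := IsFreeGroup.toFreeGroup F
  obtain ⟨c, L, hne, hL, h⟩ := FreeGroup.exists_conj_isCyclicallyReduced (e u) (by simpa using hu)
  refine ⟨fun x => (c⁻¹ * e x * c).norm, L.length, List.length_pos_iff.2 hne, fun x y => ?_,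
    fun a => ?_⟩
  · simp only [map_mul]
    convert FreeGroup.norm_mul_le (c⁻¹ * e x * c) (c⁻¹ * e y * c) using 2
    group
  · simp only [map_zpow, h, ← FreeGroup.norm_mk_zpow hL, conj_zpow]
    congr 1
    group

lemma IsFreeGroup.exists_conj_zpow [Nontrivial (IsFreeGroup.Generators F)] {u : F} (hu : u ≠ 1) :
    ∃ α : F, ∀ i j : ℤ, α⁻¹ * u ^ i * α = u ^ j → i = 0 := by
  classical
  let e := IsFreeGroup.toFreeGroup F
  obtain ⟨c, L, hne, hL, h⟩ := FreeGroup.exists_conj_isCyclicallyReduced (e u) (by simpa using hu)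
  obtain ⟨t, ht⟩ := FreeGroup.exists_norm_conj_zpow hL hne
  obtain ⟨α, hα⟩ := e.surjective (c * t⁻¹ * c⁻¹)
  have hconj (i j : ℤ) (hi : i ≠ 0) (hij : α⁻¹ * u ^ i * α = u ^ j) :
      i.natAbs * L.length + 2 = j.natAbs * L.length := by
    rw [← ht i hi, ← FreeGroup.norm_mk_zpow hL]
    congr 1
    replace hij := congrArg (fun x => c⁻¹ * e x * c) hij
    simp only [map_mul, map_inv, map_zpow, hα, h, conj_zpow, mul_inv_rev, inv_inv] at hij
    convert hij using 1 <;> group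
  refine ⟨α, fun i j hij => ?_⟩
  by_contra hi
  have h₁ := hconj i j hi hij
  have h₂ := hconj (i * 2) (j * 2) (by simpa using hi) (by
    rw [zpow_mul, zpow_mul, ← hij]
    simp only [zpow_ofNat, pow_two]
    group)
  rw [Int.natAbs_mul, Int.natAbs_mul] at h₂
  simp only [Int.reduceAbs] at h₂
  nlinarith

lemma notMem_zpowers_of_conj_zpow {u α : F}
    (hα : ∀ i j : ℤ, α⁻¹ * u ^ i * α = u ^ j → i = 0) :
    α * α ∉ Subgroup.zpowers u ∧ α ∉ Subgroup.zpowers u := by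
  have hmem : α ∉ Subgroup.zpowers u := by
    rintro ⟨k, rfl⟩
    have := hα 1 1 (by group)
    simp at this
  refine ⟨?_, hmem⟩
  rintro ⟨k, hk⟩
  have hk : u ^ k = α * α := hk
  obtain rfl : k = 0 := hα k k (by rw [hk]; group)
  have : IsMulTorsionFree F := by
    have e := IsFreeGroup.toFreeGroup F
    exact Function.Injective.isMulTorsionFree e.toMonoidHom e.injective
  rw [zpow_zero, ← pow_two, eq_comm, pow_eq_one_iff_left two_ne_zero] at hk
  exact hmem (hk ▸ one_mem _)

lemma IsFreeGroup.nontrivial_generators {F : Type u} [Group F] [IsFreeGroup F] {x : F}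
    (hx : x ≠ 1) (hprim : ¬ ∃ (p : F) (k : ℤ), IsPrimitiveElement p ∧ x = p ^ k) :
    Nontrivial (IsFreeGroup.Generators F) := by
  by_contra h
  rw [not_nontrivial_iff_subsingleton] at h
  let e := IsFreeGroup.toFreeGroup F
  rcases isEmpty_or_nonempty (IsFreeGroup.Generators F) with h0 | ⟨⟨i⟩⟩
  · exact hx (e.injective (Subsingleton.elim _ _))
  · refine hprim ⟨e.symm (FreeGroup.of i), ?_⟩
    have h := FreeGroup.closure_range_of (IsFreeGroup.Generators F)
    have := Nonempty.intro i
    rw [(Set.range_eq_singleton_iff (y := FreeGroup.of i)).2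
      fun j => by rw [Subsingleton.elim j i]] at h
    obtain ⟨k, hk⟩ := Subgroup.mem_closure_singleton.1 (h ▸ Subgroup.mem_top (e x))
    refine ⟨k, ⟨_, IsFreeGroup.basis F, i, rfl⟩, ?_⟩
    rw [← map_zpow, hk, e.symm_apply_apply]

end FreeGroupFacts

section Pushout

lemma Group.FG.countable {G : Type*} [Group G] [Group.FG G] : Countable G := by
  obtain ⟨S, hS⟩ := (Group.fg_def (G := G)).1 inferInstance
  have : Countable (FreeGroup S) := inferInstanceAs (Countable (Quot _))
  have h : Function.Surjective (FreeGroup.lift ((↑) : S → G)) := by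
    rw [← MonoidHom.range_eq_top, FreeGroup.range_lift_eq_closure]
    simpa using hS
  exact h.countable

open Monoid in
/-- A group mapping compatibly to a pushout of injections, and generated by the two factors, is an
internal amalgam. -/
lemma isInternalAmalgam_of_hom {G H : Type*} {M : Bool → Type*} [Group G] [Group H]
    [∀ i, Group (M i)] {φ : ∀ i, H →* M i} (hφ : ∀ i, Function.Injective (φ i))
    {j : ∀ i, M i →* G} {k : H →* G} (hj : ∀ i, (j i).comp (φ i) = k)
    {Φ : G →* PushoutI φ} (hΦ : ∀ i x, Φ (j i x) = PushoutI.of i x)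
    (hsup : (j true).range ⊔ (j false).range = ⊤) :
    IsInternalAmalgam (fun i => (j i).range) k.range := by
  have hword {a b : Bool} {x : G} (hx : IsReducedProduct (fun i => (j i).range) k.range a b x) :
      ∃ w : CoprodI.Word M, PushoutI.Reduced φ w ∧ w.fstIdx = some a ∧
        PushoutI.ofCoprodI w.prod = Φ x := by
    have hrange {i : Bool} {y : M i} (hy : j i y ∉ k.range) : y ∉ (φ i).range := by
      rintro ⟨h, rfl⟩
      exact hy ⟨h, by rw [← hj i]; rfl⟩
    have hcons {i : Bool} {y : M i} (hy : j i y ∉ k.range) (w : CoprodI.Word M)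
        (hw : PushoutI.Reduced φ w) (hi : w.fstIdx ≠ some i) :
        ∃ w' : CoprodI.Word M, PushoutI.Reduced φ w' ∧ w'.fstIdx = some i ∧
          PushoutI.ofCoprodI (φ := φ) w'.prod = Φ (j i y) * PushoutI.ofCoprodI w.prod := by
      refine ⟨.cons y w hi fun h => hy (by simp [h, one_mem]), ?_, CoprodI.Word.fstIdx_cons .., ?_⟩
      · rintro g hg
        obtain rfl | hg := List.mem_cons.1 hg
        · exact hrange hy
        · exact hw g hg
      · rw [CoprodI.Word.prod_cons, map_mul, PushoutI.ofCoprodI_of, hΦ]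
    induction hx with
    | single hx hxC =>
      obtain ⟨y, rfl⟩ := hx
      simpa using hcons hxC .empty (by simp [PushoutI.Reduced, CoprodI.Word.empty])
        (by simp [CoprodI.Word.fstIdx, CoprodI.Word.empty])
    | cons hx hxC _ ih =>
      obtain ⟨y, rfl⟩ := hx
      obtain ⟨w, hw, hi, hprod⟩ := ih
      rw [map_mul, ← hprod]
      exact hcons hxC w hw (by simp [hi])
  refine ⟨?_, hsup, ?_⟩
  · rintro i _ ⟨h, rfl⟩
    exact ⟨φ i h, by rw [← hj i]; rfl⟩
  · rintro a b _ hx ⟨h, rfl⟩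
    obtain ⟨w, hw, hi, hprod⟩ := hword hx
    obtain rfl := hw.eq_empty_of_mem_range hφ (by
      refine ⟨h, ?_⟩
      rw [hprod, ← hj true, MonoidHom.comp_apply, hΦ, PushoutI.of_apply_eq_base])
    simp [CoprodI.Word.fstIdx, CoprodI.Word.empty] at hi

variable {A B G H : Type*} [Group A] [Group B] [Group G] [Group H]
  {f : H →* A} {g : H →* B} {ia : A →* G} {ib : B →* G}

lemma IsGroupPushout.existsUnique_hom (h : IsGroupPushout.{_, _, _, _, u} f g ia ib)
    {K : Type*} [Group K] [Small.{u} K] (ja : A →* K) (jb : B →* K)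
    (hj : ja.comp f = jb.comp g) : ∃! φ : G →* K, φ.comp ia = ja ∧ φ.comp ib = jb := by
  let e : Shrink.{u} K ≃* K := Shrink.mulEquiv
  obtain ⟨φ, ⟨h₁, h₂⟩, huniq⟩ := h.2 (Shrink.{u} K) (e.symm.toMonoidHom.comp ja)
    (e.symm.toMonoidHom.comp jb) (by rw [MonoidHom.comp_assoc, hj, MonoidHom.comp_assoc])
  refine ⟨e.toMonoidHom.comp φ, ⟨?_, ?_⟩, fun ψ ⟨hψ₁, hψ₂⟩ => ?_⟩
  · rw [MonoidHom.comp_assoc, h₁]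
    ext
    simp
  · rw [MonoidHom.comp_assoc, h₂]
    ext
    simp
  · rw [← huniq (e.symm.toMonoidHom.comp ψ) ⟨by rw [MonoidHom.comp_assoc, hψ₁],
      by rw [MonoidHom.comp_assoc, hψ₂]⟩]
    ext
    simp

lemma IsGroupPushout.range_sup_range [Small.{u} G] (h : IsGroupPushout.{_, _, _, _, u} f g ia ib) :
    ia.range ⊔ ib.range = ⊤ := by
  set N := ia.range ⊔ ib.range with hN
  have : Small.{u} N := small_subset (Set.subset_univ _)
  have hA (a : A) : ia a ∈ N := Subgroup.mem_sup_left ⟨a, rfl⟩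
  have hB (b : B) : ib b ∈ N := Subgroup.mem_sup_right ⟨b, rfl⟩
  obtain ⟨ψ, ⟨h₁, h₂⟩, -⟩ := h.existsUnique_hom (ia.codRestrict N hA) (ib.codRestrict N hB) (by
    ext x
    exact DFunLike.congr_fun h.1 x)
  have hψ : N.subtype.comp ψ = MonoidHom.id G :=
    (h.existsUnique_hom ia ib h.1).unique
      ⟨by rw [MonoidHom.comp_assoc, h₁]; rfl, by rw [MonoidHom.comp_assoc, h₂]; rfl⟩ ⟨rfl, rfl⟩
  refine eq_top_iff.2 fun x _ => ?_
  have hx : (ψ x : G) = x := DFunLike.congr_fun hψ x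
  exact hx ▸ (ψ x).2

open Monoid in
/-- The factors of a pushout of injective homomorphisms embed, and the pushout is the amalgam of
their images. The family `M` only serves to index the two factors by `Bool`. -/
lemma IsGroupPushout.isInternalAmalgam_of_family {H : Type} [Group H] {f : H →* A} {g : H →* B}
    [Small.{u} G] (h : IsGroupPushout.{_, _, _, _, u} f g ia ib) (hf : Function.Injective f)
    (hg : Function.Injective g) {M : Bool → Type} [∀ i, Group (M i)] (eA : M true ≃* A)
    (eB : M false ≃* B) :
    Function.Injective ia ∧ Function.Injective ib ∧
      IsInternalAmalgam (fun i => bif i then ia.range else ib.range) (ia.comp f).range := by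
  let φ : ∀ i, H →* M i
    | true => eA.symm.toMonoidHom.comp f
    | false => eB.symm.toMonoidHom.comp g
  let j : ∀ i, M i →* G
    | true => ia.comp eA.toMonoidHom
    | false => ib.comp eB.toMonoidHom
  have hφ : ∀ i, Function.Injective (φ i)
    | true => eA.symm.injective.comp hf
    | false => eB.symm.injective.comp hg
  have hj : ∀ i, (j i).comp (φ i) = ia.comp f
    | true => by ext; simp [j, φ]
    | false => by rw [h.1]; ext; simp [j, φ]
  obtain ⟨Φ, ⟨h₁, h₂⟩, -⟩ := h.existsUnique_hom
    ((PushoutI.of (φ := φ) true).comp eA.symm.toMonoidHom)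
    ((PushoutI.of (φ := φ) false).comp eB.symm.toMonoidHom) (by
      rw [MonoidHom.comp_assoc, MonoidHom.comp_assoc]
      exact (PushoutI.of_comp_eq_base true).trans (PushoutI.of_comp_eq_base false).symm)
  have hΦ : ∀ i x, Φ (j i x) = PushoutI.of i x
    | true, x => by simpa [j] using DFunLike.congr_fun h₁ (eA x)
    | false, x => by simpa [j] using DFunLike.congr_fun h₂ (eB x)
  have hrange : (fun i => (j i).range) = fun i => bif i then ia.range else ib.range := by
    funext i
    cases i
    · exact SetLike.coe_injective (eB.surjective.range_comp _)
    · exact SetLike.coe_injective (eA.surjective.range_comp _)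
  refine ⟨?_, ?_, ?_⟩
  · refine Function.Injective.of_comp (f := Φ) ?_
    rw [← MonoidHom.coe_comp, h₁]
    exact (PushoutI.of_injective hφ true).comp eA.symm.injective
  · refine Function.Injective.of_comp (f := Φ) ?_
    rw [← MonoidHom.coe_comp, h₂]
    exact (PushoutI.of_injective hφ false).comp eB.symm.injective
  · rw [← hrange]
    refine isInternalAmalgam_of_hom hφ hj hΦ ?_
    have := h.range_sup_range
    rwa [← show (j true).range = ia.range from congrFun hrange true,
      ← show (j false).range = ib.range from congrFun hrange false] at this

lemma IsGroupPushout.isInternalAmalgam {H : Type} [Group H] {f : H →* A} {g : H →* B}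
    [Countable A] [Countable B] [Countable G] (h : IsGroupPushout.{_, _, _, _, u} f g ia ib)
    (hf : Function.Injective f) (hg : Function.Injective g) :
    Function.Injective ia ∧ Function.Injective ib ∧
      IsInternalAmalgam (fun i => bif i then ia.range else ib.range) (ia.comp f).range := by
  let M : Bool → Type
    | true => Shrink.{0} A
    | false => Shrink.{0} B
  let : ∀ i, Group (M i)
    | true => inferInstanceAs (Group (Shrink.{0} A))
    | false => inferInstanceAs (Group (Shrink.{0} B))
  exact h.isInternalAmalgam_of_family hf hg (M := M) Shrink.mulEquiv Shrink.mulEquiv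

end Pushout

/-- A cyclically pinched one-relator group `G = F₁ ∗_{U=V} F₂`, the amalgamated free product
of finitely generated free groups `F₁`, `F₂` identifying the cyclic subgroup generated by a
nontrivial `U ∈ F₁` with the cyclic subgroup generated by a nontrivial `V ∈ F₂` via `U ↦ V`
(realized as the pushout of the homomorphisms `ℤ →* F₁` and `ℤ →* F₂` sending `1` to `U`
and `V` respectively), satisfies the strong generic free group property with respect to
every finite generating set, provided `U` is not a power of a primitive element of `F₁`
and `V` is not a power of a primitive element of `F₂`. -/
theorem cyclicallyPinched_hasStrongGenericFreeGroupProperty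
    {F₁ F₂ G : Type*} [Group F₁] [Group F₂] [Group G]
    [IsFreeGroup F₁] [IsFreeGroup F₂] [Group.FG F₁] [Group.FG F₂]
    (U : F₁) (V : F₂) (hU : U ≠ 1) (hV : V ≠ 1)
    (f : Multiplicative ℤ →* F₁) (g : Multiplicative ℤ →* F₂)
    (hf : f (Multiplicative.ofAdd 1) = U) (hg : g (Multiplicative.ofAdd 1) = V)
    (ia : F₁ →* G) (ib : F₂ →* G) (hpush : IsGroupPushout f g ia ib)
    (hUprim : ¬ ∃ (p : F₁) (k : ℤ), IsPrimitiveElement p ∧ U = p ^ k)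
    (hVprim : ¬ ∃ (p : F₂) (k : ℤ), IsPrimitiveElement p ∧ V = p ^ k) :
    HasStrongGenericFreeGroupProperty G := by
  intro S hS hgen
  have : Group.FG G := (Group.fg_iff).2 ⟨S, hgen, hS⟩
  have : Countable F₁ := Group.FG.countable
  have : Countable F₂ := Group.FG.countable
  have : Countable G := Group.FG.countable
  have hf' (a : ℤ) : f (.ofAdd a) = U ^ a := by
    rw [← hf, ← map_zpow, ← ofAdd_zsmul, smul_eq_mul, mul_one]
  have hg' (a : ℤ) : g (.ofAdd a) = V ^ a := by
    rw [← hg, ← map_zpow, ← ofAdd_zsmul, smul_eq_mul, mul_one]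
  have : Nontrivial (IsFreeGroup.Generators F₁) := IsFreeGroup.nontrivial_generators hU hUprim
  have : Nontrivial (IsFreeGroup.Generators F₂) := IsFreeGroup.nontrivial_generators hV hVprim
  obtain ⟨α, hα⟩ := IsFreeGroup.exists_conj_zpow hU
  obtain ⟨β, hβ⟩ := IsFreeGroup.exists_conj_zpow hV
  obtain ⟨ℓ₁, τ₁, hτ₁, hℓ₁, hℓU⟩ := IsFreeGroup.exists_length hU
  obtain ⟨ℓ₂, τ₂, hτ₂, hℓ₂, hℓV⟩ := IsFreeGroup.exists_length hV
  have hf_inj : Function.Injective f := by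
    refine (injective_iff_map_eq_one f).2 fun a ha => ?_
    have ha : U ^ a.toAdd = 1 := (hf' a.toAdd).symm.trans ha
    exact hα a.toAdd 0 (by rw [ha]; simp)
  have hg_inj : Function.Injective g := by
    refine (injective_iff_map_eq_one g).2 fun a ha => ?_
    have ha : V ^ a.toAdd = 1 := (hg' a.toAdd).symm.trans ha
    exact hβ a.toAdd 0 (by rw [ha]; simp)
  obtain ⟨hia, hib, hP⟩ := hpush.isInternalAmalgam hf_inj hg_inj
  have hUV : ia U = ib V := by
    rw [← hf, ← hg]
    exact DFunLike.congr_fun hpush.1 _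
  have hC : (ia.comp f).range = Subgroup.zpowers (ia U) := by
    ext x
    constructor
    · rintro ⟨a, rfl⟩
      exact ⟨a.toAdd, (map_zpow ia U a.toAdd).symm.trans (congrArg ia (hf' a.toAdd).symm)⟩
    · rintro ⟨a, rfl⟩
      exact ⟨.ofAdd a, by rw [MonoidHom.comp_apply, hf', map_zpow]⟩
  have hCa {x : F₁} (hx : x ∉ Subgroup.zpowers U) : ia x ∉ (ia.comp f).range := by
    rintro ⟨a, ha⟩
    exact hx ⟨a.toAdd, hia ((congrArg ia (hf' a.toAdd)).symm.trans ha)⟩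
  have hCb {x : F₂} (hx : x ∉ Subgroup.zpowers V) : ib x ∉ (ia.comp f).range := by
    rw [hpush.1]
    rintro ⟨a, ha⟩
    exact hx ⟨a.toAdd, hib ((congrArg ib (hg' a.toAdd)).symm.trans ha)⟩
  obtain ⟨c, hc⟩ := hP.exists_zpowers_inter_le hS (u := ia U) (τ := τ₁ * τ₂)
    (ℓ := fun i => bif i then Function.extend ia (fun x => ℓ₁ x * τ₂) 0
      else Function.extend ib (fun x => ℓ₂ x * τ₁) 0)
    (by
      rintro (_ | _) _ ⟨x, rfl⟩ _ ⟨y, rfl⟩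
      · simp only [cond_false, ← map_mul, hib.extend_apply, ← add_mul]
        exact Nat.mul_le_mul_right _ (hℓ₂ x y)
      · simp only [cond_true, ← map_mul, hia.extend_apply, ← add_mul]
        exact Nat.mul_le_mul_right _ (hℓ₁ x y))
    hC (Nat.mul_pos hτ₁ hτ₂)
    (by
      rintro (_ | _) a
      · rw [hUV, ← map_zpow, cond_false, hib.extend_apply, hℓV]
        ring
      · rw [← map_zpow, cond_true, hia.extend_apply, hℓU]
        ring)
  refine (hP.isWallSystem hS hgen (α := ia α) (β := ib β) ⟨α, rfl⟩ ?_ ⟨β, rfl⟩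
    (hCb (notMem_zpowers_of_conj_zpow hβ).2) ?_ hc).strongGenericFreeGroupProperty hS hgen
  · rw [← map_mul]
    exact hCa (notMem_zpowers_of_conj_zpow hα).1
  · rw [hC]
    rintro _ ⟨i, rfl⟩ ⟨k, hk⟩
    have hk : ia (U ^ k) = ia (α⁻¹ * U ^ i * α) := by simpa using hk
    obtain rfl : i = 0 := hα i k (hia hk).symm
    exact zpow_zero _
end
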